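/- arXiv:1906.12206 — 2 statements merged into one kernel-verified Lean document; each statement's English description precedes it below -/
import Mathlib

section
/- Let p ≥ 5 be a prime and let 𝔽̄_p be an algebraic closure of 𝔽_p. Suppose j ∈ 𝔽̄_p is a supersingular j-invariant, i.e., ss_p(j) = 0, and y ∈ 𝔽̄_p satisfies R₂(j,y) = 0 or R₃(j,y) = 0. Then y lies in the quadratic subfield 𝔽_{p²} of 𝔽̄_p, i.e., y^{p²} = y. -/
open Polynomial

/-- The supersingular polynomial `ss_p(x) = x^r (x-1728)^s J_p(x)` over `𝔽_p`,
where `n_p = ⌊p/12⌋`, `r = 1` iff `p ≡ 2 (mod 3)`, `s = 1` iff `p ≡ 3 (mod 4)`,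
and `J_p(t) = Σ_{k=0}^{n_p} C(2n_p+s,2k+s) C(2n_p-2k,n_p-k)(-432)^{n_p-k}(t-1728)^k`.
Its roots in an algebraic closure of `𝔽_p` are exactly the supersingular
`j`-invariants in characteristic `p`. -/
noncomputable def ssp (p : ℕ) : Polynomial (ZMod p) :=
  X ^ (if p % 3 = 2 then 1 else 0) *
  (X - 1728) ^ (if p % 4 = 3 then 1 else 0) *
  ∑ k ∈ Finset.range (p / 12 + 1),
    (Nat.choose (2 * (p / 12) + (if p % 4 = 3 then 1 else 0))
        (2 * k + (if p % 4 = 3 then 1 else 0)) : Polynomial (ZMod p)) *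
    (Nat.choose (2 * (p / 12) - 2 * k) (p / 12 - k) : Polynomial (ZMod p)) *
    (-432) ^ (p / 12 - k) * (X - 1728) ^ k

theorem two_ne_zero_of_five_le {K : Type*} [Field K] {p : ℕ} [CharP K p] (hp : 5 ≤ p) :
    (2 : K) ≠ 0 := fun h => by
  have : ((2 : ℕ) : K) = 0 := by exact_mod_cast h
  have := Nat.le_of_dvd two_pos ((CharP.cast_eq_zero_iff K p 2).1 this)
  omega

theorem three_ne_zero_of_five_le {K : Type*} [Field K] {p : ℕ} [CharP K p] (hp : 5 ≤ p) :
    (3 : K) ≠ 0 := fun h => by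
  have : ((3 : ℕ) : K) = 0 := by exact_mod_cast h
  have := Nat.le_of_dvd three_pos ((CharP.cast_eq_zero_iff K p 3).1 this)
  omega

/-- Iterated Leibniz rule for a derivation. -/
theorem Derivation.iterate_leibniz {K A : Type*} [CommRing K] [CommRing A] [Algebra K A]
    (D : Derivation K A A) (a b : A) (n : ℕ) :
    D^[n] (a * b) = ∑ ij ∈ Finset.HasAntidiagonal.antidiagonal n,
      n.choose ij.1 • (D^[ij.1] a * D^[ij.2] b) := by
  induction n with
  | zero => simp
  | succ n ih =>
    rw [Finset.sum_antidiagonal_choose_succ_nsmul (M := A) (fun i j => D^[i] a * D^[j] b) n,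
      Function.iterate_succ_apply', ih, map_sum, ← Finset.sum_add_distrib]
    refine Finset.sum_congr rfl fun ij hij => ?_
    rw [n.choose_symm_of_eq_add (Finset.HasAntidiagonal.mem_antidiagonal.1 hij).symm]
    simp only [map_nsmul, Derivation.leibniz, Function.iterate_succ_apply', smul_eq_mul]
    rw [← smul_add]
    ring

/-- In characteristic `p`, the `p`-th power of a derivation is a derivation. -/
noncomputable def Derivation.charPow {K A : Type*} [CommRing K] [CommRing A] [Algebra K A]
    (p : ℕ) [Fact p.Prime] [CharP A p] (D : Derivation K A A) : Derivation K A A :=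
  Derivation.mk' ((D : A →ₗ[K] A) ^ p) fun a b => by
    have hp : p.Prime := Fact.out
    have key : ∀ x, ((D : A →ₗ[K] A) ^ p) x = D^[p] x := fun x => by
      rw [Module.End.pow_apply]; rfl
    rw [key, key, key, D.iterate_leibniz, Finset.Nat.sum_antidiagonal_eq_sum_range_succ_mk,
      Finset.sum_range_succ, ← Nat.sub_add_cancel hp.one_le, Finset.sum_range_succ',
      Nat.sub_add_cancel hp.one_le, Finset.sum_eq_zero]
    · simp [add_comm, mul_comm]
    · intro i hi
      rw [Finset.mem_range] at hi
      have : (p.choose (i + 1) : A) = 0 :=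
        (CharP.cast_eq_zero_iff A p _).2 (hp.dvd_choose_self (by omega) (by omega))
      simp [nsmul_eq_mul, this]

theorem Derivation.charPow_apply {K A : Type*} [CommRing K] [CommRing A] [Algebra K A]
    (p : ℕ) [Fact p.Prime] [CharP A p] (D : Derivation K A A) (a : A) :
    D.charPow p a = D^[p] a := by
  change ((D : A →ₗ[K] A) ^ p) a = _
  rw [Module.End.pow_apply]; rfl

/-- The derivation `2y d/dx` of the coordinate ring of `y² = f(x)`. -/
noncomputable def invariantDerivation {K : Type*} [Field K] (f : K[X]) :
    Derivation K (QuadraticAlgebra K[X] f 0) (QuadraticAlgebra K[X] f 0) :=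
  Derivation.mk'
    { toFun := fun u => ⟨2 * derivative u.im * f + u.im * derivative f, 2 * derivative u.re⟩
      map_add' := fun u v => by ext1 <;> simp <;> ring
      map_smul' := fun c u => by
        ext1 <;> simp [smul_eq_C_mul] <;> ring }
    fun u v => by
      ext1 <;> simp <;> ring

theorem invariantDerivation_mk {K : Type*} [Field K] (f a b : K[X]) :
    invariantDerivation f ⟨a, b⟩ = ⟨2 * derivative b * f + b * derivative f, 2 * derivative a⟩ :=
  rfl

theorem Polynomial.exists_derivative_eq {K : Type*} [Field K] (g : K[X])
    (hg : ∀ i : ℕ, ((i : K) + 1) = 0 → g.coeff i = 0) : ∃ G : K[X], derivative G = g := by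
  refine ⟨∑ i ∈ Finset.range (g.natDegree + 1), monomial (i + 1) (g.coeff i / (i + 1)), ?_⟩
  conv_rhs => rw [g.as_sum_range]
  rw [map_sum]
  refine Finset.sum_congr rfl fun i _ => ?_
  rw [derivative_monomial]
  simp only [Nat.add_sub_cancel, Nat.cast_add, Nat.cast_one]
  by_cases h : (i : K) + 1 = 0
  · simp [h, hg i h]
  · rw [div_mul_cancel₀ _ h]

theorem derivative_pow_mul_eq_neg {K : Type*} [Field K] {p m : ℕ} [CharP K p] (hpm : p = 2 * m + 1)
    (f : K[X]) : 2 * derivative (f ^ m) * f = - (f ^ m * derivative f) := by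
  have h2m : (2 * (m : K[X]) + 1) = 0 := by
    have : ((p : ℕ) : K[X]) = 0 := CharP.cast_eq_zero _ p
    rw [hpm] at this; exact_mod_cast this
  rcases m with _ | m
  · simp at h2m
  · rw [derivative_pow]
    simp only [Nat.add_sub_cancel, map_natCast]
    linear_combination (f ^ (m + 1) * derivative f) * h2m

/-- If the coefficient of `x^(p-1)` in `f^((p-1)/2)` vanishes, the `p`-th power of the invariant
derivation of `y² = f(x)` is zero. -/
theorem charPow_invariantDerivation_eq_zero {K : Type*} [Field K] {p m : ℕ} [Fact p.Prime]
    [CharP K p] (hpm : p = 2 * m + 1) {f : K[X]} (hf : f.Monic) (hdeg : f.natDegree = 3)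
    (hH : (f ^ m).coeff (2 * m) = 0) (u : QuadraticAlgebra K[X] f 0) :
    (invariantDerivation f)^[p] u = 0 := by
  have hp : p.Prime := Fact.out
  have : CharP (QuadraticAlgebra K[X] f 0) p :=
    charP_of_injective_algebraMap (algebraMap K (QuadraticAlgebra K[X] f 0)).injective p
  obtain ⟨G, hG⟩ : ∃ G : K[X], derivative G = f ^ m := by
    refine Polynomial.exists_derivative_eq _ fun i hi => ?_
    have hi' : ((i + 1 : ℕ) : K) = 0 := by exact_mod_cast hi
    rw [CharP.cast_eq_zero_iff K p] at hi'
    by_cases h : 3 * m < i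
    · apply coeff_eq_zero_of_natDegree_lt
      rw [hf.natDegree_pow, hdeg]; omega
    · obtain ⟨c, hc⟩ := hi'
      have : c = 1 := by
        rcases c with _ | _ | c
        · omega
        · rfl
        · have : p * (c + 1 + 1) ≥ p * 2 := Nat.mul_le_mul_left _ (by omega)
          omega
      subst this
      have : i = 2 * m := by omega
      rw [this, hH]
  have h2 : (invariantDerivation f)^[p] ⟨G, 0⟩ = 0 := by
    obtain ⟨q, hq⟩ : ∃ q, p = q + 2 := ⟨p - 2, by have := hp.two_le; omega⟩
    rw [hq, Function.iterate_add_apply]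
    have : (invariantDerivation f)^[2] ⟨G, 0⟩ = 0 := by
      rw [Function.iterate_succ_apply', Function.iterate_one, invariantDerivation_mk,
        invariantDerivation_mk, hG]
      ext1
      · have := derivative_pow_mul_eq_neg hpm f
        simp only [derivative_mul, derivative_ofNat, QuadraticAlgebra.re_zero]
        linear_combination 2 * this
      · simp
    rw [this]
    exact Function.iterate_fixed (map_zero (invariantDerivation f)) q
  set E := (invariantDerivation f).charPow p with hE
  have hEX : E ⟨X, 0⟩ = 0 := by
    have hx : ∀ P : K[X], aeval (⟨X, 0⟩ : QuadraticAlgebra K[X] f 0) P = ⟨P, 0⟩ := fun P => by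
      have := aeval_algebraMap_apply (QuadraticAlgebra K[X] f 0) (X : K[X]) P
      rw [aeval_X_left_apply] at this
      exact this
    have := E.map_aeval G ⟨X, 0⟩
    rw [hx, hx, hG, hE, Derivation.charPow_apply, h2, ← hE] at this
    have h3 : f ^ m ≠ 0 := (hf.pow m).ne_zero
    have hre := congrArg QuadraticAlgebra.re this
    have him := congrArg QuadraticAlgebra.im this
    simp [h3] at hre him
    ext1
    · exact hre
    · exact him
  have hEP : ∀ P : K[X], E ⟨P, 0⟩ = 0 := fun P => by
    have hx : aeval (⟨X, 0⟩ : QuadraticAlgebra K[X] f 0) P = ⟨P, 0⟩ := by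
      have := aeval_algebraMap_apply (QuadraticAlgebra K[X] f 0) (X : K[X]) P
      rw [aeval_X_left_apply] at this
      exact this
    rw [← hx, E.map_aeval, hEX, smul_zero]
  have hEy : E ⟨0, 1⟩ = 0 := by
    have h1 : (⟨0, 1⟩ * ⟨0, 1⟩ : QuadraticAlgebra K[X] f 0) = ⟨f, 0⟩ := by ext1 <;> simp
    have h2 := hEP f
    rw [← h1, E.leibniz] at h2
    have hre := congrArg QuadraticAlgebra.re h2
    have him := congrArg QuadraticAlgebra.im h2
    have h2' : (2 : K) ≠ 0 := by
      intro h
      have : ((2 : ℕ) : K) = 0 := by exact_mod_cast h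
      rw [CharP.cast_eq_zero_iff K p] at this
      have := Nat.le_of_dvd (by norm_num) this
      have := hp.two_le
      omega
    have h22 : (2 : K[X]) ≠ 0 := by
      rw [← C_ofNat]; exact C_ne_zero.2 h2'
    simp only [smul_eq_mul, QuadraticAlgebra.re_add, QuadraticAlgebra.re_mul, zero_mul, mul_one,
      zero_add, QuadraticAlgebra.re_zero, QuadraticAlgebra.im_add, QuadraticAlgebra.im_mul, one_mul,
      add_zero, QuadraticAlgebra.im_zero] at hre him
    ext1
    · refine (mul_eq_zero.1 ?_).resolve_left h22
      linear_combination him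
    · refine (mul_eq_zero.1 ?_).resolve_left (mul_ne_zero h22 hf.ne_zero)
      linear_combination hre
  rw [← Derivation.charPow_apply, ← hE]
  have : u = ⟨u.re, 0⟩ + ⟨u.im, 0⟩ * ⟨0, 1⟩ := by ext1 <;> simp
  rw [this, map_add, E.leibniz, hEP, hEP, hEy]
  simp

theorem eigenvalue_invariantDerivation_eq_zero {K : Type*} [Field K] {p m : ℕ} [Fact p.Prime]
    [CharP K p] (hpm : p = 2 * m + 1) {f : K[X]} (hf : f.Monic) (hdeg : f.natDegree = 3)
    (hH : (f ^ m).coeff (2 * m) = 0) {κ : K} {a b : K[X]}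
    (h1 : 2 * derivative b * f + b * derivative f = C κ * a)
    (h2 : 2 * derivative a = C κ * b) (hab : a ≠ 0 ∨ b ≠ 0) : κ = 0 := by
  have key : ∀ n, (invariantDerivation f)^[n] ⟨a, b⟩ = ⟨C (κ ^ n) * a, C (κ ^ n) * b⟩ := by
    intro n
    induction n with
    | zero => simp
    | succ n ih =>
      rw [Function.iterate_succ_apply', ih, invariantDerivation_mk]
      ext1
      · simp only [derivative_C_mul, pow_succ, C_mul]
        linear_combination C (κ ^ n) * h1
      · simp only [derivative_C_mul, pow_succ, C_mul]
        linear_combination C (κ ^ n) * h2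
  have h := charPow_invariantDerivation_eq_zero hpm hf hdeg hH ⟨a, b⟩
  rw [key p] at h
  have hre := congrArg QuadraticAlgebra.re h
  have him := congrArg QuadraticAlgebra.im h
  simp at hre him
  tauto

theorem X_sub_C_pow_char {K : Type*} [Field K] {p : ℕ} [Fact p.Prime] [CharP K p] (x₀ : K) :
    (X - C x₀) ^ p = X ^ p - C (x₀ ^ p) := by
  rw [sub_pow_char, C_pow]

theorem derivative_X_sub_C_pow_char {K : Type*} [Field K] {p : ℕ} [Fact p.Prime] [CharP K p]
    (x₀ : K) : derivative ((X - C x₀) ^ p) = 0 := by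
  rw [X_sub_C_pow_char, derivative_sub, derivative_X_pow, derivative_C]
  simp

theorem X_sub_C_pow_dvd_norm {K : Type*} [Field K] {p m : ℕ} [Fact p.Prime] [CharP K p]
    (hpm : p = 2 * m + 1) {f : K[X]} {x₀ y₀ : K} (hy : y₀ ^ 2 = f.eval x₀) (hy0 : y₀ ≠ 0)
    {a b : K[X]} (h : (X - C x₀) ^ p ∣ a * f ^ m - C (y₀ ^ p) * b) :
    (X - C x₀) ^ p ∣ a ^ 2 - b ^ 2 * f := by
  have hY : IsUnit (C (y₀ ^ p) ^ 2) := by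
    rw [← C_pow, isUnit_C]; exact (pow_ne_zero _ (pow_ne_zero _ hy0)).isUnit
  refine (hY.dvd_mul_left).1 ?_
  have h1 : (X - C x₀) ^ p ∣ f ^ p - C (y₀ ^ p) ^ 2 := by
    rw [← C_pow, ← pow_mul, mul_comm p 2, pow_mul, hy, C_pow, ← sub_pow_char]
    exact pow_dvd_pow_of_dvd (dvd_iff_isRoot.2 (by simp)) p
  have h2 : C (y₀ ^ p) ^ 2 * (a ^ 2 - b ^ 2 * f) =
      (a * f ^ m - C (y₀ ^ p) * b) * ((a * f ^ m + C (y₀ ^ p) * b) * f) -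
        (f ^ p - C (y₀ ^ p) ^ 2) * a ^ 2 := by
    rw [hpm]; ring
  rw [h2]
  exact dvd_sub (h.mul_right _) (h1.mul_right _)

theorem X_sub_C_pow_dvd_derivation {K : Type*} [Field K] {p m : ℕ} [Fact p.Prime] [CharP K p]
    (hpm : p = 2 * m + 1) {f : K[X]} {x₀ y₀ : K} (hy0 : y₀ ≠ 0)
    {a b : K[X]} (h : (X - C x₀) ^ p ∣ a * f ^ m - C (y₀ ^ p) * b) :
    (X - C x₀) ^ p ∣
      (2 * derivative b * f + b * derivative f) * a - 2 * derivative a * b * f := by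
  have hY : IsUnit (C (y₀ ^ p)) := by
    rw [isUnit_C]; exact (pow_ne_zero _ hy0).isUnit
  refine (hY.dvd_mul_left).1 ?_
  obtain ⟨c, hc⟩ := h
  have hd := congrArg derivative hc
  rw [derivative_sub, derivative_mul, derivative_C_mul, derivative_mul,
    derivative_X_sub_C_pow_char] at hd
  have hf := derivative_pow_mul_eq_neg hpm f
  refine ⟨-2 * derivative c * f * a - c * derivative f * a + 2 * derivative a * f * c, ?_⟩
  linear_combination (-2 * f * a) * hd + a ^ 2 * hf +
    (2 * derivative a * f - derivative f * a) * hc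

/-- If `δv` times the conjugate of `v` is `κ` times the norm of `v` and the norm is a constant of
the derivation, then `v` is an eigenvector of `δ`. -/
theorem eigenvector_of_norm {K : Type*} [Field K] {f a b κ : K[X]} (hN : a ^ 2 - b ^ 2 * f ≠ 0)
    (hN' : derivative (a ^ 2 - b ^ 2 * f) = 0)
    (hκ : (2 * derivative b * f + b * derivative f) * a - 2 * derivative a * b * f =
      κ * (a ^ 2 - b ^ 2 * f)) :
    2 * derivative b * f + b * derivative f = κ * a ∧ 2 * derivative a = κ * b := by
  simp only [derivative_sub, derivative_mul, derivative_pow, Nat.cast_ofNat, Nat.add_one_sub_one,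
    pow_one, map_ofNat] at hN'
  constructor
  · refine mul_right_cancel₀ hN ?_
    linear_combination a * hκ + b * f * hN'
  · refine mul_right_cancel₀ hN ?_
    linear_combination b * hκ + a * hN'

theorem eq_zero_of_derivation_eq_zero {K : Type*} [Field K] {p : ℕ} [Fact p.Prime] [CharP K p]
    {f b : K[X]} {e₁ e₂ : K} (he : e₁ ≠ e₂) (h1 : f.eval e₁ = 0) (h2 : f.eval e₂ = 0)
    (hf : f ≠ 0) (hdeg : (b ^ 2 * f).natDegree < 2 * p)
    (hb : 2 * derivative b * f + b * derivative f = 0) : b = 0 := by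
  have hp : p.Prime := Fact.out
  have hd : derivative (b ^ 2 * f) = 0 := by
    simp only [derivative_mul, derivative_pow, Nat.cast_ofNat, Nat.add_one_sub_one,
      pow_one, map_ofNat]
    linear_combination b * hb
  have hexp := expand_contract p hd hp.ne_zero
  set g := contract p (b ^ 2 * f) with hg
  have hgdeg : g.natDegree ≤ 1 := by
    rw [← hexp, natDegree_expand] at hdeg
    have := Nat.lt_of_mul_lt_mul_right hdeg
    omega
  obtain ⟨c, d, hcd⟩ := exists_eq_X_add_C_of_natDegree_le_one hgdeg
  have key : ∀ x, f.eval x = 0 → c * x ^ p + d = 0 := fun x hx => by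
    have : (b ^ 2 * f).eval x = 0 := by simp [hx]
    rw [← hexp, expand_eval, hcd] at this
    simpa using this
  have k1 := key e₁ h1
  have k2 := key e₂ h2
  have k3 : c * (e₁ - e₂) ^ p = 0 := by
    rw [sub_pow_char]; linear_combination k1 - k2
  have hc : c = 0 := (mul_eq_zero.1 k3).resolve_right (pow_ne_zero _ (sub_ne_zero.2 he))
  have hd0 : d = 0 := by simpa [hc] using k1
  rw [hcd, hc, hd0] at hexp
  simp [hf] at hexp
  exact hexp

/-- The cubic `f = (x - e₀)(x - e₁)(x - e₂)` has distinct roots and the coefficient of `x^(p-1)` in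
`f^((p-1)/2)` vanishes, where `p = 2m + 1`; equivalently `y² = f(x)` is a supersingular elliptic
curve. -/
structure SupersingularCubic {K : Type*} [Field K] (m : ℕ) (e : Fin 3 → K) (f : K[X]) : Prop where
  injective : Function.Injective e
  eq_prod : f = ∏ i, (X - C (e i))
  coeff_eq_zero : (f ^ m).coeff (2 * m) = 0

namespace SupersingularCubic

variable {K : Type*} [Field K] {p m : ℕ} {e : Fin 3 → K} {f : K[X]}

theorem monic (h : SupersingularCubic m e f) : f.Monic := by
  rw [h.eq_prod]; exact monic_prod_X_sub_C _ _

theorem natDegree_eq (h : SupersingularCubic m e f) : f.natDegree = 3 := by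
  rw [h.eq_prod, natDegree_prod_of_monic _ _ fun i _ => monic_X_sub_C _]
  simp

theorem eval_root (h : SupersingularCubic m e f) (i : Fin 3) : f.eval (e i) = 0 := by
  rw [h.eq_prod, eval_prod]
  exact Finset.prod_eq_zero (Finset.mem_univ i) (by simp)

theorem exists_root (h : SupersingularCubic m e f) {x : K} (hx : f.eval x = 0) :
    ∃ i, x = e i := by
  rw [h.eq_prod, eval_prod, Finset.prod_eq_zero_iff] at hx
  obtain ⟨i, _, hi⟩ := hx
  exact ⟨i, by simpa [sub_eq_zero] using hi⟩

theorem exists_cofactor (h : SupersingularCubic m e f) (i : Fin 3) :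
    ∃ g : K[X], f = (X - C (e i)) * g ∧ g.eval (e i) ≠ 0 := by
  refine ⟨∏ j ∈ Finset.univ.erase i, (X - C (e j)), ?_, ?_⟩
  · rw [h.eq_prod]
    exact (Finset.mul_prod_erase _ (fun j => X - C (e j)) (Finset.mem_univ i)).symm
  · rw [eval_prod, Finset.prod_ne_zero_iff]
    intro j hj
    simpa [sub_eq_zero] using fun hij => (Finset.ne_of_mem_erase hj) (h.injective hij.symm)

theorem dvd_of_dvd_root (h : SupersingularCubic m e f) (hpm : p = 2 * m + 1) (i : Fin 3)
    {a b : K[X]} (hb : b.degree < m) (hd : (X - C (e i)) ^ p ∣ a * f ^ m - b) :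
    b = 0 ∧ (X - C (e i)) ^ (m + 1) ∣ a := by
  obtain ⟨g, hg, hge⟩ := h.exists_cofactor i
  have hb0 : b = 0 := by
    refine eq_zero_of_dvd_of_degree_lt (p := (X - C (e i)) ^ m) ?_ ?_
    · have h1 : (X - C (e i)) ^ m ∣ a * f ^ m := by
        rw [hg, mul_pow]; exact (dvd_mul_right _ _).mul_left _
      exact (dvd_sub_right h1).1 ((pow_dvd_pow _ (by omega)).trans hd)
    · rw [degree_pow, degree_X_sub_C]; simpa using hb
  refine ⟨hb0, ?_⟩
  rw [hb0, sub_zero, hg, mul_pow, mul_left_comm, show p = m + (m + 1) by omega, pow_add] at hd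
  have hd' := (mul_dvd_mul_iff_left (pow_ne_zero m (X_sub_C_ne_zero (e i)))).1 hd
  refine IsCoprime.dvd_of_dvd_mul_right (IsCoprime.pow ?_) hd'
  rw [(irreducible_X_sub_C (e i)).coprime_iff_not_dvd, dvd_iff_isRoot]
  exact hge

theorem natDegree_lt_of_degree_lt {b : K[X]} (hb : b.degree < m) (hm : 0 < m) :
    b.natDegree + 1 ≤ m := by
  by_cases h0 : b = 0
  · simp [h0]; omega
  · exact (natDegree_lt_iff_degree_lt h0).2 hb

/-- There is no function on a supersingular curve with divisor `p (P) - p (O)`, nor a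
smaller pole. -/
theorem eq_zero_of_dvd [IsAlgClosed K] [Fact p.Prime] [CharP K p]
    (h : SupersingularCubic m e f) (hpm : p = 2 * m + 1) {x₀ : K}
    {a b : K[X]} (ha : a.natDegree ≤ m) (hb : b.degree < m)
    (hd : (X - C x₀) ^ p ∣ a * f ^ m - b) : a = 0 := by
  have hp : p.Prime := Fact.out
  have hm : 0 < m := by have := hp.two_le; omega
  by_cases hx : f.eval x₀ = 0
  · obtain ⟨i, rfl⟩ := h.exists_root hx
    refine eq_zero_of_dvd_of_natDegree_lt (h.dvd_of_dvd_root hpm i hb hd).2 ?_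
    rw [natDegree_pow, natDegree_X_sub_C]; omega
  obtain ⟨y₀, hy⟩ := IsAlgClosed.exists_pow_nat_eq (f.eval x₀) two_pos
  have hy0 : y₀ ≠ 0 := by rintro rfl; exact hx (by rw [← hy]; simp)
  have hY : y₀ ^ p ≠ 0 := pow_ne_zero _ hy0
  obtain ⟨c, rfl⟩ : ∃ c, b = C (y₀ ^ p) * c :=
    ⟨C (y₀ ^ p)⁻¹ * b, by rw [← mul_assoc, ← C_mul, mul_inv_cancel₀ hY]; simp⟩
  rw [degree_C_mul hY] at hb
  have hcdeg := natDegree_lt_of_degree_lt hb hm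
  have hfdeg := h.natDegree_eq
  have hc2 : (c ^ 2 * f).natDegree ≤ p := by
    refine natDegree_mul_le.trans ?_
    rw [natDegree_pow, hfdeg]; omega
  have hN := X_sub_C_pow_dvd_norm hpm hy hy0 hd
  have hκ := X_sub_C_pow_dvd_derivation hpm hy0 hd
  have hPdeg : ((X - C x₀) ^ p).natDegree = p := by simp
  have hconst : ∀ g : K[X], g.natDegree ≤ p → (X - C x₀) ^ p ∣ g →
      ∃ k, g = (X - C x₀) ^ p * C k := by
    rintro g hg ⟨q, rfl⟩
    refine ⟨q.coeff 0, ?_⟩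
    by_cases hq : q = 0
    · simp [hq]
    · rw [← eq_C_of_natDegree_eq_zero]
      rw [natDegree_mul (pow_ne_zero _ (X_sub_C_ne_zero _)) hq, hPdeg] at hg
      omega
  have ha2 : (a ^ 2).natDegree ≤ 2 * m := by rw [natDegree_pow]; omega
  have hNle : (a ^ 2 - c ^ 2 * f).natDegree ≤ p :=
    (natDegree_sub_le _ _).trans (max_le (by omega) hc2)
  by_cases hN0 : a ^ 2 - c ^ 2 * f = 0
  · by_contra ha0
    have h1 : a ^ 2 = c ^ 2 * f := sub_eq_zero.1 hN0
    have hc0 : c ≠ 0 := by rintro rfl; simp at h1; exact ha0 h1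
    have h2 := congrArg natDegree h1
    rw [natDegree_pow, natDegree_mul (pow_ne_zero _ hc0) h.monic.ne_zero, natDegree_pow,
      hfdeg] at h2
    omega
  obtain ⟨k, hk⟩ := hconst _ hNle hN
  have hk0 : k ≠ 0 := by rintro rfl; simp at hk; exact hN0 hk
  have hN' : derivative (a ^ 2 - c ^ 2 * f) = 0 := by
    rw [hk, derivative_mul, derivative_X_sub_C_pow_char]; simp
  have hda := natDegree_derivative_le a
  have hdc := natDegree_derivative_le c
  have hdf := natDegree_derivative_le f
  have hB : (2 * derivative c * f + c * derivative f).natDegree ≤ m + 1 := by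
    refine (natDegree_add_le _ _).trans (max_le ?_ ?_)
    · by_cases hc1 : derivative c = 0
      · simp [hc1]
      have : 0 < c.natDegree := by
        by_contra h0
        rw [eq_C_of_natDegree_eq_zero (Nat.eq_zero_of_not_pos h0)] at hc1
        simp at hc1
      refine natDegree_mul_le.trans ?_
      rw [← C_ofNat]
      have := natDegree_C_mul_le (2 : K) (derivative c)
      omega
    · refine natDegree_mul_le.trans ?_
      omega
  obtain ⟨l, hl⟩ := hconst _ ((natDegree_sub_le _ _).trans (max_le
    (natDegree_mul_le.trans (by omega)) (by
      by_cases ha1 : derivative a = 0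
      · simp [ha1]
      have : 0 < a.natDegree := by
        by_contra h0
        rw [eq_C_of_natDegree_eq_zero (Nat.eq_zero_of_not_pos h0)] at ha1
        simp at ha1
      refine natDegree_mul_le.trans ?_
      have := natDegree_mul_le (p := 2 * derivative a) (q := c)
      have := natDegree_C_mul_le (2 : K) (derivative a)
      rw [C_ofNat] at this
      omega))) hκ
  have hκ' : (2 * derivative c * f + c * derivative f) * a - 2 * derivative a * c * f =
      C (l / k) * (a ^ 2 - c ^ 2 * f) := by
    rw [hl, hk, mul_left_comm, ← C_mul, div_mul_cancel₀ _ hk0]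
  obtain ⟨h1, h2⟩ := eigenvector_of_norm hN0 hN' hκ'
  have hl0 : l / k = 0 := by
    refine eigenvalue_invariantDerivation_eq_zero hpm h.monic hfdeg h.coeff_eq_zero h1 h2 ?_
    by_contra! hac
    simp [hac.1, hac.2] at hN0
  rw [hl0, C_0, zero_mul] at h1 h2
  have hc0 : c = 0 := eq_zero_of_derivation_eq_zero (p := p) (f := f)
    (h.injective.ne (show (0 : Fin 3) ≠ 1 by decide)) (h.eval_root 0) (h.eval_root 1)
    h.monic.ne_zero (by omega) h1
  rw [hc0] at hN
  simp only [ne_eq, OfNat.ofNat_ne_zero, not_false_eq_true, zero_pow, zero_mul, sub_zero] at hN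
  have := eq_zero_of_dvd_of_natDegree_lt hN (by rw [hPdeg]; omega)
  exact pow_eq_zero_iff two_ne_zero |>.1 this
end SupersingularCubic

theorem Matrix.natDegree_det_le {R n : Type*} [CommRing R] [Fintype n] [DecidableEq n]
    (M : Matrix n n R[X]) {d : ℕ} (hM : ∀ i j, (M i j).natDegree ≤ d) :
    M.det.natDegree ≤ Fintype.card n * d := by
  rw [Matrix.det_apply]
  refine natDegree_sum_le_of_forall_le _ _ fun σ _ => ?_
  rw [Units.smul_def, zsmul_eq_mul, ← C_eq_intCast]
  refine (natDegree_C_mul_le _ _).trans ((natDegree_prod_le _ _).trans ?_)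
  refine (Finset.sum_le_card_nsmul _ _ d fun i _ => hM _ _).trans ?_
  simp

theorem exists_dvd_sub_of_coeff {K : Type*} [Field K] {p m : ℕ} [Fact p.Prime] [CharP K p]
    (hmp : m ≤ p) {g : K[X]} (hg : g.natDegree < 2 * p) (x₀ : K)
    (h : ∀ j, m ≤ j → j < p → g.coeff j + x₀ ^ p * g.coeff (j + p) = 0) :
    ∃ b : K[X], b.degree < m ∧ (X - C x₀) ^ p ∣ g - b ∧
      ∀ j < m, b.coeff j = g.coeff j + x₀ ^ p * g.coeff (j + p) := by
  refine ⟨∑ j ∈ Finset.range m, monomial j (g.coeff j + x₀ ^ p * g.coeff (j + p)), ?_, ?_, ?_⟩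
  · refine (degree_lt_iff_coeff_zero _ _).2 fun k hk => ?_
    rw [finsetSum_coeff]
    refine Finset.sum_eq_zero fun j hj => coeff_monomial_of_ne _ ?_
    have := Finset.mem_range.1 hj
    omega
  · have h1 : ∑ j ∈ Finset.range m, monomial j (g.coeff j + x₀ ^ p * g.coeff (j + p)) =
        ∑ j ∈ Finset.range p, monomial j (g.coeff j + x₀ ^ p * g.coeff (j + p)) := by
      refine Finset.sum_subset (by simpa using hmp) fun j hj hjm => ?_
      rw [h j (by simpa using hjm) (by simpa using hj), map_zero]
    have hg' := g.as_sum_range' _ hg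
    rw [two_mul, Finset.sum_range_add, ← Finset.sum_add_distrib] at hg'
    have h2 := congrArg (· - ∑ j ∈ Finset.range p,
      monomial j (g.coeff j + x₀ ^ p * g.coeff (j + p))) hg'
    simp only [← Finset.sum_sub_distrib] at h2
    rw [h1, h2]
    refine Finset.dvd_sum fun j _ => ⟨monomial j (g.coeff (j + p)), ?_⟩
    rw [X_sub_C_pow_char, sub_mul, C_mul_monomial, X_pow_mul_monomial, map_add, add_comm p j]
    ring
  · intro j hj
    rw [finsetSum_coeff]
    simp only [coeff_monomial]
    rw [Finset.sum_ite_eq']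
    simp [hj]

namespace SupersingularCubic

variable {K : Type*} [Field K] {p m : ℕ} {e : Fin 3 → K} {f : K[X]}

theorem exists_family [IsAlgClosed K] [Fact p.Prime] [CharP K p]
    (h : SupersingularCubic m e f) (hpm : p = 2 * m + 1) :
    ∃ α β : K[X], α.natDegree ≤ m + 1 ∧ β.natDegree ≤ m + 2 ∧ ∀ x₀ : K, ∃ a b : K[X],
      a.Monic ∧ a.natDegree = m + 1 ∧ b.degree < m ∧ (X - C x₀) ^ p ∣ a * f ^ m - b ∧
      a.coeff m = α.eval (x₀ ^ p) ∧ b.coeff (m - 1) = β.eval (x₀ ^ p) := by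
  have hp : p.Prime := Fact.out
  have hm : 0 < m := by have := hp.two_le; omega
  have hgdeg : ∀ a : K[X], a.natDegree ≤ m + 1 → (a * f ^ m).natDegree < 2 * p := fun a ha => by
    refine natDegree_mul_le.trans_lt ?_
    rw [h.monic.natDegree_pow, h.natDegree_eq]; omega
  let L : ℕ → ℕ → K[X] := fun i j =>
    C ((X ^ i * f ^ m).coeff j) + X * C ((X ^ i * f ^ m).coeff (j + p))
  have hL : ∀ i j, (L i j).natDegree ≤ 1 := fun i j =>
    (natDegree_add_le _ _).trans (max_le (by simp) (natDegree_mul_le.trans (by simp)))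
  have hLe : ∀ i j t, (L i j).eval t =
      (X ^ i * f ^ m).coeff j + t * (X ^ i * f ^ m).coeff (j + p) := fun i j t => by
    simp only [L, eval_add, eval_mul, eval_C, eval_X]
  let M : Matrix (Fin (m + 1)) (Fin (m + 1)) K[X] := fun j i => L i (m + j)
  let r : Fin (m + 1) → K[X] := fun j => -L (m + 1) (m + j)
  have hsum : ∀ (v : Fin (m + 1) → K) (j : ℕ),
      ((∑ i, C (v i) * X ^ (i : ℕ)) * f ^ m).coeff j =
        ∑ i : Fin (m + 1), v i * (X ^ (i : ℕ) * f ^ m).coeff j := fun v j => by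
    rw [Finset.sum_mul, finsetSum_coeff]
    exact Finset.sum_congr rfl fun i _ => by rw [mul_assoc, coeff_C_mul]
  have hvdeg : ∀ v : Fin (m + 1) → K, (∑ i, C (v i) * X ^ (i : ℕ)).natDegree ≤ m := fun v =>
    natDegree_sum_le_of_forall_le _ _ fun i _ => (natDegree_C_mul_X_pow_le _ _).trans (by omega)
  have hvcoeff : ∀ (v : Fin (m + 1) → K) (k : Fin (m + 1)),
      (∑ i, C (v i) * X ^ (i : ℕ)).coeff k = v k := fun v k => by
    simp [coeff_X_pow, Fin.val_inj]
  have hdet : ∀ t, M.det.eval t ≠ 0 := by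
    intro t ht
    obtain ⟨x₀, rfl⟩ := IsAlgClosed.exists_pow_nat_eq t hp.pos
    rw [← coe_evalRingHom, RingHom.map_det, ← Matrix.exists_mulVec_eq_zero_iff] at ht
    obtain ⟨v, hv, hMv⟩ := ht
    obtain ⟨b, hb, hd, -⟩ := exists_dvd_sub_of_coeff (m := m) (by omega)
      (hgdeg _ ((hvdeg v).trans (by omega))) x₀ (by
        intro j hj hjp
        have : ∑ i : Fin (m + 1), (L i (m + (j - m))).eval (x₀ ^ p) * v i = 0 :=
          congrFun hMv ⟨j - m, by omega⟩
        simp only [hLe, Nat.add_sub_cancel' hj] at this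
        rw [hsum, hsum, Finset.mul_sum, ← Finset.sum_add_distrib, ← this]
        exact Finset.sum_congr rfl fun i _ => by ring)
    have h0 := h.eq_zero_of_dvd hpm (hvdeg v) hb hd
    exact hv (funext fun k => by rw [← hvcoeff v k, h0]; simp)
  obtain ⟨d, hd⟩ : ∃ d, M.det = C d := by
    refine ⟨_, eq_C_of_degree_eq_zero ?_⟩
    by_contra hdeg
    obtain ⟨t, ht⟩ := IsAlgClosed.exists_root _ hdeg
    exact hdet t ht
  have hd0 : d ≠ 0 := by
    have := hdet 0
    rwa [hd, eval_C] at this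
  let w : Fin (m + 1) → K[X] := fun i => C d⁻¹ * M.cramer r i
  have hw : ∀ i, (w i).natDegree ≤ m + 1 := fun i => by
    refine (natDegree_C_mul_le _ _).trans ?_
    rw [Matrix.cramer_apply]
    refine (Matrix.natDegree_det_le _ (d := 1) fun j k => ?_).trans (by simp)
    rw [Matrix.updateCol_apply]
    split_ifs
    · simpa [r] using hL _ _
    · exact hL _ _
  have hMw : ∀ j : Fin (m + 1), ∑ i : Fin (m + 1), L i (m + j) * w i = -L (m + 1) (m + j) :=
      fun j => by
    have := congrFun (Matrix.mulVec_cramer M r) j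
    simp only [Matrix.mulVec, dotProduct, M, hd, Pi.smul_apply, smul_eq_mul, r] at this
    simp only [w, mul_left_comm _ (C d⁻¹), ← Finset.mul_sum]
    rw [this, ← mul_assoc, ← C_mul, inv_mul_cancel₀ hd0]
    simp
  refine ⟨w (Fin.last m), ∑ i : Fin (m + 1), L i (m - 1) * w i + L (m + 1) (m - 1), hw _, ?_,
    fun x₀ => ?_⟩
  · refine (natDegree_add_le _ _).trans (max_le ?_ ((hL _ _).trans (by omega)))
    refine natDegree_sum_le_of_forall_le _ _ fun i _ => natDegree_mul_le.trans ?_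
    have := hL i (m - 1)
    have := hw i
    omega
  let v : Fin (m + 1) → K := fun i => (w i).eval (x₀ ^ p)
  have hlow : (∑ i, C (v i) * X ^ (i : ℕ)).degree < ((m + 1 : ℕ) : WithBot ℕ) :=
    degree_lt_iff_coeff_zero _ _ |>.2 fun k hk =>
      coeff_eq_zero_of_natDegree_lt ((hvdeg v).trans_lt hk)
  set a : K[X] := X ^ (m + 1) + ∑ i, C (v i) * X ^ (i : ℕ) with ha
  have hadeg : a.natDegree = m + 1 := by
    rw [ha, natDegree_add_eq_left_of_degree_lt (by rwa [degree_X_pow]), natDegree_X_pow]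
  have hacoeff : ∀ j, (a * f ^ m).coeff j + x₀ ^ p * (a * f ^ m).coeff (j + p) =
      (∑ i : Fin (m + 1), L i j * w i + L (m + 1) j).eval (x₀ ^ p) := fun j => by
    rw [ha, add_mul, coeff_add, coeff_add, hsum, hsum, eval_add, eval_finsetSum, hLe, mul_add,
      Finset.mul_sum, add_add_add_comm, ← Finset.sum_add_distrib, add_comm]
    congr 1
    exact Finset.sum_congr rfl fun i _ => by rw [eval_mul, hLe]; simp only [v]; ring
  obtain ⟨b, hb, hdvd, hbc⟩ := exists_dvd_sub_of_coeff (m := m) (by omega)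
    (hgdeg a hadeg.le) x₀ (by
      intro j hj hjp
      have := hMw ⟨j - m, by omega⟩
      simp only [Nat.add_sub_cancel' hj] at this
      rw [hacoeff, this]; simp)
  refine ⟨a, b, monic_X_pow_add hlow, hadeg, hb, hdvd, ?_, ?_⟩
  · have := hvcoeff v (Fin.last m)
    rw [Fin.val_last] at this
    rw [ha, coeff_add, this, coeff_X_pow]
    simp [v]
  · rw [hbc _ (by omega), hacoeff]

theorem eq_of_dvd [IsAlgClosed K] [Fact p.Prime] [CharP K p]
    (h : SupersingularCubic m e f) (hpm : p = 2 * m + 1) {x₀ : K} {a b a' b' : K[X]}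
    (ha : a.Monic) (had : a.natDegree = m + 1) (hb : b.degree < m)
    (hd : (X - C x₀) ^ p ∣ a * f ^ m - b) (ha' : a'.Monic) (had' : a'.natDegree = m + 1)
    (hb' : b'.degree < m) (hd' : (X - C x₀) ^ p ∣ a' * f ^ m - b') : a = a' ∧ b = b' := by
  have hdeg : (a - a').degree < a.degree := by
    refine degree_sub_lt_left ?_ ha.ne_zero (by rw [ha.leadingCoeff, ha'.leadingCoeff])
    rw [degree_eq_natDegree ha.ne_zero, degree_eq_natDegree ha'.ne_zero, had, had']
  have hbb : (b - b').degree < m := (degree_sub_le _ _).trans_lt (max_lt hb hb')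
  have hdvd : (X - C x₀) ^ p ∣ (a - a') * f ^ m - (b - b') := by
    convert dvd_sub hd hd' using 1; ring
  have h0 : a - a' = 0 := by
    refine h.eq_zero_of_dvd hpm ?_ hbb hdvd
    rw [degree_eq_natDegree ha.ne_zero, had] at hdeg
    exact natDegree_le_iff_degree_le.2 (Order.le_of_lt_succ hdeg)
  rw [h0, zero_mul, zero_sub, dvd_neg] at hdvd
  refine ⟨sub_eq_zero.1 h0, sub_eq_zero.1 (eq_zero_of_dvd_of_degree_lt hdvd ?_)⟩
  rw [degree_pow, degree_X_sub_C]
  refine hbb.trans ?_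
  simp only [nsmul_eq_mul, mul_one]
  exact_mod_cast (by omega : m < p)

/-- The norm of a function with divisor `p (P) + (Q) - (p + 1) (O)`. -/
theorem norm_eq_of_dvd [IsAlgClosed K] [Fact p.Prime] [CharP K p]
    (h : SupersingularCubic m e f) (hpm : p = 2 * m + 1) {x₀ y₀ : K} (hy : y₀ ^ 2 = f.eval x₀)
    (hy0 : y₀ ≠ 0) {a b : K[X]} (ha : a.Monic) (had : a.natDegree = m + 1) (hb : b.degree < m)
    (hd : (X - C x₀) ^ p ∣ a * f ^ m - C (y₀ ^ p) * b) :
    a ^ 2 - b ^ 2 * f =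
      (X - C x₀) ^ p * (X - C (b.coeff (m - 1) ^ 2 - 2 * a.coeff m)) := by
  have hp : p.Prime := Fact.out
  have hm : 0 < m := by have := hp.two_le; omega
  have hbd := natDegree_lt_of_degree_lt hb hm
  have hb2 : (b ^ 2 * f).natDegree ≤ 2 * m + 1 := by
    refine natDegree_mul_le.trans ?_
    rw [natDegree_pow, h.natDegree_eq]; omega
  have ha2 : (a ^ 2).natDegree = 2 * m + 2 := by rw [natDegree_pow, had]; ring
  have hlt : (-(b ^ 2 * f)).degree < (a ^ 2).degree := by
    rw [degree_neg]
    exact degree_lt_degree (by omega)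
  have hNm : (a ^ 2 - b ^ 2 * f).Monic := by
    rw [sub_eq_add_neg]; exact (ha.pow 2).add_of_left hlt
  have hNd : (a ^ 2 - b ^ 2 * f).natDegree = 2 * m + 2 := by
    rw [sub_eq_add_neg, natDegree_add_eq_left_of_degree_lt hlt, ha2]
  obtain ⟨q, hq⟩ := X_sub_C_pow_dvd_norm hpm hy hy0 hd
  have hP : ((X - C x₀) ^ p).Monic := (monic_X_sub_C x₀).pow p
  have hqm : q.Monic := hP.of_mul_monic_left (hq ▸ hNm)
  have hqd : q.natDegree = 1 := by
    have := hP.natDegree_mul hqm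
    rw [← hq, hNd, natDegree_pow, natDegree_X_sub_C] at this
    omega
  have hqX : q = X + C (q.coeff 0) := by
    conv_lhs => rw [eq_X_add_C_of_natDegree_le_one hqd.le]
    rw [show q.coeff 1 = 1 by rw [← hqd]; exact hqm]
    simp
  have hnext : (a ^ 2 - b ^ 2 * f).nextCoeff = q.nextCoeff := by
    rw [hq, hP.nextCoeff_mul hqm, (monic_X_sub_C x₀).nextCoeff_pow]
    simp
  have hqn : q.nextCoeff = q.coeff 0 := by
    rw [nextCoeff_of_natDegree_pos (by omega), hqd]
  have ha2n : (a ^ 2).coeff (2 * m + 1) = 2 * a.coeff m := by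
    have := ha.nextCoeff_pow 2
    rw [nextCoeff_of_natDegree_pos (by omega), ha2, nextCoeff_of_natDegree_pos (by omega),
      had] at this
    simpa using this
  have hbn : (b ^ 2 * f).coeff (2 * m + 1) = b.coeff (m - 1) ^ 2 := by
    have h1 := coeff_mul_add_eq_of_natDegree_le (df := 2 * (m - 1)) (dg := 3) (f := b ^ 2) (g := f)
      (by rw [natDegree_pow]; omega) h.natDegree_eq.le
    rw [coeff_pow_of_natDegree_le (by omega), show f.coeff 3 = 1 by
      rw [← h.natDegree_eq]; exact h.monic, mul_one] at h1
    rw [← h1]; congr 1; omega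
  rw [nextCoeff_of_natDegree_pos (by omega), hNd, hqn] at hnext
  simp only [Nat.add_one_sub_one, coeff_sub] at hnext
  rw [ha2n, hbn] at hnext
  rw [hq]
  congr 1
  rw [hqX, ← hnext]
  simp only [C_sub]
  ring

theorem exists_coordinate [IsAlgClosed K] [Fact p.Prime] [CharP K p]
    (h : SupersingularCubic m e f) (hpm : p = 2 * m + 1) :
    ∃ G : K[X], G.natDegree ≤ p ∧ (∀ i, G.eval (e i ^ p) = e i) ∧
      ∀ x₀ y₀ : K, y₀ ^ 2 = f.eval x₀ → y₀ ≠ 0 → ∃ a b : K[X], a.Monic ∧ a.natDegree = m + 1 ∧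
        b.degree < m ∧ (X - C x₀) ^ p ∣ a * f ^ m - C (y₀ ^ p) * b ∧
        a ^ 2 - b ^ 2 * f = (X - C x₀) ^ p * (X - C (G.eval (x₀ ^ p))) := by
  have hp : p.Prime := Fact.out
  have hm : 0 < m := by have := hp.two_le; omega
  have hp0 : (2 * m + 1 : K) = 0 := by
    have := CharP.cast_eq_zero K p
    rw [hpm] at this
    exact_mod_cast this
  obtain ⟨α, β, hα, hβ, H⟩ := h.exists_family hpm
  have hroot : ∀ i, β.eval (e i ^ p) = 0 ∧ -2 * α.eval (e i ^ p) = e i := fun i => by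
    obtain ⟨a, b, ha, had, hb, hd, haα, hbβ⟩ := H (e i)
    obtain ⟨hb0, hda⟩ := h.dvd_of_dvd_root hpm i hb hd
    have hae : a = (X - C (e i)) ^ (m + 1) :=
      (eq_of_monic_of_dvd_of_natDegree_le ((monic_X_sub_C _).pow _) ha hda
        (by rw [natDegree_pow, natDegree_X_sub_C, had]; omega))
    refine ⟨by rw [← hbβ, hb0, coeff_zero], ?_⟩
    rw [← haα, hae, sub_eq_add_neg, ← C_neg, coeff_X_add_C_pow]
    simp
    linear_combination (e i) * hp0
  have hinj : Function.Injective fun i => e i ^ p := (frobenius_inj K p).comp h.injective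
  obtain ⟨c, hc⟩ : ∏ i, (X - C (e i ^ p)) ∣ β :=
    Fintype.prod_dvd_of_coprime (pairwise_coprime_X_sub_C hinj) fun i =>
      dvd_iff_isRoot.2 (hroot i).1
  set F : K[X] := ∏ i, (X - C (e i ^ p)) with hF
  have hFm : F.Monic := monic_prod_X_sub_C _ _
  have hFd : F.natDegree = 3 := by
    rw [hF, natDegree_prod_of_monic _ _ fun i _ => monic_X_sub_C _]
    simp only [natDegree_X_sub_C]
    simp
  have hFe : ∀ x, F.eval (x ^ p) = f.eval x ^ p := fun x => by
    rw [hF, h.eq_prod, eval_prod, eval_prod, ← Finset.prod_pow]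
    exact Finset.prod_congr rfl fun i _ => by simp [sub_pow_char]
  have hcd : (F * c ^ 2).natDegree ≤ p := by
    by_cases hc0 : c = 0
    · simp [hc0]
    rw [hc, hFm.natDegree_mul' hc0, hFd] at hβ
    refine natDegree_mul_le.trans ?_
    rw [natDegree_pow, hFd]; omega
  refine ⟨F * c ^ 2 - C 2 * α, (natDegree_sub_le _ _).trans (max_le hcd
    ((natDegree_C_mul_le _ _).trans (by omega))), fun i => ?_, fun x₀ y₀ hy hy0 => ?_⟩
  · rw [eval_sub, eval_mul, hFe, h.eval_root, zero_pow hp.ne_zero, eval_mul, eval_C]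
    linear_combination (hroot i).2
  · obtain ⟨a, b, ha, had, hb, hd, haα, hbβ⟩ := H x₀
    have hY : y₀ ^ p ≠ 0 := pow_ne_zero _ hy0
    have hb' : (C (y₀ ^ p)⁻¹ * b).degree < m := by rwa [degree_C_mul (inv_ne_zero hY)]
    have hd' : (X - C x₀) ^ p ∣ a * f ^ m - C (y₀ ^ p) * (C (y₀ ^ p)⁻¹ * b) := by
      rwa [← mul_assoc, ← C_mul, mul_inv_cancel₀ hY, C_1, one_mul]
    refine ⟨a, _, ha, had, hb', hd', ?_⟩
    rw [h.norm_eq_of_dvd hpm hy hy0 ha had hb' hd', coeff_C_mul, hbβ, haα, hc]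
    congr 3
    have h1 : F.eval (x₀ ^ p) = (y₀ ^ p) ^ 2 := by
      rw [hFe, ← hy, ← pow_mul, ← pow_mul, mul_comm]
    simp only [eval_sub, eval_mul, eval_pow, eval_C, h1]
    field_simp

theorem two_ne_zero_of_odd [Fact p.Prime] [CharP K p] (hpm : p = 2 * m + 1) : (2 : K) ≠ 0 :=
    fun h2 => by
  have := CharP.cast_eq_zero K p
  rw [hpm] at this
  push_cast at this
  rw [h2] at this
  simp at this

/-- A supersingular curve has no function with divisor `p (P) + (Q) - (p + 1) (O)` where `P` is
not `2`-torsion but `Q` is. -/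
theorem norm_ne [IsAlgClosed K] [Fact p.Prime] [CharP K p]
    (h : SupersingularCubic m e f) (hpm : p = 2 * m + 1) {x₀ y₀ : K} (hy : y₀ ^ 2 = f.eval x₀)
    (hy0 : y₀ ≠ 0) {a b : K[X]} (ha : a.Monic) (had : a.natDegree = m + 1) (hb : b.degree < m)
    (hd : (X - C x₀) ^ p ∣ a * f ^ m - C (y₀ ^ p) * b) (i : Fin 3) :
    a ^ 2 - b ^ 2 * f ≠ (X - C x₀) ^ p * (X - C (e i)) := fun hN => by
  have hp : p.Prime := Fact.out
  have hm : 0 < m := by have := hp.two_le; omega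
  have h2 : (2 : K) ≠ 0 := two_ne_zero_of_odd hpm
  have hbd := natDegree_lt_of_degree_lt hb hm
  have hfz := h.eval_root i
  have hxz : e i ≠ x₀ := fun hz => hy0 (by rw [← hz, hfz] at hy; simpa using hy)
  have hPz : ((X - C x₀) ^ p).eval (e i) ≠ 0 := by
    simpa [sub_eq_zero] using fun h => absurd h hxz
  have hdκ := X_sub_C_pow_dvd_derivation hpm hy0 hd
  have hNz := congrArg (eval (e i)) hN
  simp only [eval_sub, eval_pow, eval_mul, hfz, eval_X, eval_C, sub_self, mul_zero,
    sub_zero] at hNz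
  have haz : a.eval (e i) = 0 := pow_eq_zero_iff two_ne_zero |>.1 hNz
  obtain ⟨L, hL⟩ := hdκ
  have hLz : L.eval (e i) = 0 := by
    have := congrArg (eval (e i)) hL
    rw [eval_mul] at this
    simp only [eval_sub, eval_mul, hfz, haz, mul_zero, sub_zero] at this
    exact (mul_eq_zero.1 this.symm).resolve_left hPz
  have hda := natDegree_derivative_le a
  have hdb := natDegree_derivative_le b
  have hdf := natDegree_derivative_le f
  have hfd := h.natDegree_eq
  have hB : (2 * derivative b * f + b * derivative f).natDegree ≤ m + 1 := by
    refine (natDegree_add_le _ _).trans (max_le ?_ ?_)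
    · by_cases hb1 : derivative b = 0
      · simp [hb1]
      have : 0 < b.natDegree := by
        by_contra h0
        rw [eq_C_of_natDegree_eq_zero (Nat.eq_zero_of_not_pos h0)] at hb1
        simp at hb1
      refine natDegree_mul_le.trans ?_
      rw [← C_ofNat]
      have := natDegree_C_mul_le (2 : K) (derivative b)
      omega
    · refine natDegree_mul_le.trans ?_
      omega
  have hLd : L.natDegree ≤ 1 := by
    by_cases hL0 : L = 0
    · simp [hL0]
    have h1 : ((X - C x₀) ^ p * L).natDegree ≤ p + 1 := by
      rw [← hL]
      refine (natDegree_sub_le _ _).trans (max_le (natDegree_mul_le.trans (by omega)) ?_)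
      refine natDegree_mul_le.trans ?_
      have h3 := natDegree_mul_le (p := 2 * derivative a) (q := b)
      have h4 := natDegree_C_mul_le (2 : K) (derivative a)
      rw [C_ofNat] at h4
      omega
    rw [natDegree_mul (pow_ne_zero _ (X_sub_C_ne_zero _)) hL0] at h1
    simp only [natDegree_pow, natDegree_X_sub_C] at h1
    omega
  obtain ⟨κ, hκ⟩ : ∃ κ, L = (X - C (e i)) * C κ := by
    obtain ⟨l, k, hlk⟩ := exists_eq_X_add_C_of_natDegree_le_one hLd
    refine ⟨l, ?_⟩
    rw [hlk] at hLz ⊢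
    simp only [eval_add, eval_mul, eval_C, eval_X] at hLz
    rw [eq_neg_of_add_eq_zero_right hLz]
    simp only [C_neg, C_mul]
    ring
  obtain ⟨a₁, rfl⟩ := dvd_iff_isRoot.2 haz
  obtain ⟨g, hg, -⟩ := h.exists_cofactor i
  set t : K[X] := X - C (e i) with ht
  have ht0 : t ≠ 0 := X_sub_C_ne_zero _
  have hdt : derivative t = 1 := by simp [ht]
  have ha₁ : a₁.Monic := (monic_X_sub_C (e i)).of_mul_monic_left ha
  have ha₁d : a₁.natDegree = m := by
    rw [(monic_X_sub_C (e i)).natDegree_mul ha₁, natDegree_X_sub_C] at had; omega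
  have hN0 : (t * a₁) ^ 2 - b ^ 2 * f ≠ 0 := by
    rw [hN]; exact mul_ne_zero (pow_ne_zero _ (X_sub_C_ne_zero _)) ht0
  have hN' := congrArg derivative hN
  rw [derivative_mul (f := (X - C x₀) ^ p), derivative_X_sub_C_pow_char, hdt] at hN'
  simp only [derivative_sub, derivative_mul, derivative_pow, Nat.cast_ofNat, Nat.add_one_sub_one,
    pow_one, map_ofNat, hdt] at hN'
  have hdg : derivative f = g + t * derivative g := by
    rw [hg, derivative_mul, hdt]; ring
  rw [derivative_mul, hdt, hdg] at hL
  rw [hdg] at hN'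
  have key1 : 2 * derivative b * g + b * derivative g = C κ * a₁ := by
    refine mul_left_cancel₀ (mul_ne_zero (mul_ne_zero ht0 ht0) hN0) ?_
    rw [hκ] at hL
    rw [hg] at hL hN hN' ⊢
    linear_combination t ^ 2 * a₁ * hL + t ^ 2 * b * g * hN' - (t ^ 2 * a₁ * C κ + t * b * g) * hN
  have key2 : 2 * t * derivative a₁ + a₁ = C κ * b := by
    refine mul_left_cancel₀ (mul_ne_zero ht0 hN0) ?_
    rw [hκ] at hL
    rw [hg] at hL hN hN' ⊢
    linear_combination b * t * hL + t ^ 2 * a₁ * hN' - (t * b * C κ + t * a₁) * hN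
  have hf0 := h.monic
  have e1 : 2 * derivative (2 * a₁ * b) * f + 2 * a₁ * b * derivative f =
      C (2 * κ) * (t * a₁ ^ 2 + b ^ 2 * g) := by
    rw [hdg, hg]
    simp only [derivative_mul, derivative_ofNat, C_mul, C_ofNat]
    linear_combination 2 * b * g * key2 + 2 * t * a₁ * key1
  have e2 : 2 * derivative (t * a₁ ^ 2 + b ^ 2 * g) = C (2 * κ) * (2 * a₁ * b) := by
    simp only [derivative_add, derivative_mul, derivative_pow, Nat.cast_ofNat,
      Nat.add_one_sub_one, pow_one, map_ofNat, hdt, C_mul]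
    linear_combination 2 * a₁ * key2 + 2 * b * key1
  have h2X : (2 : K[X]) ≠ 0 := by rw [← C_ofNat]; simpa using h2
  have hb0 : 2 * a₁ * b = 0 → b = 0 := fun hab =>
    (mul_eq_zero.1 hab).resolve_left (mul_ne_zero h2X ha₁.ne_zero)
  have hκ0 : 2 * κ = 0 := by
    refine eigenvalue_invariantDerivation_eq_zero hpm h.monic hfd h.coeff_eq_zero e1 e2 ?_
    by_contra! hAB
    have := hAB.1
    rw [hb0 hAB.2] at this
    simp [ht0, ha₁.ne_zero] at this
  rw [hκ0, C_0, zero_mul] at e1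
  have hbz := hb0 (eq_zero_of_derivation_eq_zero (p := p) (f := f)
    (h.injective.ne (show (0 : Fin 3) ≠ 1 by decide)) (h.eval_root 0) (h.eval_root 1)
    h.monic.ne_zero (by
      refine natDegree_mul_le.trans_lt ?_
      rw [natDegree_pow]
      have h3 := natDegree_mul_le (p := 2 * a₁) (q := b)
      have h4 := natDegree_C_mul_le (2 : K) a₁
      rw [C_ofNat] at h4
      omega) e1)
  rw [hbz] at hN
  have h3 : t * a₁ ^ 2 = (X - C x₀) ^ p := mul_right_cancel₀ ht0 (by linear_combination hN)
  apply hPz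
  rw [← h3, ht]
  simp

end SupersingularCubic

theorem Polynomial.eq_C_mul_X_sub_C_pow {K : Type*} [Field K] [IsAlgClosed K] {g : K[X]} {r : K}
    (h : ∀ x, g.eval x = 0 → x = r) : g = C g.leadingCoeff * (X - C r) ^ g.natDegree := by
  have hs := IsAlgClosed.splits g
  have hr : g.roots = Multiset.replicate g.natDegree r := by
    refine Multiset.eq_replicate.2 ⟨hs.natDegree_eq_card_roots.symm, fun x hx => h x ?_⟩
    exact (mem_roots'.1 hx).2
  conv_lhs => rw [hs.eq_prod_roots, hr]
  simp

namespace SupersingularCubic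

variable {K : Type*} [Field K] {p m : ℕ} {e : Fin 3 → K} {f : K[X]}

theorem exists_affine [IsAlgClosed K] [Fact p.Prime] [CharP K p]
    (h : SupersingularCubic m e f) (hpm : p = 2 * m + 1) :
    ∃ (α β : K) (q : ℕ), (q = p ∨ q = p ^ 2) ∧ (∀ i, e i = α * e i ^ q + β) ∧
      ∀ (x₀ y₀ : K) (a b : K[X]), y₀ ^ 2 = f.eval x₀ → y₀ ≠ 0 → a.Monic → a.natDegree = m + 1 →
        b.degree < m → (X - C x₀) ^ p ∣ a * f ^ m - C (y₀ ^ p) * b →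
        a ^ 2 - b ^ 2 * f = (X - C x₀) ^ (p + 1) → x₀ = α * x₀ ^ q + β := by
  have hp : p.Prime := Fact.out
  obtain ⟨G, hGd, hGe, hG⟩ := h.exists_coordinate hpm
  have huniq : ∀ i t, (G - C (e i)).eval t = 0 → t = e i ^ p := fun i t ht => by
    rw [eval_sub, eval_C, sub_eq_zero] at ht
    obtain ⟨x₀, rfl⟩ := IsAlgClosed.exists_pow_nat_eq t hp.pos
    by_cases hx : f.eval x₀ = 0
    · obtain ⟨j, rfl⟩ := h.exists_root hx
      rw [← ht, hGe]
    · obtain ⟨y₀, hy⟩ := IsAlgClosed.exists_pow_nat_eq (f.eval x₀) two_pos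
      have hy0 : y₀ ≠ 0 := by rintro rfl; exact hx (by rw [← hy]; simp)
      obtain ⟨a, b, ha, had, hb, hd, hN⟩ := hG x₀ y₀ hy hy0
      rw [ht] at hN
      exact absurd hN (h.norm_ne hpm hy hy0 ha had hb hd i)
  have he01 : e 0 ≠ e 1 := h.injective.ne (by decide)
  have hE01 : e 0 ^ p ≠ e 1 ^ p := fun h0 => he01 (frobenius_inj K p h0)
  have hd0 : 0 < G.natDegree := by
    by_contra h0
    have h1 := hGe 0
    have h2 := hGe 1
    rw [eq_C_of_natDegree_eq_zero (Nat.eq_zero_of_not_pos h0), eval_C] at h1 h2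
    exact he01 (h1.symm.trans h2)
  have hG0 : ∀ i, G = C (e i) + C G.leadingCoeff * (X - C (e i ^ p)) ^ G.natDegree := fun i => by
    have h1 := Polynomial.eq_C_mul_X_sub_C_pow (huniq i)
    rw [natDegree_sub_C, leadingCoeff_sub_of_degree_lt
      (degree_C_le.trans_lt (natDegree_pos_iff_degree_pos.1 hd0))] at h1
    linear_combination h1
  have hlc : G.leadingCoeff ≠ 0 := leadingCoeff_ne_zero.2 (by rintro rfl; simp at hd0)
  obtain ⟨u, d, hu, hdd, hform⟩ : ∃ u d, u ≠ 0 ∧ d = G.natDegree ∧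
    ∀ i, G = C (e i) + C u * (X - C (e i ^ p)) ^ d := ⟨_, _, hlc, rfl, hG0⟩
  have hd1 : d = 1 ∨ d = p := by
    by_contra! hne
    have h1 := congrArg derivative ((hform 0).symm.trans (hform 1))
    simp only [derivative_add, derivative_C, derivative_C_mul, derivative_X_sub_C_pow] at h1
    have h2 := congrArg (eval (e 0 ^ p)) h1
    simp only [eval_mul, eval_C, eval_pow, eval_sub, eval_X, sub_self,
      zero_pow (show d - 1 ≠ 0 by omega), mul_zero, zero_add] at h2
    have h3 : (d : K) = 0 := by
      have := (mul_eq_zero.1 h2.symm).resolve_left hu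
      simpa using (mul_eq_zero.1 this).resolve_right (pow_ne_zero _ (sub_ne_zero.2 hE01))
    rw [CharP.cast_eq_zero_iff K p] at h3
    have := Nat.le_of_dvd (by omega) h3
    omega
  have hval : ∀ x, G.eval (x ^ p) = u * x ^ (p * d) + (e 0 - u * e 0 ^ (p * d)) := fun x => by
    rw [hform 0]
    rcases hd1 with h1 | h1 <;> rw [h1]
    · simp; ring
    · simp [sub_pow_char, ← pow_mul]; ring
  refine ⟨u, e 0 - u * e 0 ^ (p * d), p * d, ?_, fun i => by rw [← hval, hGe], ?_⟩
  · rcases hd1 with h1 | h1 <;> rw [h1]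
    · simp
    · right; ring
  · intro x₀ y₀ a b hy hy0 ha had hb hd hN
    obtain ⟨a', b', ha', had', hb', hd', hN'⟩ := hG x₀ y₀ hy hy0
    have hY : y₀ ^ p ≠ 0 := pow_ne_zero _ hy0
    obtain ⟨rfl, hbb⟩ := h.eq_of_dvd hpm ha had (by rwa [degree_C_mul hY]) hd ha' had'
      (by rwa [degree_C_mul hY]) hd'
    obtain rfl := mul_left_cancel₀ (C_ne_zero.2 hY) hbb
    rw [hN', pow_succ] at hN
    have h1 := mul_left_cancel₀ (pow_ne_zero _ (X_sub_C_ne_zero _)) hN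
    rw [← hval]
    have := congrArg (eval x₀) h1
    simp only [eval_sub, eval_X, eval_C, sub_self] at this
    exact sub_eq_zero.1 this

end SupersingularCubic

/-- The powers of a linear function `y - l` on the curve `y² = f(x)`, as pairs `A + B y`. -/
theorem exists_linear_pow {K : Type*} [Field K] {f l : K[X]} (hf : f.natDegree = 3)
    (hl : l.natDegree ≤ 1) (n : ℕ) :
    ∃ A B : K[X], 2 * A.natDegree ≤ 3 * n ∧ (B = 0 ∨ 2 * B.natDegree + 3 ≤ 3 * n) ∧
      A ^ 2 - B ^ 2 * f = (l ^ 2 - f) ^ n ∧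
      ∀ S : K[X], S ^ 2 - f ∣ A + B * S - (S - l) ^ n := by
  induction n with
  | zero => exact ⟨1, 0, by simp, Or.inl rfl, by simp, by simp⟩
  | succ n ih =>
    obtain ⟨A, B, hA, hB, hN, hS⟩ := ih
    refine ⟨f * B - l * A, A - l * B, ?_, ?_, ?_, fun S => ?_⟩
    · have h1 := natDegree_sub_le (f * B) (l * A)
      have h2 := natDegree_mul_le (p := f) (q := B)
      have h3 := natDegree_mul_le (p := l) (q := A)
      rcases hB with rfl | hB
      · simp only [mul_zero, zero_sub, natDegree_neg] at h1 ⊢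
        omega
      · omega
    · right
      have h1 := natDegree_sub_le A (l * B)
      have h3 := natDegree_mul_le (p := l) (q := B)
      rcases hB with rfl | hB
      · simp only [mul_zero, sub_zero]
        omega
      · omega
    · rw [pow_succ (l ^ 2 - f), ← hN]; ring
    · obtain ⟨c, hc⟩ := hS S
      exact ⟨(S - l) * c - B, by linear_combination (S - l) * hc⟩

/-- A square root of `f` modulo `(X - x₀)^p`. -/
theorem exists_sqrt {K : Type*} [Field K] {p m : ℕ} [Fact p.Prime] [CharP K p]
    (hpm : p = 2 * m + 1) {f : K[X]} {x₀ y₀ : K} (hy : y₀ ^ 2 = f.eval x₀) (hy0 : y₀ ≠ 0) :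
    ∃ S : K[X], S.eval x₀ = y₀ ∧ (X - C x₀) ^ p ∣ S ^ 2 - f ∧
      (X - C x₀) ^ p ∣ S * f ^ m - C (y₀ ^ p) := by
  have hp : p.Prime := Fact.out
  have hco : IsCoprime ((X - C x₀) ^ p) f := by
    refine IsCoprime.pow_left ?_
    rw [(irreducible_X_sub_C x₀).coprime_iff_not_dvd, dvd_iff_isRoot, IsRoot.def, ← hy]
    exact pow_ne_zero _ hy0
  obtain ⟨v, w, hvw⟩ := hco.pow_right (n := m)
  have hd : (X - C x₀) ^ p ∣ C (y₀ ^ p) * w * f ^ m - C (y₀ ^ p) :=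
    ⟨-(C (y₀ ^ p) * v), by linear_combination C (y₀ ^ p) * hvw⟩
  refine ⟨C (y₀ ^ p) * w, ?_, ?_, hd⟩
  · obtain ⟨c, hc⟩ := hd
    have h1 := congrArg (eval x₀) hc
    simp only [eval_sub, eval_mul, eval_pow, eval_C, eval_X, sub_self, zero_pow hp.ne_zero,
      zero_mul, ← hy, ← pow_mul] at h1
    refine mul_right_cancel₀ (pow_ne_zero (2 * m) hy0) ?_
    rw [eval_mul, eval_C]
    rw [hpm] at h1 ⊢
    linear_combination h1
  · refine (hco.pow_right (n := 2 * m)).dvd_of_dvd_mul_right ?_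
    have h1 : (X - C x₀) ^ p ∣ f ^ p - C (y₀ ^ p) ^ 2 := by
      rw [← C_pow, ← pow_mul, mul_comm p 2, pow_mul, hy, C_pow, ← sub_pow_char]
      exact pow_dvd_pow_of_dvd (dvd_iff_isRoot.2 (by simp)) p
    have h2 : ((C (y₀ ^ p) * w) ^ 2 - f) * f ^ (2 * m) =
        (C (y₀ ^ p) * w * f ^ m - C (y₀ ^ p)) * (C (y₀ ^ p) * w * f ^ m + C (y₀ ^ p)) -
          (f ^ (2 * m + 1) - C (y₀ ^ p) ^ 2) := by ring
    rw [h2, ← hpm]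
    exact dvd_sub (hd.mul_right _) h1

namespace SupersingularCubic

variable {K : Type*} [Field K] {p m : ℕ} {e : Fin 3 → K} {f : K[X]}

/-- At a `3`-torsion point `P`, there is a function with divisor `p (P) + (±P) - (p + 1) (O)`
on any curve in odd characteristic `p ≠ 3`. -/
theorem exists_norm_eq_pow [Fact p.Prime] [CharP K p] (h : SupersingularCubic m e f)
    (hpm : p = 2 * m + 1) (hp5 : 5 ≤ p) {x₀ y₀ s : K} (hy : y₀ ^ 2 = f.eval x₀) (hy0 : y₀ ≠ 0)
    (hline : f - (C y₀ + C s * (X - C x₀)) ^ 2 = (X - C x₀) ^ 3) :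
    ∃ a b : K[X], a.Monic ∧ a.natDegree = m + 1 ∧ b.degree < m ∧
      (X - C x₀) ^ p ∣ a * f ^ m - C (y₀ ^ p) * b ∧
      a ^ 2 - b ^ 2 * f = (X - C x₀) ^ (p + 1) := by
  have hp : p.Prime := Fact.out
  have h2 : (2 : K) ≠ 0 := two_ne_zero_of_odd hpm
  have hfd := h.natDegree_eq
  suffices ∃ a b : K[X], a.natDegree ≤ m + 1 ∧ (b = 0 ∨ b.natDegree + 1 ≤ m) ∧
      (X - C x₀) ^ p ∣ a * f ^ m - C (y₀ ^ p) * b ∧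
      a ^ 2 - b ^ 2 * f = (X - C x₀) ^ (p + 1) by
    obtain ⟨a, b, had, hbd, hd, hN⟩ := this
    have hm' : ((X - C x₀) ^ (p + 1)).Monic := (monic_X_sub_C x₀).pow _
    have hb2 : (b ^ 2 * f).degree < ((X - C x₀) ^ (p + 1)).degree := by
      rcases hbd with rfl | hbd
      · rw [zero_pow two_ne_zero, zero_mul, degree_zero, bot_lt_iff_ne_bot, Ne, degree_eq_bot]
        exact hm'.ne_zero
      · refine degree_lt_degree ?_
        rw [natDegree_pow, natDegree_X_sub_C]
        refine natDegree_mul_le.trans_lt ?_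
        rw [natDegree_pow, hfd]; omega
    have ha2 : a ^ 2 = (X - C x₀) ^ (p + 1) + b ^ 2 * f := by linear_combination hN
    have ha2m : (a ^ 2).Monic := by rw [ha2]; exact hm'.add_of_left hb2
    have had' : a.natDegree = m + 1 := by
      have := natDegree_add_eq_left_of_degree_lt hb2
      rw [← ha2, natDegree_pow, natDegree_pow, natDegree_X_sub_C] at this
      omega
    have hlc : a.leadingCoeff ^ 2 = 1 := by rw [← leadingCoeff_pow]; exact ha2m
    have hlc0 : a.leadingCoeff ≠ 0 := fun h0 => by rw [h0] at hlc; simp at hlc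
    have hC : C a.leadingCoeff ^ 2 = (1 : K[X]) := by rw [← C_pow, hlc, C_1]
    refine ⟨C a.leadingCoeff * a, C a.leadingCoeff * b, ?_, ?_, ?_, ?_, ?_⟩
    · rw [Monic, leadingCoeff_mul, leadingCoeff_C, ← sq, hlc]
    · rw [natDegree_C_mul hlc0, had']
    · rw [degree_C_mul hlc0]
      rcases hbd with rfl | hbd
      · simp
      · by_cases hb0 : b = 0
        · simp [hb0]
        · exact (natDegree_lt_iff_degree_lt hb0).1 hbd
    · obtain ⟨c, hc⟩ := hd
      exact ⟨C a.leadingCoeff * c, by linear_combination C a.leadingCoeff * hc⟩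
    · rw [← hN]; linear_combination (a ^ 2 - b ^ 2 * f) * hC
  obtain ⟨S, hSx, hSf, hSy⟩ := exists_sqrt hpm hy hy0
  set l : K[X] := C y₀ + C s * (X - C x₀) with hl
  have hld : l.natDegree ≤ 1 := by
    refine (natDegree_add_le _ _).trans (max_le (by simp) ((natDegree_C_mul_le _ _).trans ?_))
    simp
  have hSl : (X - C x₀) ^ 3 ∣ S - l := by
    have hco : IsCoprime ((X - C x₀) ^ 3) (S + l) := by
      refine IsCoprime.pow_left ?_
      rw [(irreducible_X_sub_C x₀).coprime_iff_not_dvd, dvd_iff_isRoot, IsRoot.def, eval_add, hSx]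
      simpa [hl, ← two_mul] using ⟨h2, hy0⟩
    refine hco.dvd_of_dvd_mul_right ?_
    rw [show (S - l) * (S + l) = (S ^ 2 - f) + (X - C x₀) ^ 3 by linear_combination hline]
    exact dvd_add ((pow_dvd_pow _ (by omega)).trans hSf) dvd_rfl
  have hfin : ∀ a B : K[X], (X - C x₀) ^ p ∣ a + B * S →
      (X - C x₀) ^ p ∣ a * f ^ m - C (y₀ ^ p) * (-B) := fun a B hd => by
    convert dvd_sub (hd.mul_right (f ^ m)) (hSy.mul_right B) using 1
    ring
  have hnorm : l ^ 2 - f = -(X - C x₀) ^ 3 := by linear_combination -hline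
  obtain ⟨k, hk | hk⟩ : ∃ k, p = 3 * k + 1 ∨ p = 3 * k + 2 := by
    refine ⟨p / 3, ?_⟩
    have : p % 3 ≠ 0 := fun h0 => by
      have := (Nat.prime_dvd_prime_iff_eq Nat.prime_three hp).1 (Nat.dvd_of_mod_eq_zero h0)
      omega
    omega
  · obtain ⟨A, B, hA, hB, hN, hS⟩ := exists_linear_pow hfd hld k
    have hX : (X - C x₀).natDegree = 1 := natDegree_X_sub_C _
    refine ⟨(X - C x₀) * A, -((X - C x₀) * B), ?_, ?_, ?_, ?_⟩
    · refine natDegree_mul_le.trans ?_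
      omega
    · rcases hB with rfl | hB
      · left; simp
      · right
        rw [natDegree_neg]
        have := natDegree_mul_le (p := X - C x₀) (q := B)
        omega
    · refine hfin _ _ ?_
      have h3 : (X - C x₀) ^ p ∣ (X - C x₀) * (S - l) ^ k := by
        rw [hk, pow_succ', pow_mul]
        exact mul_dvd_mul_left _ (pow_dvd_pow_of_dvd hSl k)
      have h4 := (hSf.trans (hS S)).mul_left (X - C x₀)
      convert dvd_add h4 h3 using 1
      ring
    · obtain ⟨i, hi⟩ : ∃ i, k = 2 * i := ⟨k / 2, by omega⟩
      rw [hnorm, hi, pow_mul, neg_sq, ← pow_mul, ← pow_mul] at hN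
      rw [hk, hi]
      linear_combination (X - C x₀) ^ 2 * hN
  · obtain ⟨A, B, hA, hB, hN, hS⟩ := exists_linear_pow hfd hld (k + 1)
    refine ⟨A, -B, by omega, ?_, ?_, ?_⟩
    · rcases hB with rfl | hB
      · left; simp
      · right
        rw [natDegree_neg]
        omega
    · refine hfin _ _ ?_
      have h3 : (X - C x₀) ^ p ∣ (S - l) ^ (k + 1) := by
        refine (pow_dvd_pow _ ?_).trans (pow_mul (X - C x₀) 3 (k + 1) ▸ pow_dvd_pow_of_dvd hSl _)
        omega
      convert dvd_add (hSf.trans (hS S)) h3 using 1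
      ring
    · obtain ⟨i, hi⟩ : ∃ i, k + 1 = 2 * i := ⟨(k + 1) / 2, by omega⟩
      rw [hnorm, hi, pow_mul, neg_sq, ← pow_mul, ← pow_mul] at hN
      rw [show p + 1 = 3 * 2 * i by omega]
      linear_combination hN

/-- The roots of a supersingular cubic and the abscissas of its `3`-torsion points satisfy a common
relation `x = α x^q + β` with `q = p` or `q = p²`. -/
theorem exists_affine_torsion [IsAlgClosed K] [Fact p.Prime] [CharP K p]
    (h : SupersingularCubic m e f) (hpm : p = 2 * m + 1) (hp5 : 5 ≤ p) :
    ∃ (α β : K) (q : ℕ), (q = p ∨ q = p ^ 2) ∧ (∀ i, e i = α * e i ^ q + β) ∧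
      ∀ x₀ y₀ s : K, y₀ ^ 2 = f.eval x₀ → y₀ ≠ 0 →
        f - (C y₀ + C s * (X - C x₀)) ^ 2 = (X - C x₀) ^ 3 → x₀ = α * x₀ ^ q + β := by
  obtain ⟨α, β, q, hq, he, ht⟩ := h.exists_affine hpm
  refine ⟨α, β, q, hq, he, fun x₀ y₀ s hy hy0 hline => ?_⟩
  obtain ⟨a, b, ha, had, hb, hd, hN⟩ := h.exists_norm_eq_pow hpm hp5 hy hy0 hline
  exact ht x₀ y₀ a b hy hy0 ha had hb hd hN

end SupersingularCubic

theorem sum_choose_mul_choose_mul_pow {R : Type*} [CommRing R] (z : R) (N : ℕ) :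
    ∑ k ∈ Finset.range (N + 1), (N.choose k * (N + k).choose N : R) * z ^ k =
      ∑ i ∈ Finset.range (N + 1), (N.choose i : R) * (1 + 2 * z) ^ (N - i) *
        if Even i then (i.choose (i / 2) : R) * (z * (1 + z)) ^ (i / 2) else 0 := by
  have h1 : ((((X + C z) * (X + C z + 1)) ^ N : R[X])).coeff N =
      ∑ k ∈ Finset.range (N + 1), (N.choose k * (N + k).choose N : R) * z ^ k := by
    rw [mul_pow, add_pow (X + C z) 1 N, Finset.mul_sum, finsetSum_coeff]
    refine Finset.sum_congr rfl fun k _ => ?_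
    rw [one_pow, mul_one, ← mul_assoc, ← pow_add, ← C_eq_natCast, mul_comm, coeff_C_mul,
      coeff_X_add_C_pow, Nat.add_sub_cancel_left]
    ring
  have h2 : (X + C z) * (X + C z + 1) =
      (X ^ 2 + C (z * (1 + z))) + C (1 + 2 * z) * X := by
    simp only [C_mul, C_add, C_1, C_ofNat]; ring
  rw [← h1, h2, add_pow, finsetSum_coeff]
  refine Finset.sum_congr rfl fun i hi => ?_
  have hi' : i ≤ N := Nat.lt_succ_iff.1 (Finset.mem_range.1 hi)
  obtain ⟨d, rfl⟩ := Nat.exists_eq_add_of_le hi'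
  rw [Nat.add_sub_cancel_left, mul_pow, ← C_pow, ← C_eq_natCast,
    show (X ^ 2 + C (z * (1 + z))) ^ i * (C ((1 + 2 * z) ^ d) * X ^ d) * C ((i + d).choose i : R) =
      C ((1 + 2 * z) ^ d * (i + d).choose i) * ((X ^ 2 + C (z * (1 + z))) ^ i * X ^ d) by
      rw [C_mul (a := (1 + 2 * z) ^ d)]; ring,
    coeff_C_mul, coeff_mul_X_pow]
  have h3 : ((X ^ 2 + C (z * (1 + z))) ^ i : R[X]) = expand R 2 ((X + C (z * (1 + z))) ^ i) := by
    simp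
  rw [h3, coeff_expand two_pos]
  simp only [even_iff_two_dvd]
  split_ifs with h4
  · rw [coeff_X_add_C_pow]
    obtain ⟨l, rfl⟩ := h4
    rw [Nat.mul_div_cancel_left _ two_pos, show 2 * l - l = l by omega]
    ring
  · ring

theorem sum_range_of_odd_eq_zero {R : Type*} [AddCommMonoid R] (F : ℕ → R)
    (hF : ∀ l, F (2 * l + 1) = 0) (n : ℕ) :
    ∑ i ∈ Finset.range (2 * n + 1), F i = ∑ l ∈ Finset.range (n + 1), F (2 * l) := by
  induction n with
  | zero => simp
  | succ n ih =>
    rw [show 2 * (n + 1) + 1 = 2 * n + 1 + 1 + 1 by ring, Finset.sum_range_succ,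
      Finset.sum_range_succ, hF, ih, add_zero, Finset.sum_range_succ _ (n + 1)]
    rfl

theorem coeff_cubic_pow {R : Type*} [CommRing R] (c d : R) (m : ℕ) :
    ((X ^ 3 + C c * X ^ 2 + C d : R[X]) ^ m).coeff (2 * m) =
      ∑ k ∈ Finset.range (m + 1),
        (m.choose k * (m - k).choose (2 * k) : R) * c ^ (m - k - 2 * k) * d ^ k := by
  rw [show (X ^ 3 + C c * X ^ 2 + C d : R[X]) = C d + X ^ 2 * (X + C c) by ring, add_pow,
    finsetSum_coeff]
  refine Finset.sum_congr rfl fun k hk => ?_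
  have hk' : k ≤ m := Nat.lt_succ_iff.1 (Finset.mem_range.1 hk)
  obtain ⟨l, rfl⟩ := Nat.exists_eq_add_of_le hk'
  rw [Nat.add_sub_cancel_left, mul_pow, ← pow_mul, ← C_pow, ← C_eq_natCast,
    show C (d ^ k) * (X ^ (2 * l) * (X + C c) ^ l) * C ((k + l).choose k : R) =
      C (d ^ k * (k + l).choose k) * ((X + C c) ^ l * X ^ (2 * l)) by rw [C_mul]; ring,
    coeff_C_mul, mul_add, coeff_mul_X_pow, coeff_X_add_C_pow]
  ring

theorem choose_mul_choose_succ (m k : ℕ) (hk : k < m) :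
    (m.choose (k + 1) * (m - (k + 1)).choose (2 * (k + 1)) : ℤ) *
        ((k + 1) * (2 * k + 1) * (2 * k + 2)) =
      (m - 3 * k) * (m - 3 * k - 1) * (m - 3 * k - 2) *
        (m.choose k * (m - k).choose (2 * k)) := by
  obtain ⟨r, rfl⟩ := Nat.exists_eq_add_of_lt hk
  rw [show k + r + 1 - (k + 1) = r by omega, show k + r + 1 - k = r + 1 by omega]
  have h1 : ((k + r + 1).choose (k + 1) : ℤ) * (k + 1) = (k + r + 1).choose k * (r + 1) := by
    have := Nat.choose_succ_right_eq (k + r + 1) k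
    rw [show k + r + 1 - k = r + 1 by omega] at this
    exact_mod_cast this
  have hs : ∀ n i : ℕ, (n.choose (i + 1) : ℤ) * (i + 1) = n.choose i * (n - i) := fun n i => by
    rcases le_or_gt i n with hi | hi
    · have := Nat.choose_succ_right_eq n i
      zify [hi] at this
      exact this
    · simp [Nat.choose_eq_zero_of_lt hi, Nat.choose_eq_zero_of_lt (hi.trans (Nat.lt_succ_self i))]
  have h2 := hs r (2 * k + 1)
  have h3 := hs r (2 * k)
  have h4 : ((r + 1).choose (2 * k) : ℤ) * (r + 1 - 2 * k) = (r + 1) * r.choose (2 * k) := by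
    have := Nat.add_one_mul_choose_eq r (2 * k)
    have h5 := hs (r + 1) (2 * k)
    zify at this
    push_cast at h5 this
    linarith
  rw [show 2 * (k + 1) = 2 * k + 1 + 1 by ring]
  push_cast at h2 h3 ⊢
  linear_combination
    (2 * k + 1) * (2 * k + 2) * (r.choose (2 * k + 1 + 1) : ℤ) * h1 +
    (2 * k + 1) * ((k + r + 1).choose k : ℤ) * (r + 1) * h2 +
    ((k + r + 1).choose k : ℤ) * (r + 1) * (r - (2 * k + 1)) * h3 -
    ((k + r + 1).choose k : ℤ) * (r - 2 * k) * (r - 2 * k - 1) * h4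

theorem choose_mul_choose_add_succ (N k : ℕ) :
    (N.choose (k + 1) * (N + (k + 1)).choose N : ℤ) * (k + 1) ^ 2 =
      (N - k) * (N + k + 1) * (N.choose k * (N + k).choose N) := by
  have h1 : (N.choose (k + 1) : ℤ) * (k + 1) = N.choose k * (N - k) := by
    rcases le_or_gt k N with hi | hi
    · have := Nat.choose_succ_right_eq N k
      zify [hi] at this
      exact this
    · simp [Nat.choose_eq_zero_of_lt hi, Nat.choose_eq_zero_of_lt (hi.trans (Nat.lt_succ_self k))]
  have h2 : ((N + (k + 1)).choose N : ℤ) * (k + 1) = (N + k + 1) * (N + k).choose N := by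
    have := Nat.add_one_mul_choose_eq (N + k) k
    rw [Nat.choose_symm_add, Nat.choose_symm_add, ← add_assoc]
    zify at this
    linarith
  linear_combination (k + 1) * ((N + (k + 1)).choose N : ℤ) * h1 + (N.choose k : ℤ) * (N - k) * h2

theorem four_pow_mul_choose_mul_choose {K : Type*} [Field K] {p m N : ℕ} [Fact p.Prime] [CharP K p]
    (hpm : p = 2 * m + 1) (hN : (6 * N + 1 : K) = 0 ∨ (6 * N + 5 : K) = 0) {k : ℕ} (hk : k ≤ m) :
    4 ^ k * (m.choose k * (m - k).choose (2 * k) : K) =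
      27 ^ k * (N.choose k * (N + k).choose N) := by
  have hp0 : (2 * m + 1 : K) = 0 := by
    have := CharP.cast_eq_zero K p
    rw [hpm] at this
    exact_mod_cast this
  induction k with
  | zero => simp
  | succ k ih =>
    have hD := congrArg (Int.cast (R := K)) (choose_mul_choose_succ m k hk)
    have hc := congrArg (Int.cast (R := K)) (choose_mul_choose_add_succ N k)
    push_cast at hD hc
    have ih' := ih (by omega)
    have hlt : ∀ i : ℕ, 0 < i → i < p → (i : K) ≠ 0 := fun i h0 hi h => by
      rw [CharP.cast_eq_zero_iff K p] at h
      exact absurd (Nat.le_of_dvd h0 h) (by omega)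
    have hk1 : (k + 1 : K) ≠ 0 := by exact_mod_cast hlt (k + 1) (by omega) (by omega)
    have hk2 : (2 * k + 1 : K) ≠ 0 := by exact_mod_cast hlt (2 * k + 1) (by omega) (by omega)
    have h2 : (2 : K) ≠ 0 := SupersingularCubic.two_ne_zero_of_odd hpm
    have hD' : 16 * ((m.choose (k + 1) * (m - (k + 1)).choose (2 * (k + 1)) : K)) * (k + 1) ^ 2 =
        -3 * (6 * k + 1) * (6 * k + 5) * (m.choose k * (m - k).choose (2 * k)) := by
      refine mul_left_cancel₀ hk2 ?_
      have hm : (m : K) = -1 / 2 := by field_simp; linear_combination hp0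
      rw [hm] at hD
      field_simp at hD
      linear_combination hD
    have hc' : 36 * (N.choose (k + 1) * (N + (k + 1)).choose N : K) * (k + 1) ^ 2 =
        -(6 * k + 1) * (6 * k + 5) * (N.choose k * (N + k).choose N) := by
      have hNN : 36 * ((N : K) - k) * (N + k + 1) = -(6 * k + 1) * (6 * k + 5) := by
        rcases hN with hN | hN
        · linear_combination (6 * N + 5) * hN
        · linear_combination (6 * N + 1) * hN
      linear_combination 36 * hc + (N.choose k * (N + k).choose N : K) * hNN
    refine mul_left_cancel₀ (mul_ne_zero (pow_ne_zero 2 h2) (pow_ne_zero 2 hk1)) ?_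
    rw [pow_succ, pow_succ]
    linear_combination 4 ^ k * hD' - 3 * (6 * k + 1) * (6 * k + 5) * ih' - 27 ^ k * 3 * hc'

theorem coeff_cubic_pow_eq_sum {K : Type*} [Field K] {p m N : ℕ} [Fact p.Prime] [CharP K p]
    (hpm : p = 2 * m + 1) (hp5 : 5 ≤ p) (hN : (6 * N + 1 : K) = 0 ∨ (6 * N + 5 : K) = 0)
    (hNm : N ≤ m) (z : K) :
    ((X ^ 3 + C 3 * X ^ 2 + C (4 * z) : K[X]) ^ m).coeff (2 * m) =
      3 ^ m * ∑ k ∈ Finset.range (N + 1), (N.choose k * (N + k).choose N : K) * z ^ k := by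
  have h3 : (3 : K) ≠ 0 := three_ne_zero_of_five_le hp5
  have hsub : ∑ k ∈ Finset.range (N + 1), (N.choose k * (N + k).choose N : K) * z ^ k =
      ∑ k ∈ Finset.range (m + 1), (N.choose k * (N + k).choose N : K) * z ^ k := by
    refine Finset.sum_subset (Finset.range_subset_range.2 (by omega)) fun k _ hk => ?_
    rw [Nat.choose_eq_zero_of_lt (by simpa using hk)]
    simp
  rw [hsub, coeff_cubic_pow, Finset.mul_sum]
  refine Finset.sum_congr rfl fun k hk => ?_
  have hk' := four_pow_mul_choose_mul_choose (K := K) hpm hN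
    (Nat.lt_succ_iff.1 (Finset.mem_range.1 hk))
  rcases le_or_gt (3 * k) m with h | h
  · obtain ⟨r, rfl⟩ := Nat.exists_eq_add_of_le h
    rw [show 3 * k + r - k - 2 * k = r by omega, pow_add, pow_mul, mul_pow]
    norm_num1
    linear_combination 3 ^ r * z ^ k * hk'
  · have h0 : (m - k).choose (2 * k) = 0 := Nat.choose_eq_zero_of_lt (by omega)
    rw [h0, Nat.cast_zero, mul_zero, mul_zero] at hk'
    have h27 : (27 : K) ≠ 0 := by
      rw [show (27 : K) = 3 ^ 3 by norm_num]; exact pow_ne_zero 3 h3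
    rw [h0, (mul_eq_zero.1 hk'.symm).resolve_left (pow_ne_zero k h27)]
    simp

theorem pow_mul_sum_choose_mul_choose {K : Type*} [Field K] (h2 : (2 : K) ≠ 0) {w j : K}
    (hw : w ^ 2 * j = j - 1728) (n s : ℕ) (hs : s ≤ 1) :
    j ^ n * ∑ k ∈ Finset.range (2 * n + s + 1),
        ((2 * n + s).choose k * (2 * n + s + k).choose (2 * n + s) : K) * ((w - 1) / 2) ^ k =
      w ^ s * ∑ k ∈ Finset.range (n + 1), ((2 * n + s).choose (2 * k + s) : K) *
        ((2 * n - 2 * k).choose (n - k) : K) * (-432) ^ (n - k) * (j - 1728) ^ k := by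
  have h4 : (4 : K) ≠ 0 := by rw [show (4 : K) = 2 * 2 by norm_num]; exact mul_ne_zero h2 h2
  have hz1 : 1 + 2 * ((w - 1) / 2) = w := by field_simp; ring
  have hz2 : (w - 1) / 2 * (1 + (w - 1) / 2) * j = -432 := by
    field_simp
    linear_combination hw
  rw [sum_choose_mul_choose_mul_pow, hz1]
  set v := (w - 1) / 2 * (1 + (w - 1) / 2) with hv
  have hsum : ∀ F : ℕ → K, (∀ l, F (2 * l + 1) = 0) →
      ∑ i ∈ Finset.range (2 * n + s + 1), F i = ∑ l ∈ Finset.range (n + 1), F (2 * l) :=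
    fun F hF => by
      rw [← sum_range_of_odd_eq_zero F hF]
      obtain rfl | rfl : s = 0 ∨ s = 1 := by omega
      · rfl
      · rw [Finset.sum_range_succ, hF, add_zero]
  rw [hsum _ fun l => by rw [if_neg (by simp), mul_zero], ← Finset.sum_flip, Finset.mul_sum,
    Finset.mul_sum]
  refine Finset.sum_congr rfl fun k hk => ?_
  obtain ⟨l, rfl⟩ := Nat.exists_eq_add_of_le (Nat.lt_succ_iff.1 (Finset.mem_range.1 hk))
  rw [Nat.add_sub_cancel_left, if_pos (by simp), Nat.mul_div_cancel_left _ two_pos,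
    show 2 * (k + l) - 2 * k = 2 * l by omega, show 2 * (k + l) + s - 2 * l = 2 * k + s by omega,
    ← hw, ← hz2,
    Nat.choose_symm_of_eq_add (show 2 * (k + l) + s = 2 * k + s + 2 * l by omega)]
  ring_nf

theorem coeff_cubic_pow_eq_zero_of_aeval_ssp {K : Type*} [Field K] {p m : ℕ} [Fact p.Prime]
    [Algebra (ZMod p) K] [CharP K p] (hpm : p = 2 * m + 1) (hp5 : 5 ≤ p) {w j : K}
    (hj0 : j ≠ 0) (hj : aeval j (ssp p) = 0) (hw : w ^ 2 * j = j - 1728) :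
    ((X ^ 3 + C 3 * X ^ 2 + C (2 * (w - 1)) : K[X]) ^ m).coeff (2 * m) = 0 := by
  have hp : p.Prime := Fact.out
  have h2 : (2 : K) ≠ 0 := SupersingularCubic.two_ne_zero_of_odd hpm
  have hw4 : 2 * (w - 1) = 4 * ((w - 1) / 2) := by
    linear_combination 2 * (mul_div_cancel₀ (w - 1) h2).symm
  rw [hw4]
  unfold ssp at hj
  set n := p / 12 with hn
  set s := if p % 4 = 3 then 1 else 0 with hs
  have hs1 : s ≤ 1 := by rw [hs]; split_ifs <;> simp
  have h6 : (6 * (2 * n + s) + 1 = p ∨ 6 * (2 * n + s) + 5 = p) := by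
    have h3 : p % 3 ≠ 0 := fun h0 => by
      have := (Nat.prime_dvd_prime_iff_eq Nat.prime_three hp).1 (Nat.dvd_of_mod_eq_zero h0)
      omega
    rw [hs, hn]; split_ifs <;> omega
  have hN : (6 * (2 * n + s : ℕ) + 1 : K) = 0 ∨ (6 * (2 * n + s : ℕ) + 5 : K) = 0 := by
    have h0 := CharP.cast_eq_zero K p
    rcases h6 with h6 | h6
    · left; rw [← h6] at h0; exact_mod_cast h0
    · right; rw [← h6] at h0; exact_mod_cast h0
  rw [coeff_cubic_pow_eq_sum hpm hp5 hN (by omega)]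
  refine mul_eq_zero_of_right _ ?_
  refine mul_left_cancel₀ (pow_ne_zero n hj0) ?_
  rw [mul_zero, pow_mul_sum_choose_mul_choose h2 hw n s hs1]
  simp only [map_mul, map_pow, map_sub, map_sum, map_natCast, map_neg, map_ofNat, aeval_X] at hj
  rcases mul_eq_zero.1 hj with hj | hj
  · rcases mul_eq_zero.1 hj with hj | hj
    · exact absurd hj (pow_ne_zero _ hj0)
    · have hs0 : s ≠ 0 := by rintro h0; rw [h0] at hj; simp at hj
      have hj' : j - 1728 = 0 := pow_eq_zero_iff hs0 |>.1 hj
      rw [hj', mul_eq_zero, or_iff_left hj0, pow_eq_zero_iff two_ne_zero] at hw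
      rw [hw, zero_pow hs0, zero_mul]
  · rw [hj, mul_zero]

theorem IsAlgClosed.exists_root_quadratic {K : Type*} [Field K] [IsAlgClosed K] (b c : K) :
    ∃ t : K, t ^ 2 + b * t + c = 0 := by
  have hd : (X ^ 2 + C b * X + C c : K[X]).natDegree = 2 := by compute_degree!
  obtain ⟨t, ht⟩ := IsAlgClosed.exists_root (X ^ 2 + C b * X + C c : K[X])
    (degree_ne_of_natDegree_ne (n := 0) (by rw [hd]; norm_num))
  exact ⟨t, by simpa using ht⟩

theorem exists_roots_cubic {K : Type*} [Field K] [IsAlgClosed K] (h2 : (2 : K) ≠ 0)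
    (h3 : (3 : K) ≠ 0) {w : K} (hw : w ^ 2 ≠ 1) :
    ∃ r : Fin 3 → K, Function.Injective r ∧ r 0 + r 1 + r 2 = 0 ∧
      r 0 * r 1 + r 0 * r 2 + r 1 * r 2 = -3 ∧ r 0 * r 1 * r 2 = -2 * w := by
  have hd : (X ^ 3 + C (-3) * X + C (2 * w) : K[X]).natDegree = 3 := by compute_degree!
  obtain ⟨a, ha⟩ := IsAlgClosed.exists_root (X ^ 3 + C (-3) * X + C (2 * w) : K[X])
    (degree_ne_of_natDegree_ne (n := 0) (by rw [hd]; norm_num))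
  simp only [IsRoot.def, eval_add, eval_mul, eval_pow, eval_X, eval_C] at ha
  obtain ⟨b, hb⟩ := IsAlgClosed.exists_root_quadratic a (a ^ 2 - 3)
  have hdis : ∀ x y z : K, x + y + z = 0 → x * y + x * z + y * z = -3 → x * y * z = -2 * w →
      x ≠ y := by
    rintro x _ z e1 e2 e3 rfl
    obtain rfl : z = -2 * x := by linear_combination e1
    have hx : x ^ 2 = 1 := mul_left_cancel₀ h3 (by linear_combination -e2)
    have hxw : x = w := mul_left_cancel₀ h2 (by linear_combination -e3 - 2 * x * hx)
    exact hw (hxw ▸ hx)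
  have e1 : a + b + (-a - b) = 0 := by ring
  have e2 : a * b + a * (-a - b) + b * (-a - b) = -3 := by linear_combination -hb
  have e3 : a * b * (-a - b) = -2 * w := by linear_combination ha - a * hb
  have h01 := hdis _ _ _ e1 e2 e3
  have h02 := hdis a (-a - b) b (by ring) (by linear_combination e2) (by linear_combination e3)
  have h12 := hdis b (-a - b) a (by ring) (by linear_combination e2) (by linear_combination e3)
  refine ⟨![a, b, -a - b], ?_, by simp, by simpa using e2, by simpa using e3⟩
  clear hb ha hd hdis e1 e2 e3
  simp only [Function.Injective, Fin.forall_fin_succ, Matrix.cons_val_zero, Matrix.cons_val_succ,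
    Fin.succ_ne_zero, (Fin.succ_ne_zero _).symm, h01, h02, h12, h01.symm, h02.symm, h12.symm]
  simp

/-- For a supersingular curve `y² = x³ - 3x + 2w`, the squares of the abscissas of the `2`-torsion
and `3`-torsion points lie in `𝔽_{p²}`. -/
theorem sq_pow_eq_of_coeff_eq_zero {K : Type*} [Field K] [IsAlgClosed K] {p m : ℕ} [Fact p.Prime]
    [CharP K p] (hpm : p = 2 * m + 1) (hp5 : 5 ≤ p) {w : K} (hw : w ^ 2 ≠ 1)
    (hcoeff : ((X ^ 3 + C 3 * X ^ 2 + C (2 * (w - 1)) : K[X]) ^ m).coeff (2 * m) = 0) :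
    (∀ x : K, x ^ 3 - 3 * x + 2 * w = 0 → (x ^ 2) ^ p ^ 2 = x ^ 2) ∧
      ∀ x : K, x ^ 4 - 6 * x ^ 2 + 8 * w * x - 3 = 0 → (x ^ 2) ^ p ^ 2 = x ^ 2 := by
  have h2 : (2 : K) ≠ 0 := two_ne_zero_of_five_le hp5
  have h3 : (3 : K) ≠ 0 := three_ne_zero_of_five_le hp5
  obtain ⟨r, hr, r1, r2, r3⟩ := exists_roots_cubic h2 h3 hw
  have hf : SupersingularCubic m (fun i => r i - 1)
      (X ^ 3 + C 3 * X ^ 2 + C (2 * (w - 1)) : K[X]) := by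
    refine ⟨fun i j hij => hr (sub_left_injective hij), ?_, hcoeff⟩
    have r1' := congrArg (C (R := K)) r1
    have r2' := congrArg (C (R := K)) r2
    have r3' := congrArg (C (R := K)) r3
    simp only [C_add, C_mul, C_neg, C_0, C_ofNat] at r1' r2' r3'
    simp only [Fin.prod_univ_three, C_sub, C_1, C_mul, C_ofNat]
    linear_combination (X + 1) ^ 2 * r1' - (X + 1) * r2' + r3'
  obtain ⟨α, β, q, hq, he, ht⟩ := hf.exists_affine_torsion hpm hp5
  obtain ⟨k, hk⟩ : ∃ k, q = p ^ k := by
    rcases hq with rfl | rfl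
    · exact ⟨1, by simp⟩
    · exact ⟨2, rfl⟩
  let φ : K →+* K := iterateFrobenius K p k
  have hφ : ∀ x, x ^ q = φ x := fun x => by rw [hk]; rfl
  have hφ2 : ∀ x, φ x = x → x ^ p ^ 2 = x := fun x hx => by
    rcases hq with h | h
    · rw [sq, pow_mul, ← h, hφ (x ^ q), hφ x, hx, hx]
    · rw [← h, hφ, hx]
  simp only [hφ, map_sub, map_one] at he ht
  have he0 := he 0
  have he1 := he 1
  have he2 := he 2
  have s1 := congrArg φ r1
  have s2 := congrArg φ r2
  simp only [map_add, map_mul, map_zero, map_neg, map_ofNat] at s1 s2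
  have hβ : β = α - 1 := mul_left_cancel₀ h3
    (by linear_combination r1 - he0 - he1 - he2 - α * s1)
  subst hβ
  have hα : α ^ 2 = 1 := by
    have t0 : r 0 = α * φ (r 0) := by linear_combination he0
    have t1 : r 1 = α * φ (r 1) := by linear_combination he1
    have t2 : r 2 = α * φ (r 2) := by linear_combination he2
    rw [t0, t1, t2] at r2
    exact mul_left_cancel₀ h3 (by linear_combination α ^ 2 * s2 - r2)
  have hfix : ∀ x, x - 1 = α * (φ x - 1) + (α - 1) → (x ^ 2) ^ p ^ 2 = x ^ 2 := fun x hx => by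
    refine hφ2 _ ?_
    rw [map_pow]
    have : x = α * φ x := by linear_combination hx
    conv_rhs => rw [this, mul_pow, hα, one_mul]
  refine ⟨fun x hx => ?_, fun x hx => ?_⟩
  · have : (x - r 0) * (x - r 1) * (x - r 2) = 0 := by
      linear_combination hx - x ^ 2 * r1 + x * r2 - r3
    rcases mul_eq_zero.1 this with h | h
    · rcases mul_eq_zero.1 h with h | h <;> rw [sub_eq_zero.1 h]
      · exact hfix _ he0
      · exact hfix _ he1
    · rw [sub_eq_zero.1 h]; exact hfix _ he2
  · obtain ⟨y, hy⟩ := IsAlgClosed.exists_pow_nat_eq (x ^ 3 - 3 * x + 2 * w) two_pos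
    have hy0 : y ≠ 0 := by
      rintro rfl
      have h1 : (3 * (x ^ 2 - 1)) * (x ^ 2 - 1) = 0 := by
        linear_combination -hx - 4 * x * hy
      have hx1 : x ^ 2 = 1 := by
        rcases mul_eq_zero.1 h1 with h | h
        · exact sub_eq_zero.1 ((mul_eq_zero.1 h).resolve_left h3)
        · exact sub_eq_zero.1 h
      have hwx : w * x = 1 := by
        refine mul_left_cancel₀ (pow_ne_zero 3 h2) ?_
        linear_combination hx - (x ^ 2 - 5) * hx1
      apply hw
      linear_combination -w ^ 2 * hx1 + (w * x + 1) * hwx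
    obtain ⟨s, hs⟩ : ∃ s, 2 * y * s = 3 * x ^ 2 - 3 :=
      ⟨(3 * x ^ 2 - 3) / (2 * y), by field_simp⟩
    have hs2 : s ^ 2 = 3 * x := by
      refine mul_left_cancel₀ (pow_ne_zero 2 (mul_ne_zero h2 hy0)) ?_
      linear_combination (2 * y * s + 3 * x ^ 2 - 3) * hs - 12 * x * hy - 3 * hx
    refine hfix x ?_
    have := ht (x - 1) y s (by
      simp only [eval_add, eval_mul, eval_pow, eval_X, eval_C]
      linear_combination hy) hy0 (by
      have hy' := congrArg (C (R := K)) hy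
      have hs' := congrArg (C (R := K)) hs
      have hs2' := congrArg (C (R := K)) hs2
      simp only [C_add, C_sub, C_mul, C_pow, C_ofNat] at hy' hs' hs2'
      simp only [C_sub, C_1, C_mul, C_ofNat]
      linear_combination -hy' - (X - C x + 1) * hs' - (X - C x + 1) ^ 2 * hs2')
    rwa [map_sub, map_one] at this

/-- The torsion data `sq_pow_eq_of_coeff_eq_zero` for the curve `y² = x³ - 3x + 2w` whose
`j`-invariant `1728 / (1 - w²)` is a root of the supersingular polynomial. -/
theorem sq_pow_eq_of_aeval_ssp {K : Type*} [Field K] [IsAlgClosed K] {p : ℕ} [Fact p.Prime]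
    [Algebra (ZMod p) K] [CharP K p] (hp : 5 ≤ p) {j : K} (hj0 : j ≠ 0) (hj : aeval j (ssp p) = 0)
    {w : K} (hw : w ^ 2 * j = j - 1728) :
    (∀ x : K, x ^ 3 - 3 * x + 2 * w = 0 → (x ^ 2) ^ p ^ 2 = x ^ 2) ∧
      ∀ x : K, x ^ 4 - 6 * x ^ 2 + 8 * w * x - 3 = 0 → (x ^ 2) ^ p ^ 2 = x ^ 2 := by
  have hpm : p = 2 * (p / 2) + 1 := by
    have := (Fact.out : p.Prime).eq_two_or_odd
    omega
  refine sq_pow_eq_of_coeff_eq_zero hpm hp (fun h => ?_)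
    (coeff_cubic_pow_eq_zero_of_aeval_ssp hpm hp hj0 hj hw)
  have h23 : (2 : K) ^ 6 * 3 ^ 3 = 0 := by
    rw [h] at hw
    linear_combination hw
  rcases mul_eq_zero.1 h23 with h | h
  · exact two_ne_zero_of_five_le hp (pow_eq_zero_iff (by norm_num) |>.1 h)
  · exact three_ne_zero_of_five_le hp (pow_eq_zero_iff (by norm_num) |>.1 h)

theorem pow_eq_self_of_level_two {K : Type*} [Field K] [IsAlgClosed K] {p : ℕ} [Fact p.Prime]
    [Algebra (ZMod p) K] [CharP K p] (hp : 5 ≤ p) {j : K} (hj0 : j ≠ 0) (hj : aeval j (ssp p) = 0)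
    {t u : K} (htu : t * u = 4096) (hjt : 256 * j = (t + 256) * (u + 16) ^ 2) :
    t ^ p ^ 2 = t := by
  have h2 : (2 : K) ≠ 0 := two_ne_zero_of_five_le hp
  have h3 : (3 : K) ≠ 0 := three_ne_zero_of_five_le hp
  have h256 : (256 : K) ≠ 0 := by
    rw [show (256 : K) = 2 ^ 8 by norm_num]; exact pow_ne_zero _ h2
  have ht0 : t ≠ 0 := by
    rintro rfl
    exact pow_ne_zero 12 h2 (by linear_combination -htu)
  have ht : t + 256 ≠ 0 := fun h => mul_ne_zero h256 hj0 (by rw [hjt, h, zero_mul])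
  have hjt' : j * t ^ 2 = (t + 256) ^ 3 := mul_left_cancel₀ h256 (by
    linear_combination t ^ 2 * hjt + (t + 256) * (t * u + 4096 + 32 * t) * htu)
  obtain ⟨E, hE⟩ : ∃ E : K, E * (t + 256) = 4 * (t + 64) :=
    ⟨4 * (t + 64) / (t + 256), div_mul_cancel₀ _ ht⟩
  obtain ⟨e, he⟩ := IsAlgClosed.exists_pow_nat_eq E two_pos
  obtain ⟨w, hw⟩ : ∃ w : K, 2 * w = e * (3 - E) := ⟨e * (3 - E) / 2, by field_simp⟩
  have hwj : w ^ 2 * j = j - 1728 := by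
    have h4 : 4 * w ^ 2 = E * (3 - E) ^ 2 := by
      linear_combination (2 * w + e * (3 - E)) * hw + (3 - E) ^ 2 * he
    have h3E : (3 - E) * (t + 256) = 512 - t := by linear_combination -hE
    have hP : (E * (t + 256)) * ((3 - E) * (t + 256)) ^ 2 = 4 * (t + 64) * (512 - t) ^ 2 := by
      rw [hE, h3E]
    refine mul_left_cancel₀ (pow_ne_zero 2 h2) (mul_left_cancel₀ (pow_ne_zero 2 ht0) ?_)
    linear_combination (4 * w ^ 2 - 4) * hjt' + (t + 256) ^ 3 * h4 + hP
  have hφE := (sq_pow_eq_of_aeval_ssp hp hj0 hj hwj).1 e (by linear_combination hw + e * he)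
  rw [he] at hφE
  have htE : t * (4 - E) = 256 * (E - 1) := by linear_combination -hE
  have h4E : 4 - E ≠ 0 := fun h => by
    refine mul_ne_zero h256 h3 ?_
    linear_combination hE + (t + 256) * h
  let φ : K →+* K := iterateFrobenius K p 2
  change φ t = t
  change φ E = E at hφE
  have := congrArg φ htE
  simp only [map_mul, map_sub, map_one, map_ofNat, hφE] at this
  exact mul_right_cancel₀ h4E (this.trans htE.symm)

theorem pow_eq_self_of_level_three {K : Type*} [Field K] [IsAlgClosed K] {p : ℕ} [Fact p.Prime]
    [Algebra (ZMod p) K] [CharP K p] (hp : 5 ≤ p) {j : K} (hj0 : j ≠ 0) (hj : aeval j (ssp p) = 0)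
    {t u : K} (htu : t * u = 729) (hjt : 27 * j = (t + 27) * (u + 3) ^ 3) :
    t ^ p ^ 2 = t := by
  have h2 : (2 : K) ≠ 0 := two_ne_zero_of_five_le hp
  have h3 : (3 : K) ≠ 0 := three_ne_zero_of_five_le hp
  have h27 : (27 : K) ≠ 0 := by
    rw [show (27 : K) = 3 ^ 3 by norm_num]; exact pow_ne_zero _ h3
  have ht0 : t ≠ 0 := by
    rintro rfl
    exact pow_ne_zero 6 h3 (by linear_combination -htu)
  have hjt' : j * t ^ 3 = (t + 27) * (t + 243) ^ 3 := by
    have hu : t * (u + 3) = 3 * (t + 243) := by linear_combination htu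
    have hu3 : (t * (u + 3)) ^ 3 = (3 * (t + 243)) ^ 3 := by rw [hu]
    exact mul_left_cancel₀ h27 (by linear_combination t ^ 3 * hjt + (t + 27) * hu3)
  have hjt0 : j * t ^ 3 ≠ 0 := mul_ne_zero hj0 (pow_ne_zero 3 ht0)
  have ht27 : t + 27 ≠ 0 := fun h => hjt0 (by rw [hjt', h, zero_mul])
  have ht : t + 243 ≠ 0 := fun h => hjt0 (by rw [hjt', h]; ring)
  obtain ⟨E, hE⟩ : ∃ E : K, E * (t + 243) = 9 * (t + 27) :=
    ⟨9 * (t + 27) / (t + 243), div_mul_cancel₀ _ ht⟩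
  have hE0 : E ≠ 0 := by
    rintro rfl
    refine mul_ne_zero (pow_ne_zero 2 h3) ht27 ?_
    linear_combination -hE
  obtain ⟨e, he⟩ := IsAlgClosed.exists_pow_nat_eq E two_pos
  have he0 : e ≠ 0 := by
    rintro rfl
    exact hE0 (by linear_combination -he)
  have h8 : (8 : K) ≠ 0 := by
    rw [show (8 : K) = 2 ^ 3 by norm_num]; exact pow_ne_zero _ h2
  obtain ⟨w, hw⟩ : ∃ w : K, 8 * w * e = 3 + 6 * E - E ^ 2 :=
    ⟨(3 + 6 * E - E ^ 2) / (8 * e), by field_simp⟩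
  have hwj : w ^ 2 * j = j - 1728 := by
    have h64 : 64 * E * w ^ 2 = (3 + 6 * E - E ^ 2) ^ 2 := by
      linear_combination (8 * w * e + (3 + 6 * E - E ^ 2)) * hw - 64 * w ^ 2 * he
    have hP : (3 + 6 * E - E ^ 2) * (t + 243) ^ 2 =
        3 * (t + 243) ^ 2 + 6 * (9 * (t + 27)) * (t + 243) - (9 * (t + 27)) ^ 2 := by
      rw [← hE]; ring
    have hP2 := congrArg (· ^ 2) hP
    beta_reduce at hP2
    refine mul_left_cancel₀ (mul_ne_zero h8 (mul_ne_zero h8 hE0)) (mul_left_cancel₀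
      (mul_ne_zero (pow_ne_zero 3 ht0) ht) ?_)
    linear_combination (64 * E * (t + 243) * (w ^ 2 - 1)) * hjt' + (t + 27) * (t + 243) ^ 4 * h64
      + (t + 27) * hP2 - 64 * ((t + 27) * (t + 243) ^ 3 - 1728 * t ^ 3) * hE
  have hφE := (sq_pow_eq_of_aeval_ssp hp hj0 hj hwj).2 e
    (by linear_combination hw + (e ^ 2 + E - 6) * he)
  rw [he] at hφE
  have htE : t * (9 - E) = 243 * (E - 1) := by linear_combination -hE
  have h9E : 9 - E ≠ 0 := fun h => by
    refine mul_ne_zero h8 (pow_ne_zero 5 h3) ?_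
    linear_combination hE + (t + 243) * h
  let φ : K →+* K := iterateFrobenius K p 2
  change φ t = t
  change φ E = E at hφE
  have := congrArg φ htE
  simp only [map_mul, map_sub, map_one, map_ofNat, hφE] at this
  exact mul_right_cancel₀ h9E (this.trans htE.symm)

theorem pow_eq_self_of_modular_level_two {K : Type*} [Field K] [IsAlgClosed K] {p : ℕ}
    [Fact p.Prime] [Algebra (ZMod p) K] [CharP K p] (hp : 5 ≤ p) {j y : K}
    (hj : aeval j (ssp p) = 0)
    (hy : j ^ 2 - j * (y ^ 2 - 207 * y + 3456) + (y + 144) ^ 3 = 0) : y ^ p ^ 2 = y := by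
  let φ : K →+* K := iterateFrobenius K p 2
  change φ y = y
  by_cases hj0 : j = 0
  · have : (y + 144) ^ 3 = 0 := by
      rw [hj0] at hy
      linear_combination hy
    rw [eq_neg_of_add_eq_zero_left ((pow_eq_zero_iff three_ne_zero).1 this), map_neg, map_ofNat]
  obtain ⟨t, ht⟩ := IsAlgClosed.exists_root_quadratic (128 - y) 4096
  obtain ⟨u, rfl⟩ : ∃ u, y = t + u + 128 := ⟨y - t - 128, by ring⟩
  have htu : t * u = 4096 := by linear_combination -ht
  have hut : u * t = 4096 := by rw [mul_comm, htu]
  have hprod : (256 * j - (t + 256) * (u + 16) ^ 2) * (256 * j - (u + 256) * (t + 16) ^ 2) = 0 := by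
    have hsum : (t + 256) * (u + 16) ^ 2 + (u + 256) * (t + 16) ^ 2 =
        256 * ((t + u + 128) ^ 2 - 207 * (t + u + 128) + 3456) := by
      linear_combination (t + u - 448) * htu
    have h1 : (t + 256) * (u + 256) = 256 * (t + u + 128 + 144) := by linear_combination htu
    have h2 : (t + 16) * (u + 16) = 16 * (t + u + 128 + 144) := by linear_combination htu
    have h3 : ((t + 256) * (u + 256)) * ((t + 16) * (u + 16)) ^ 2 =
        256 ^ 2 * (t + u + 128 + 144) ^ 3 := by
      rw [h1, h2]; ring
    linear_combination 256 ^ 2 * hy - 256 * j * hsum + h3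
  have h : φ t = t ∧ φ u = u := by
    have h2 : (2 : K) ≠ 0 := two_ne_zero_of_five_le hp
    have h4096 : (4096 : K) ≠ 0 := by
      rw [show (4096 : K) = 2 ^ 12 by norm_num]; exact pow_ne_zero _ h2
    have hφ := congrArg φ htu
    rw [map_mul, map_ofNat, ← htu] at hφ
    rcases mul_eq_zero.1 hprod with h | h
    · have ht' : φ t = t := pow_eq_self_of_level_two hp hj0 hj htu (sub_eq_zero.1 h)
      rw [ht'] at hφ
      exact ⟨ht', mul_left_cancel₀ (left_ne_zero_of_mul (htu.trans_ne h4096)) hφ⟩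
    · have hu' : φ u = u := pow_eq_self_of_level_two hp hj0 hj hut (sub_eq_zero.1 h)
      rw [hu'] at hφ
      exact ⟨mul_right_cancel₀ (right_ne_zero_of_mul (htu.trans_ne h4096)) hφ, hu'⟩
  rw [map_add, map_add, h.1, h.2, map_ofNat]

theorem pow_eq_self_of_modular_level_three {K : Type*} [Field K] [IsAlgClosed K] {p : ℕ}
    [Fact p.Prime] [Algebra (ZMod p) K] [CharP K p] (hp : 5 ≤ p) {j y : K}
    (hj : aeval j (ssp p) = 0)
    (hy : j ^ 2 - j * y * (y ^ 2 - 126 * y + 2944) + y * (y + 192) ^ 3 = 0) :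
    y ^ p ^ 2 = y := by
  let φ : K →+* K := iterateFrobenius K p 2
  change φ y = y
  by_cases hj0 : j = 0
  · have : y * (y + 192) ^ 3 = 0 := by
      rw [hj0] at hy
      linear_combination hy
    rcases mul_eq_zero.1 this with rfl | h
    · exact map_zero φ
    · rw [eq_neg_of_add_eq_zero_left ((pow_eq_zero_iff three_ne_zero).1 h), map_neg, map_ofNat]
  obtain ⟨t, ht⟩ := IsAlgClosed.exists_root_quadratic (54 - y) 729
  obtain ⟨u, rfl⟩ : ∃ u, y = t + u + 54 := ⟨y - t - 54, by ring⟩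
  have htu : t * u = 729 := by linear_combination -ht
  have hut : u * t = 729 := by rw [mul_comm, htu]
  have hprod : (27 * j - (t + 27) * (u + 3) ^ 3) * (27 * j - (u + 27) * (t + 3) ^ 3) = 0 := by
    have hsum : (t + 27) * (u + 3) ^ 3 + (u + 27) * (t + 3) ^ 3 =
        27 * ((t + u + 54) * ((t + u + 54) ^ 2 - 126 * (t + u + 54) + 2944)) := by
      linear_combination ((t + u) ^ 2 - 2 * (t * u + 729) - 72 * (t + u) - 432) * htu
    have h1 : (t + 27) * (u + 27) = 27 * (t + u + 54) := by linear_combination htu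
    have h2 : (t + 3) * (u + 3) = 3 * (t + u + 54 + 192) := by linear_combination htu
    have h3 : ((t + 27) * (u + 27)) * ((t + 3) * (u + 3)) ^ 3 =
        27 ^ 2 * ((t + u + 54) * (t + u + 54 + 192) ^ 3) := by
      rw [h1, h2]; ring
    linear_combination 27 ^ 2 * hy - 27 * j * hsum + h3
  have h : φ t = t ∧ φ u = u := by
    have h3 : (3 : K) ≠ 0 := three_ne_zero_of_five_le hp
    have h729 : (729 : K) ≠ 0 := by
      rw [show (729 : K) = 3 ^ 6 by norm_num]; exact pow_ne_zero _ h3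
    have hφ := congrArg φ htu
    rw [map_mul, map_ofNat, ← htu] at hφ
    rcases mul_eq_zero.1 hprod with h | h
    · have ht' : φ t = t := pow_eq_self_of_level_three hp hj0 hj htu (sub_eq_zero.1 h)
      rw [ht'] at hφ
      exact ⟨ht', mul_left_cancel₀ (left_ne_zero_of_mul (htu.trans_ne h729)) hφ⟩
    · have hu' : φ u = u := pow_eq_self_of_level_three hp hj0 hj hut (sub_eq_zero.1 h)
      rw [hu'] at hφ
      exact ⟨mul_right_cancel₀ (right_ne_zero_of_mul (htu.trans_ne h729)) hφ, hu'⟩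
  rw [map_add, map_add, h.1, h.2, map_ofNat]

/-- For a prime `p ≥ 5`, if `j` is a supersingular `j`-invariant in an algebraic
closure of `𝔽_p` and `y` satisfies `R₂(j,y) = 0` or `R₃(j,y) = 0`, then `y` lies in
`𝔽_{p²}`, i.e. `y^{p²} = y`. -/
theorem fricke_2_3_values_in_Fp2 (p : ℕ) [Fact p.Prime] (hp : 5 ≤ p)
    (j y : AlgebraicClosure (ZMod p)) (hj : aeval j (ssp p) = 0)
    (hy : j ^ 2 - j * (y ^ 2 - 207 * y + 3456) + (y + 144) ^ 3 = 0 ∨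
          j ^ 2 - j * y * (y ^ 2 - 126 * y + 2944) + y * (y + 192) ^ 3 = 0) :
    y ^ p ^ 2 = y := by
  have : CharP (AlgebraicClosure (ZMod p)) p :=
    charP_of_injective_algebraMap (algebraMap (ZMod p) (AlgebraicClosure (ZMod p))).injective p
  exact hy.elim (pow_eq_self_of_modular_level_two hp hj) (pow_eq_self_of_modular_level_three hp hj)
end

section
/- Let p ≥ 5 be a prime and let 𝔽̄_p be an algebraic closure of 𝔽_p. Suppose j ∈ 𝔽̄_p is a supersingular j-invariant, i.e., ss_p(j) = 0, and y ∈ 𝔽̄_p satisfies either R₅(j,y) = 0 with p ≠ 5, or R₇(j,y) = 0 with p ≠ 7. Then y lies in the quadratic subfield 𝔽_{p²} of 𝔽̄_p, i.e., y^{p²} = y. -/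
open Polynomial

section Supersingularity

open WeierstrassCurve

lemma addSub_some_some_of_X_ne {F : Type*} [Field F] [DecidableEq F] {W : WeierstrassCurve.Affine F}
    {x₁ y₁ x₂ y₂ : F} (h₁ : W.Nonsingular x₁ y₁) (h₂ : W.Nonsingular x₂ y₂) (hx : x₁ ≠ x₂) :
    ∃ x₃ x₄ : F, (Affine.Point.some _ _ h₁ + Affine.Point.some _ _ h₂).xRep = ![x₃, 1] ∧
      (Affine.Point.some _ _ h₁ - Affine.Point.some _ _ h₂).xRep = ![x₄, 1] ∧
      (x₁ * x₂) ^ 2 - W.b₄ * (x₁ * x₂) - W.b₆ * (x₁ + x₂) - W.b₈ = (x₁ - x₂) ^ 2 * (x₃ * x₄) ∧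
      2 * (x₁ + x₂) * (x₁ * x₂) + W.b₂ * (x₁ * x₂) + W.b₄ * (x₁ + x₂) + W.b₆ =
        (x₁ - x₂) ^ 2 * (x₃ + x₄) := by
  have e₁ := (W.equation_iff _ _).mp h₁.left
  have e₂ := (W.equation_iff _ _).mp h₂.left
  have hd : x₁ - x₂ ≠ 0 := sub_ne_zero.mpr hx
  rw [sub_eq_add_neg, Affine.Point.neg_some, Affine.Point.add_of_X_ne hx,
    Affine.Point.add_of_X_ne hx]
  refine ⟨_, _, rfl, rfl, ?_, ?_⟩
  · rw [Affine.slope_of_X_ne hx, Affine.slope_of_X_ne hx]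
    simp only [Affine.addX, Affine.negY, b₄, b₆, b₈]
    generalize W.a₁ = a₁ at *
    generalize W.a₂ = a₂ at *
    generalize W.a₃ = a₃ at *
    generalize W.a₄ = a₄ at *
    have h6 := eq_sub_of_add_eq' e₁.symm
    field_simp
    generalize W.a₆ = a₆ at *
    subst h6
    grind
  · rw [Affine.slope_of_X_ne hx, Affine.slope_of_X_ne hx]
    simp only [Affine.addX, Affine.negY, b₂, b₄, b₆]
    field_simp
    linear_combination -2 * e₁ - 2 * e₂

lemma exists_addSub {F : Type*} [Field F] [DecidableEq F] {W : WeierstrassCurve.Affine F}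
    [WeierstrassCurve.IsElliptic W] (P Q : W.Point) :
    ∃ c : F, c ≠ 0 ∧
      (P.sym2x Q 0) ^ 2 - W.b₄ * P.sym2x Q 0 * P.sym2x Q 2 - W.b₆ * P.sym2x Q 1 * P.sym2x Q 2
        - W.b₈ * P.sym2x Q 2 ^ 2 = c * (P + Q).sym2x (P - Q) 0 ∧
      2 * P.sym2x Q 1 * P.sym2x Q 0 + W.b₂ * P.sym2x Q 0 * P.sym2x Q 2
        + W.b₄ * P.sym2x Q 1 * P.sym2x Q 2 + W.b₆ * P.sym2x Q 2 ^ 2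
          = c * (P + Q).sym2x (P - Q) 1 ∧
      P.sym2x Q 1 ^ 2 - 4 * P.sym2x Q 0 * P.sym2x Q 2 = c * (P + Q).sym2x (P - Q) 2 := by
  rcases P with _ | @⟨x₁, y₁, h₁⟩
  · refine ⟨1, one_ne_zero, ?_⟩
    rw [← Affine.Point.zero_def, zero_add, zero_sub, Affine.Point.sym2x_neg_right]
    cases Q <;> simp [Affine.Point.sym2x, ← Affine.Point.zero_def]
    ring_nf
    simp
  rcases Q with _ | @⟨x₂, y₂, h₂⟩
  · refine ⟨1, one_ne_zero, ?_⟩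
    rw [← Affine.Point.zero_def, add_zero, sub_zero]
    simp [Affine.Point.sym2x]
    ring_nf
    simp
  by_cases hx : x₁ = x₂
  swap
  · obtain ⟨x₃, x₄, h3, h4, e0, e1⟩ := addSub_some_some_of_X_ne h₁ h₂ hx
    refine ⟨(x₁ - x₂) ^ 2, pow_ne_zero _ (sub_ne_zero.mpr hx), ?_⟩
    simp only [Affine.Point.sym2x, h3, h4, Affine.Point.xRep_some]
    simp
    refine ⟨by linear_combination e0, by linear_combination e1, by ring⟩
  subst hx
  have key : ∀ y₁ (h₁ : W.Nonsingular x₁ y₁), ∃ c : F, c ≠ 0 ∧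
      (x₁ ^ 2) ^ 2 - W.b₄ * x₁ ^ 2 - W.b₆ * (2 * x₁) - W.b₈ =
        c * (Affine.Point.some _ _ h₁ + Affine.Point.some _ _ h₁).sym2x 0 0 ∧
      2 * (2 * x₁) * x₁ ^ 2 + W.b₂ * x₁ ^ 2 + W.b₄ * (2 * x₁) + W.b₆ =
        c * (Affine.Point.some _ _ h₁ + Affine.Point.some _ _ h₁).sym2x 0 1 ∧
      0 = c * (Affine.Point.some _ _ h₁ + Affine.Point.some _ _ h₁).sym2x 0 2 := by
    intro y₁ h₁
    have e₁ := (W.equation_iff _ _).mp h₁.left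
    by_cases hy : y₁ = W.negY x₁ y₁
    · have h0 : Affine.Point.some _ _ h₁ + Affine.Point.some _ _ h₁ = 0 :=
        Affine.Point.add_self_of_Y_eq hy
      have hT : 2 * (2 * x₁) * x₁ ^ 2 + W.b₂ * x₁ ^ 2 + W.b₄ * (2 * x₁) + W.b₆ = 0 := by
        rw [Affine.negY] at hy
        simp only [b₂, b₄, b₆]
        linear_combination (-4) * e₁ + (2 * y₁ + W.a₁ * x₁ + W.a₃) * hy
      rw [h0]
      refine ⟨(x₁ ^ 2) ^ 2 - W.b₄ * x₁ ^ 2 - W.b₆ * (2 * x₁) - W.b₈, fun h ↦ ?_, ?_⟩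
      · refine addSubMap_ne_zero W (x := ![x₁ ^ 2, 2 * x₁, 1]) (by simp) ?_
        ext i
        fin_cases i <;> simp [addSubMap]
        · linear_combination h
        · linear_combination hT
        · ring
      · simp [hT]
    · have hd : y₁ - W.negY x₁ y₁ ≠ 0 := sub_ne_zero.mpr hy
      rw [Affine.Point.add_self_of_Y_ne hy]
      refine ⟨2 * (2 * x₁) * x₁ ^ 2 + W.b₂ * x₁ ^ 2 + W.b₄ * (2 * x₁) + W.b₆, ?_, ?_⟩
      · convert pow_ne_zero 2 hd using 1
        simp only [b₂, b₄, b₆, Affine.negY]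
        linear_combination (-4) * e₁
      · simp only [Affine.Point.sym2x_some_zero, Matrix.cons_val, mul_one, mul_zero,
          and_true]
        rw [Affine.slope_of_Y_ne rfl hy]
        simp only [Affine.addX]
        rw [Affine.negY] at hd ⊢
        have hd' : y₁ - (-y₁ - W.a₁ * x₁ - W.a₃) = 2 * y₁ + W.a₁ * x₁ + W.a₃ := by ring
        rw [hd'] at hd ⊢
        have hT : 2 * (2 * x₁) * x₁ ^ 2 + W.b₂ * x₁ ^ 2 + W.b₄ * (2 * x₁) + W.b₆ =
            (2 * y₁ + W.a₁ * x₁ + W.a₃) ^ 2 := by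
          simp only [b₂, b₄, b₆]
          linear_combination (-4) * e₁
        rw [hT]
        obtain ⟨d, hdd⟩ : ∃ d, d = 2 * y₁ + W.a₁ * x₁ + W.a₃ := ⟨_, rfl⟩
        rw [← hdd] at hd ⊢
        field_simp
        simp only [b₄, b₆, b₈]
        subst hdd
        generalize W.a₁ = a₁ at *
        generalize W.a₂ = a₂ at *
        generalize W.a₃ = a₃ at *
        generalize W.a₄ = a₄ at *
        generalize W.a₆ = a₆ at *
        have h6 := eq_sub_of_add_eq' e₁.symm
        subst h6
        ring
  rcases Affine.Y_eq_of_X_eq h₁.left h₂.left rfl with rfl | rfl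
  · obtain ⟨c, hc, h⟩ := key y₁ h₁
    refine ⟨c, hc, ?_⟩
    rw [sub_self, ← h.1, ← h.2.1, ← h.2.2]
    simp
    ring_nf
    simp
  · obtain ⟨c, hc, h⟩ := key y₂ h₂
    have h2 : Affine.Point.some _ _ h₁ = -Affine.Point.some _ _ h₂ := rfl
    refine ⟨c, hc, ?_⟩
    rw [h2, neg_add_cancel, ← neg_add', Affine.Point.sym2x_neg_right,
      Affine.Point.sym2x_neg_left, Affine.Point.sym2x_comm 0, ← h.1, ← h.2.1, ← h.2.2]
    simp
    ring_nf
    simp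

lemma exists_nonsingular_point {K : Type*} [Field K] [IsAlgClosed K]
    {W : WeierstrassCurve.Affine K} [WeierstrassCurve.IsElliptic W] (x : K) :
    ∃ y, W.Nonsingular x y := by
  obtain ⟨y, hy⟩ := IsAlgClosed.exists_root
    (X ^ 2 + C (W.a₁ * x + W.a₃) * X - C (x ^ 3 + W.a₂ * x ^ 2 + W.a₄ * x + W.a₆) : K[X])
    (by
      have : (X ^ 2 + C (W.a₁ * x + W.a₃) * X - C (x ^ 3 + W.a₂ * x ^ 2 + W.a₄ * x + W.a₆)
        : K[X]).degree = 2 := by compute_degree!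
      rw [this]; norm_num)
  refine ⟨y, (Affine.equation_iff_nonsingular).mp ((W.equation_iff _ _).mpr ?_)⟩
  simp at hy
  linear_combination hy

lemma xRep_eq_or {K : Type*} [Field K] {W : WeierstrassCurve.Affine K} (P : W.Point) :
    P.xRep = ![1, 0] ∨ ∃ x, P.xRep = ![x, 1] := by
  cases P <;> simp [← Affine.Point.zero_def]

lemma exists_factor_of_binary_form_root {K : Type*} [Field K] {u v T₀ T₁ T₂ : K[X]}
    (huv : IsCoprime u v) (hu : u ≠ 0) (h : T₀ * v ^ 2 - T₁ * (u * v) + T₂ * u ^ 2 = 0) :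
    ∃ a c : K[X], T₀ = u * a ∧ T₁ = a * v + c * u ∧ T₂ = v * c := by
  obtain ⟨a, rfl⟩ : u ∣ T₀ := by
    refine (huv.pow_right (n := 2)).dvd_of_dvd_mul_right ⟨T₁ * v - T₂ * u, ?_⟩
    linear_combination h
  have h' : v * (a * v - T₁) + T₂ * u = 0 := by
    refine mul_left_cancel₀ hu ?_
    linear_combination h
  obtain ⟨c, hc⟩ : u ∣ T₁ - a * v := by
    refine huv.dvd_of_dvd_mul_left ⟨T₂, ?_⟩
    linear_combination -h'
  refine ⟨a, c, rfl, by linear_combination hc, mul_left_cancel₀ hu ?_⟩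
  linear_combination h' + v * hc

/-- `u / v` expresses the `x`-coordinate of `n • P` in terms of that of `P`. -/
def IsMulMap {K : Type*} [Field K] [DecidableEq K] (W : WeierstrassCurve.Affine K) (n : ℕ)
    (u v : K[X]) : Prop :=
  u.degree = (n ^ 2 : ℕ) ∧ v.degree < (n ^ 2 : ℕ) ∧
    ∀ x y (h : W.Nonsingular x y), ∃ c : K, c ≠ 0 ∧
      u.eval x = c * (n • Affine.Point.some x y h).xRep 0 ∧
      v.eval x = c * (n • Affine.Point.some x y h).xRep 1

section MulMap

variable {K : Type*} [Field K] [DecidableEq K] {W : WeierstrassCurve.Affine K}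

lemma IsMulMap.isCoprime [IsAlgClosed K] [WeierstrassCurve.IsElliptic W] {n : ℕ} {u v : K[X]}
    (h : IsMulMap W n u v) : IsCoprime u v := by
  rw [Polynomial.isCoprime_iff_aeval_ne_zero_of_isAlgClosed K K]
  intro x
  obtain ⟨y, hy⟩ := exists_nonsingular_point (W := W) x
  obtain ⟨c, hc, h0, h1⟩ := h.2.2 x y hy
  simp only [coe_aeval_eq_eval, h0, h1]
  have := Affine.Point.xRep_ne_zero (n • Affine.Point.some x y hy)
  contrapose! this
  ext i
  fin_cases i
  · simpa [hc] using this.1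
  · simpa [hc] using this.2

lemma isMulMap_zero : IsMulMap W 0 1 0 := by
  refine ⟨by simp, by simp, fun x y h ↦ ⟨1, one_ne_zero, by simp, by simp⟩⟩

lemma isMulMap_one : IsMulMap W 1 X 1 := by
  refine ⟨by simp, ?_, fun x y h ↦ ⟨1, one_ne_zero, by simp, by simp⟩⟩
  rw [degree_one]
  norm_num

lemma IsMulMap.step [IsAlgClosed K] [WeierstrassCurve.IsElliptic W] {n : ℕ} {u₀ v₀ u₁ v₁ : K[X]}
    (h₀ : IsMulMap W n u₀ v₀) (h₁ : IsMulMap W (n + 1) u₁ v₁) :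
    ∃ u v, IsMulMap W (n + 2) u v := by
  have hu₀ : u₀ ≠ 0 := by
    rintro rfl
    have := h₀.1
    rw [degree_zero] at this
    exact WithBot.bot_ne_coe this
  obtain ⟨s, hs⟩ : ∃ s, s = u₁ * X := ⟨_, rfl⟩
  obtain ⟨t, ht⟩ : ∃ t, t = u₁ + X * v₁ := ⟨_, rfl⟩
  obtain ⟨T₀, hT₀⟩ : ∃ T, T = s ^ 2 - C W.b₄ * s * v₁ - C W.b₆ * t * v₁ - C W.b₈ * v₁ ^ 2 :=
    ⟨_, rfl⟩
  obtain ⟨T₁, hT₁⟩ : ∃ T, T = 2 * t * s + C W.b₂ * s * v₁ + C W.b₄ * t * v₁ + C W.b₆ * v₁ ^ 2 :=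
    ⟨_, rfl⟩
  obtain ⟨T₂, hT₂⟩ : ∃ T, T = t ^ 2 - 4 * s * v₁ := ⟨_, rfl⟩
  have key : ∀ x y (h : W.Nonsingular x y), ∃ k : K, k ≠ 0 ∧
      T₀.eval x = k * ((n + 2) • Affine.Point.some x y h).sym2x (n • Affine.Point.some x y h) 0 ∧
      T₁.eval x = k * ((n + 2) • Affine.Point.some x y h).sym2x (n • Affine.Point.some x y h) 1 ∧
      T₂.eval x = k * ((n + 2) • Affine.Point.some x y h).sym2x
        (n • Affine.Point.some x y h) 2 := by
    intro x y h
    obtain ⟨c, hc, e0, e1⟩ := h₁.2.2 x y h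
    obtain ⟨d, hd, f0, f1, f2⟩ :=
      exists_addSub ((n + 1) • Affine.Point.some x y h) (Affine.Point.some x y h)
    rw [← succ_nsmul, show (n + 1) • Affine.Point.some x y h - Affine.Point.some x y h =
      n • Affine.Point.some x y h by rw [succ_nsmul, add_sub_cancel_right]] at f0 f1 f2
    refine ⟨c ^ 2 * d, mul_ne_zero (pow_ne_zero 2 hc) hd, ?_⟩
    rw [mul_assoc, mul_assoc, mul_assoc, ← f0, ← f1, ← f2, hT₀, hT₁, hT₂, hs, ht]
    simp [Affine.Point.sym2x, e0, e1]
    refine ⟨?_, ?_, ?_⟩ <;> ring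
  have hroot : T₀ * v₀ ^ 2 - T₁ * (u₀ * v₀) + T₂ * u₀ ^ 2 = 0 := by
    refine Polynomial.funext fun x ↦ ?_
    obtain ⟨y, h⟩ := exists_nonsingular_point (W := W) x
    obtain ⟨k, hk, e0, e1, e2⟩ := key x y h
    obtain ⟨c, hc, f0, f1⟩ := h₀.2.2 x y h
    simp [e0, e1, e2, f0, f1, Affine.Point.sym2x]
    ring
  obtain ⟨a, c, ha, hac, hc⟩ := exists_factor_of_binary_form_root h₀.isCoprime hu₀ hroot
  refine ⟨a, c, ?_⟩
  obtain ⟨m, hm⟩ : ∃ m, (n + 1) ^ 2 = m + 1 := ⟨n ^ 2 + 2 * n, by ring⟩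
  have du₀ : u₀.natDegree = n ^ 2 := natDegree_eq_of_degree_eq_some h₀.1
  have du₁ : u₁.natDegree = m + 1 := by rw [natDegree_eq_of_degree_eq_some h₁.1, hm]
  have hu₁ : u₁ ≠ 0 := by
    rintro rfl
    simp at du₁
  have dv₁ : v₁.natDegree ≤ m := by
    have := h₁.2.1
    rw [hm] at this
    exact natDegree_le_of_degree_le (Order.le_of_lt_succ this)
  have ds : s.natDegree = m + 2 := by rw [hs, natDegree_mul_X hu₁, du₁]
  have dt : t.natDegree ≤ m + 1 := by
    rw [ht]
    refine natDegree_add_le_of_degree_le du₁.le ?_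
    refine (natDegree_mul_le_of_le natDegree_X_le dv₁).trans ?_
    omega
  have hs0 : s ≠ 0 := by
    rintro h
    simp [h] at ds
  have d₀ : T₀.natDegree = 2 * (m + 2) := by
    have hR : (C W.b₄ * s * v₁ + C W.b₆ * t * v₁ + C W.b₈ * v₁ ^ 2).natDegree ≤ 2 * m + 2 := by
      compute_degree
      all_goals omega
    rw [hT₀, show s ^ 2 - C W.b₄ * s * v₁ - C W.b₆ * t * v₁ - C W.b₈ * v₁ ^ 2 = s ^ 2 -
      (C W.b₄ * s * v₁ + C W.b₆ * t * v₁ + C W.b₈ * v₁ ^ 2) by ring,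
      natDegree_sub_eq_left_of_natDegree_lt] <;> rw [natDegree_pow, ds]
    omega
  have d₁ : T₁.natDegree ≤ 2 * m + 3 := by
    rw [hT₁]
    compute_degree
    all_goals omega
  have ha0 : a ≠ 0 := by
    rintro rfl
    simp [ha] at d₀
  have da : a.natDegree = (n + 2) ^ 2 := by
    rw [ha, natDegree_mul hu₀ ha0, du₀] at d₀
    nlinarith
  have hdeg : a.degree = ((n + 2) ^ 2 : ℕ) := by
    rw [degree_eq_natDegree ha0, da]
  refine ⟨hdeg, ?_, fun x y h ↦ ?_⟩
  · by_cases hc0 : c = 0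
    · rw [hc0, degree_zero]
      exact WithBot.bot_lt_coe _
    rw [← natDegree_lt_iff_degree_lt hc0]
    have h2 : (c * u₀).natDegree < (n + 2) ^ 2 + n ^ 2 := by
      rw [natDegree_lt_iff_degree_lt (mul_ne_zero hc0 hu₀),
        show c * u₀ = T₁ - a * v₀ by rw [hac]; ring]
      refine (degree_sub_le _ _).trans_lt (max_lt ?_ ?_)
      · refine (degree_le_of_natDegree_le d₁).trans_lt (Nat.cast_lt.mpr ?_)
        nlinarith
      · rw [degree_mul, hdeg, Nat.cast_add]
        exact WithBot.add_lt_add_left WithBot.coe_ne_bot h₀.2.1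
    rw [natDegree_mul hc0 hu₀, du₀] at h2
    omega
  · obtain ⟨k, hk, e0, e1, e2⟩ := key x y h
    obtain ⟨d, hd, f0, f1⟩ := h₀.2.2 x y h
    refine ⟨k / d, div_ne_zero hk hd, ?_⟩
    rw [ha] at e0
    rw [hac] at e1
    rw [hc] at e2
    simp [f0, f1, Affine.Point.sym2x] at e0 e1 e2
    rcases xRep_eq_or (n • Affine.Point.some x y h) with h' | ⟨r, h'⟩
    · simp [h'] at e0 e1
      field_simp
      exact ⟨by linear_combination e0, by linear_combination e1⟩
    · simp [h'] at e1 e2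
      field_simp
      exact ⟨by linear_combination e1 - r * e2, by linear_combination e2⟩

lemma exists_isMulMap [IsAlgClosed K] [WeierstrassCurve.IsElliptic W] (n : ℕ) :
    ∃ u v, IsMulMap W n u v := by
  have : (∃ u v, IsMulMap W n u v) ∧ ∃ u v, IsMulMap W (n + 1) u v := by
    induction n with
    | zero => exact ⟨⟨_, _, isMulMap_zero⟩, ⟨_, _, isMulMap_one⟩⟩
    | succ n ih =>
      obtain ⟨h₀, u₁, v₁, h₁⟩ := ih
      obtain ⟨u₀, v₀, h₀⟩ := h₀
      exact ⟨⟨_, _, h₁⟩, h₀.step h₁⟩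
  exact this.1

end MulMap

lemma eq_C_mul_X_pow_of_eval_eq_zero {K : Type*} [Field K] [IsAlgClosed K] {u : K[X]}
    (h : ∀ x, u.eval x = 0 → x = 0) : u = C u.leadingCoeff * X ^ u.natDegree := by
  by_cases hu : u = 0
  · simp [hu]
  have hs := IsAlgClosed.splits u
  have hr : u.roots = Multiset.replicate u.natDegree 0 := by
    rw [hs.natDegree_eq_card_roots]
    exact Multiset.eq_replicate_card.mpr fun x hx ↦ h x ((mem_roots hu).mp hx)
  conv_lhs => rw [hs.eq_prod_roots, hr]
  simp

section Frobenius

variable {K : Type*} [Field K] [DecidableEq K] [IsAlgClosed K] {W : WeierstrassCurve.Affine K}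
  [WeierstrassCurve.IsElliptic W]

lemma exists_xRep_nsmul_eq {n : ℕ} (hn : n ≠ 0) (h : ∀ P : W.Point, n • P = 0 → P = 0) :
    ∃ α β : K, α ≠ 0 ∧ ∀ x y (h : W.Nonsingular x y),
      (n • Affine.Point.some x y h).xRep = ![α * x ^ n ^ 2 + β, 1] := by
  obtain ⟨u, v, hdu, hdv, huv⟩ := exists_isMulMap (W := W) n
  have hu : u.natDegree = n ^ 2 := natDegree_eq_of_degree_eq_some hdu
  have hv : ∀ x, v.eval x ≠ 0 := by
    intro x hx
    obtain ⟨y, hy⟩ := exists_nonsingular_point (W := W) x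
    obtain ⟨c, hc, -, h1⟩ := huv x y hy
    rcases xRep_eq_or (n • Affine.Point.some x y hy) with h' | ⟨r, h'⟩
    · have h0 : n • Affine.Point.some x y hy = 0 := by
        rcases Affine.Point.eq_or_eq_neg_of_xRep_eq_xRep
          (h'.trans Affine.Point.xRep_zero.symm) with h | h <;> simpa using h
      exact Affine.Point.some_ne_zero hy (h _ h0)
    · simp [h', hx, hc.symm] at h1
  obtain ⟨k, rfl⟩ : ∃ k, v = C k := by
    refine ⟨_, eq_C_of_degree_eq_zero ?_⟩
    by_contra hd
    obtain ⟨x, hx⟩ := IsAlgClosed.exists_root v hd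
    exact hv x hx
  have hk : k ≠ 0 := by simpa using hv 0
  have hx : ∀ x y (h : W.Nonsingular x y),
      (n • Affine.Point.some x y h).xRep = ![u.eval x / k, 1] := by
    intro x y h
    obtain ⟨c, hc, h0, h1⟩ := huv x y h
    rcases xRep_eq_or (n • Affine.Point.some x y h) with h' | ⟨r, h'⟩
    · simp [h', hk] at h1
    · simp only [h', eval_C, Matrix.cons_val, mul_one] at h0 h1 ⊢
      rw [h0, h1, mul_div_cancel_left₀ _ hc]
  have hroot : ∀ x, (u - C (u.eval 0)).eval x = 0 → x = 0 := by
    intro x hx0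
    obtain ⟨y, hy⟩ := exists_nonsingular_point (W := W) x
    obtain ⟨y', hy'⟩ := exists_nonsingular_point (W := W) (0 : K)
    have he : (n • Affine.Point.some x y hy).xRep = (n • Affine.Point.some 0 y' hy').xRep := by
      have he0 : u.eval x = u.eval 0 := sub_eq_zero.mp (by simpa using hx0)
      rw [hx, hx, he0]
    have he' : (Affine.Point.some x y hy).xRep = (Affine.Point.some 0 y' hy').xRep := by
      rw [Affine.Point.xRep_eq_xRep_iff]
      rcases Affine.Point.eq_or_eq_neg_of_xRep_eq_xRep he with h' | h'
      · refine .inl (sub_eq_zero.mp (h _ ?_))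
        rw [nsmul_sub, h', sub_self]
      · refine .inr (eq_neg_of_add_eq_zero_left (h _ ?_))
        rw [nsmul_add, h', neg_add_cancel]
    simpa using he'
  have hn2 : n ^ 2 ≠ 0 := pow_ne_zero 2 hn
  have hdeg : (u - C (u.eval 0)).natDegree = n ^ 2 := by rw [natDegree_sub_C, hu]
  have hform := eq_C_mul_X_pow_of_eval_eq_zero hroot
  have hl : (u - C (u.eval 0)).leadingCoeff ≠ 0 := by
    rw [Ne, leadingCoeff_eq_zero]
    intro h0
    rw [h0, natDegree_zero] at hdeg
    exact hn2 hdeg.symm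
  rw [hdeg] at hform
  refine ⟨(u - C (u.eval 0)).leadingCoeff / k, u.eval 0 / k, div_ne_zero hl hk, fun x y h ↦ ?_⟩
  have hev := congrArg (eval x) hform
  simp only [eval_sub, eval_C, eval_mul, eval_pow, eval_X, sub_eq_iff_eq_add] at hev
  rw [hx, hev, add_div, mul_div_right_comm]

end Frobenius

lemma eval_twoTorsion_of_xRep_nsmul_eq {K : Type*} [Field K] [DecidableEq K] [IsAlgClosed K]
    {W : WeierstrassCurve.Affine K} [WeierstrassCurve.IsElliptic W] {n q : ℕ} (hn : Odd n)
    (h2 : (2 : K) ≠ 0) (hadd : ∀ x y : K, (x - y) ^ q = x ^ q - y ^ q) (h4 : (4 : K) ^ q = 4)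
    {α β : K} (h : ∀ x y (h : W.Nonsingular x y),
      (n • Affine.Point.some x y h).xRep = ![α * x ^ q + β, 1]) (x : K) :
    W.Ψ₂Sq.eval (α * x ^ q + β) = α ^ 3 * W.Ψ₂Sq.eval x ^ q := by
  have h4' : (4 : K) ≠ 0 := by
    rw [show (4 : K) = 2 * 2 by norm_num]
    exact mul_ne_zero h2 h2
  have hd : W.Ψ₂Sq.natDegree = 3 := W.natDegree_Ψ₂Sq h4'
  have hl : W.Ψ₂Sq.leadingCoeff = 4 := W.leadingCoeff_Ψ₂Sq h4'
  have hs := IsAlgClosed.splits W.Ψ₂Sq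
  have hroot : ∀ e ∈ W.Ψ₂Sq.roots, α * e ^ q + β = e := by
    intro e he
    have he := (mem_roots'.mp he).2
    obtain ⟨y, hy⟩ : ∃ y, 2 * y + W.a₁ * e + W.a₃ = 0 :=
      ⟨-(W.a₁ * e + W.a₃) / 2, by field_simp; ring⟩
    have hns : W.Nonsingular e y := by
      refine (Affine.equation_iff_nonsingular).mp ((W.equation_iff _ _).mpr ?_)
      simp [WeierstrassCurve.Ψ₂Sq, b₂, b₄, b₆] at he
      refine mul_left_cancel₀ h4' ?_
      linear_combination (2 * y + W.a₁ * e + W.a₃) * hy - he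
    have h0 : 2 • Affine.Point.some e y hns = 0 := by
      rw [two_nsmul]
      refine Affine.Point.add_self_of_Y_eq ?_
      rw [Affine.negY]
      linear_combination hy
    have := h e y hns
    obtain ⟨m, rfl⟩ := hn
    rw [add_nsmul, mul_nsmul, h0, nsmul_zero, zero_add, one_nsmul] at this
    simpa using (congrFun this 0).symm
  have hcard : Multiset.card W.Ψ₂Sq.roots = 3 := by rw [← hs.natDegree_eq_card_roots, hd]
  obtain ⟨e₁, e₂, e₃, he⟩ := Multiset.card_eq_three.mp hcard
  have hf : ∀ z, W.Ψ₂Sq.eval z = 4 * ((z - e₁) * (z - e₂) * (z - e₃)) := by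
    intro z
    rw [hs.eq_prod_roots, hl, he]
    simp [mul_assoc]
  have r₁ := hroot e₁ (by simp [he])
  have r₂ := hroot e₂ (by simp [he])
  have r₃ := hroot e₃ (by simp [he])
  rw [hf, hf, mul_pow, mul_pow, mul_pow, hadd, hadd, hadd, h4]
  nth_rw 1 [← r₁, ← r₂, ← r₃]
  ring

lemma coeff_pow_half_card_sub_one_eq_zero {F : Type*} [Field F] {p : ℕ} [Fact p.Prime] [CharP F p]
    (hp : p ≠ 2) {f : F[X]} (hf : f.natDegree ≤ 3) (h : (f ^ (p / 2)).coeff (p - 1) = 0) {N : ℕ}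
    (hN : N ≠ 0) : (f ^ (p ^ N / 2)).coeff (p ^ N - 1) = 0 := by
  obtain ⟨N, rfl⟩ := Nat.exists_eq_add_one_of_ne_zero hN
  have hp0 : 0 < p := (Fact.out : p.Prime).pos
  obtain ⟨m, hm⟩ := (Fact.out : p.Prime).odd_of_ne_two hp
  obtain ⟨l, hl⟩ := ((Fact.out : p.Prime).odd_of_ne_two hp).pow (n := N)
  have he : p ^ (N + 1) / 2 = p / 2 + l * p := by
    have : p ^ (N + 1) = 2 * (p / 2 + l * p) + 1 := by
      rw [show p / 2 = m by omega, pow_succ, hl]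
      nlinarith
    omega
  have hd : (f ^ (p / 2)).natDegree < 2 * p - 1 := by
    refine (natDegree_pow_le_of_le _ hf).trans_lt ?_
    omega
  rw [he, pow_add, pow_mul, ← map_frobenius_expand (p := p), map_expand, coeff_mul]
  refine Finset.sum_eq_zero fun ij hij ↦ ?_
  rw [Finset.HasAntidiagonal.mem_antidiagonal] at hij
  rw [coeff_expand hp0]
  split_ifs with hdvd
  · obtain ⟨k, hk⟩ := hdvd
    have hi : (f ^ (p / 2)).coeff ij.1 = 0 := by
      by_cases hi : ij.1 < 2 * p - 1
      · have h1 : ij.1 + 1 + p * k = p * p ^ N := by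
          have : 0 < p ^ (N + 1) := by positivity
          rw [← hk, ← pow_succ']
          omega
        have h2 : p ∣ ij.1 + 1 := (Nat.dvd_add_left ⟨k, rfl⟩).mp ⟨_, h1⟩
        obtain ⟨c, hc⟩ := h2
        have hc1 : c = 1 := by
          rcases c with _ | _ | c
          · omega
          · rfl
          · have : 2 * p ≤ p * (c + 1 + 1) := by rw [mul_comm]; gcongr; omega
            omega
        rw [show ij.1 = p - 1 by rw [hc1] at hc; omega, h]
      · exact coeff_eq_zero_of_natDegree_lt (by omega)
    rw [hi, zero_mul]
  · rw [mul_zero]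

lemma sum_eval_eq_zero_of_coeff_eq_zero {F : Type*} [Field F] [Fintype F] {g : F[X]}
    (hd : g.natDegree < 2 * (Fintype.card F - 1)) (h : g.coeff (Fintype.card F - 1) = 0) :
    ∑ x, g.eval x = 0 := by
  simp_rw [eval_eq_sum_range]
  rw [Finset.sum_comm]
  refine Finset.sum_eq_zero fun i hi ↦ ?_
  have hi : i < 2 * (Fintype.card F - 1) := by
    rw [Finset.mem_range] at hi
    omega
  rcases lt_trichotomy i (Fintype.card F - 1) with hlt | rfl | hgt
  · rw [← Finset.mul_sum, FiniteField.sum_pow_lt_card_sub_one _ _ hlt, mul_zero]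
  · rw [← Finset.mul_sum, h, zero_mul]
  · rw [← Finset.mul_sum, ← mul_zero (g.coeff i),
      ← FiniteField.sum_pow_lt_card_sub_one F (i - (Fintype.card F - 1)) (by omega)]
    congr 1
    refine Finset.sum_congr rfl fun x _ ↦ ?_
    by_cases hx : x = 0
    · rw [hx, zero_pow (by omega), zero_pow (by omega)]
    · nth_rw 1 [show i = i - (Fintype.card F - 1) + (Fintype.card F - 1) by omega]
      rw [pow_add, FiniteField.pow_card_sub_one_eq_one x hx, mul_one]

section PointCount

variable {F : Type*} [Field F] [Fintype F] [DecidableEq F] {W : WeierstrassCurve.Affine F}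
  [WeierstrassCurve.IsElliptic W]

open scoped Classical in
lemma natCard_point (hF : ringChar F ≠ 2) :
    (Nat.card W.Point : F) = 1 + ∑ x, W.Ψ₂Sq.eval x ^ (Fintype.card F / 2) := by
  have h2 : (2 : F) ≠ 0 := Ring.two_ne_zero hF
  have h4 : (4 : F) ≠ 0 := by
    rw [show (4 : F) = 2 * 2 by norm_num]
    exact mul_ne_zero h2 h2
  have hx : ∀ x, ((∑ y, if W.Equation x y then 1 else 0 : ℕ) : F) =
      W.Ψ₂Sq.eval x ^ (Fintype.card F / 2) + 1 := by
    intro x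
    have := quadraticChar_card_sqrts hF (W.Ψ₂Sq.eval x)
    have := congrArg (Int.cast : ℤ → F) this
    rw [Int.cast_add, quadraticChar_eq_pow_of_char_ne_two' hF, Int.cast_one, Int.cast_natCast]
      at this
    rw [← this]
    congr 1
    let e : F ≃ F := (Equiv.mulLeft₀ 2 h2).trans (Equiv.addRight (W.a₁ * x + W.a₃))
    rw [Set.toFinset_ofPred, Finset.card_filter,
      ← e.sum_comp fun z ↦ if z ^ 2 = W.Ψ₂Sq.eval x then 1 else 0]
    refine Finset.sum_congr rfl fun y _ ↦ if_congr ?_ rfl rfl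
    rw [W.equation_iff]
    simp [e, WeierstrassCurve.Ψ₂Sq, b₂, b₄, b₆]
    refine ⟨fun h ↦ by linear_combination 4 * h, fun h ↦ mul_left_cancel₀ h4 ?_⟩
    linear_combination h
  have : Nat.card W.Point = 1 + ∑ x, ∑ y, if W.Equation x y then 1 else 0 := by
    have : Nat.card W.Point = Nat.card (Option {xy : F × F // W.Equation xy.1 xy.2}) := by
      refine Nat.card_congr ((Affine.nonsingularPointEquiv W).trans ?_)
      exact (Equiv.subtypeEquivRight fun xy ↦ Affine.equation_iff_nonsingular.symm).optionCongr
    rw [this, Finite.card_option, Nat.card_eq_fintype_card, Fintype.card_subtype,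
      Finset.card_filter,
      Fintype.sum_prod_type, add_comm]
  rw [this, Nat.cast_add, Nat.cast_sum, Finset.sum_congr rfl fun x _ ↦ hx x,
    Finset.sum_add_distrib]
  simp

lemma eq_zero_of_nsmul_eq_zero_of_finite {p : ℕ} [Fact p.Prime] [CharP F p] (hp : 5 ≤ p)
    (h : ((X ^ 3 - C (27 * W.c₄) * X - C (54 * W.c₆)) ^ (p / 2)).coeff (p - 1) = 0)
    {P : W.Point} (hP : p • P = 0) : P = 0 := by
  have hpF : ringChar F = p := ringChar.eq F p
  have hp2 : p ≠ 2 := by omega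
  have hF : ringChar F ≠ 2 := by rwa [hpF]
  have h108 : (108 : F) ≠ 0 := by
    have : ((108 : ℕ) : F) ≠ 0 := by
      rw [Ne, CharP.cast_eq_zero_iff F p, show 108 = 2 ^ 2 * 3 ^ 3 by norm_num,
        (Fact.out : p.Prime).dvd_mul]
      rintro (h | h)
      · have := Nat.le_of_dvd two_pos ((Fact.out : p.Prime).dvd_of_dvd_pow h)
        omega
      · have := Nat.le_of_dvd three_pos ((Fact.out : p.Prime).dvd_of_dvd_pow h)
        omega
    exact_mod_cast this
  have h36 : (36 : F) ≠ 0 := fun h ↦ h108 (by linear_combination 3 * h)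
  obtain ⟨N, -, hN⟩ := FiniteField.card F p
  have hodd : 2 * (Fintype.card F / 2) = Fintype.card F - 1 := by
    have := FiniteField.odd_card_of_char_ne_two hF
    omega
  obtain ⟨f, hf⟩ : ∃ f : F[X], f = X ^ 3 - C (27 * W.c₄) * X - C (54 * W.c₆) := ⟨_, rfl⟩
  have hfd : f.natDegree ≤ 3 := by
    rw [hf]
    compute_degree
  rw [← hf] at h
  have hsum : ∑ x, W.Ψ₂Sq.eval x ^ (Fintype.card F / 2) = 0 := by
    have hc := coeff_pow_half_card_sub_one_eq_zero hp2 hfd h N.ne_zero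
    rw [← hN] at hc
    have := sum_eval_eq_zero_of_coeff_eq_zero
      ((natDegree_pow_le_of_le _ hfd).trans_lt (by have := Fintype.one_lt_card (α := F); omega)) hc
    rw [← this, ← ((Equiv.mulLeft₀ 36 h36).trans (Equiv.addRight (3 * W.b₂))).sum_comp
      fun x ↦ (f ^ (Fintype.card F / 2)).eval x]
    refine Finset.sum_congr rfl fun x _ ↦ ?_
    have : f.eval (36 * x + 3 * W.b₂) = 108 ^ 2 * W.Ψ₂Sq.eval x := by
      simp [hf, WeierstrassCurve.Ψ₂Sq, c₄, c₆]
      ring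
    rw [eval_pow]
    change _ = f.eval (36 * x + 3 * W.b₂) ^ _
    rw [this, mul_pow, ← pow_mul, hodd, FiniteField.pow_card_sub_one_eq_one _ h108, one_mul]
  have hcard := natCard_point (W := W) hF
  rw [hsum, add_zero] at hcard
  have hnd : ¬ p ∣ Nat.card W.Point := by
    rw [← CharP.cast_eq_zero_iff F p, hcard]
    exact one_ne_zero
  have : addOrderOf P ∣ 1 := by
    rw [← ((Fact.out : p.Prime).coprime_iff_not_dvd.mpr hnd).gcd_eq_one]
    refine Nat.dvd_gcd (addOrderOf_dvd_of_nsmul_eq_zero hP) ?_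
    exact addOrderOf_dvd_natCard P
  rwa [Nat.dvd_one, AddMonoid.addOrderOf_eq_one_iff] at this

end PointCount

lemma eq_zero_of_nsmul_eq_zero {K : Type*} [Field K] [DecidableEq K] {W : WeierstrassCurve.Affine K}
    [WeierstrassCurve.IsElliptic W] {p : ℕ} [Fact p.Prime] [Algebra (ZMod p) K]
    [Algebra.IsAlgebraic (ZMod p) K] (hp : 5 ≤ p)
    (h : ((X ^ 3 - C (27 * W.c₄) * X - C (54 * W.c₆)) ^ (p / 2)).coeff (p - 1) = 0)
    {P : W.Point} (hP : p • P = 0) : P = 0 := by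
  rcases P with _ | @⟨x, y, hxy⟩
  · rfl
  let S : Set K := {W.a₁, W.a₂, W.a₃, W.a₄, W.a₆, x, y}
  have : Finite S := Set.Finite.to_subtype (by simp [S])
  let F := IntermediateField.adjoin (ZMod p) S
  have : FiniteDimensional (ZMod p) F :=
    IntermediateField.finiteDimensional_adjoin fun x _ ↦
      (Algebra.IsAlgebraic.isAlgebraic x).isIntegral
  have : Finite F := Module.finite_of_finite (ZMod p)
  have := Fintype.ofFinite F
  have hmem : ∀ z ∈ S, z ∈ F := IntermediateField.subset_adjoin (ZMod p) S
  let W₀ : WeierstrassCurve F := ⟨⟨W.a₁, hmem _ (by simp [S])⟩, ⟨W.a₂, hmem _ (by simp [S])⟩,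
    ⟨W.a₃, hmem _ (by simp [S])⟩, ⟨W.a₄, hmem _ (by simp [S])⟩, ⟨W.a₆, hmem _ (by simp [S])⟩⟩
  have hW : W₀.map (algebraMap F K) = W := rfl
  let x₀ : F := ⟨x, hmem _ (by simp [S])⟩
  let y₀ : F := ⟨y, hmem _ (by simp [S])⟩
  have : CharP F p := charP_of_injective_algebraMap (algebraMap (ZMod p) F).injective p
  have hinj : Function.Injective (algebraMap F K) := (algebraMap F K).injective
  have : (W₀⁄F).IsElliptic := by
    rw [isElliptic_iff, isUnit_iff_ne_zero]
    intro h0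
    have hΔ : W.Δ = algebraMap F K (W₀⁄F).Δ := by
      rw [← hW, map_Δ]
      rfl
    rw [h0, map_zero] at hΔ
    exact W.isUnit_Δ.ne_zero hΔ
  have hxy₀ : (W₀⁄F).toAffine.Nonsingular x₀ y₀ :=
    (Affine.baseChange_nonsingular W₀ (f := Algebra.ofId F K) hinj x₀ y₀).mp hxy
  have hP₀ : p • Affine.Point.some x₀ y₀ hxy₀ = 0 := by
    refine Affine.Point.map_injective (W' := W₀) (Algebra.ofId F K) ?_
    rw [map_nsmul, map_zero]
    exact hP
  refine absurd (eq_zero_of_nsmul_eq_zero_of_finite hp ?_ hP₀) (Affine.Point.some_ne_zero _)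
  refine hinj ?_
  rw [map_zero, ← h, ← coeff_map, Polynomial.map_pow]
  have h₄ : W.c₄ = algebraMap F K (W₀⁄F).c₄ := by
    rw [← hW, map_c₄]
    rfl
  have h₆ : W.c₆ = algebraMap F K (W₀⁄F).c₆ := by
    rw [← hW, map_c₆]
    rfl
  simp only [h₄, h₆, Polynomial.map_sub, Polynomial.map_pow, Polynomial.map_mul, Polynomial.map_X,
    Polynomial.map_C, Polynomial.map_ofNat, map_mul, map_ofNat]

section Hasse

open scoped Nat

variable {K : Type*} [Field K]

lemma cast_factorial_ne_zero {p : ℕ} [Fact p.Prime] [CharP K p] {k : ℕ} (hk : k < p) :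
    (k ! : K) ≠ 0 := by
  rw [Ne, CharP.cast_eq_zero_iff K p, (Fact.out : p.Prime).dvd_factorial]
  omega

lemma exists_factorial_ratio {p n r s : ℕ} [Fact p.Prime] [CharP K p] (hp5 : 5 ≤ p)
    (hp : p = 12 * n + 1 + 4 * r + 6 * s) (hr : r ≤ 1) :
    ∃ c : K, ∀ M ≤ n,
      (-27) ^ (3 * M + r) * (-54) ^ (2 * (n - M) + s) /
        ((4 * n + r + 2 * s - M)! * (3 * M + r)! : K) =
      c * ((2 * (2 * n + s - M))! * (-1) ^ M / ((2 * n + s - M)! * M !)) := by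
  have fac : ∀ {k : ℕ}, k < p → (k ! : K) ≠ 0 := fun hk ↦ cast_factorial_ne_zero hk
  have nat : ∀ {k : ℕ}, 0 < k → k < p → (k : K) ≠ 0 := fun h0 hk h ↦
    (Nat.le_of_dvd h0 ((CharP.cast_eq_zero_iff K p _).mp h)).not_gt hk
  refine ⟨(-27) ^ (3 * 0 + r) * (-54) ^ (2 * (n - 0) + s) /
        ((4 * n + r + 2 * s - 0)! * (3 * 0 + r)! : K) /
        ((2 * (2 * n + s - 0))! * (-1) ^ 0 / ((2 * n + s - 0)! * 0 !)), fun M ↦ ?_⟩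
  generalize hc : (-27) ^ (3 * 0 + r) * (-54) ^ (2 * (n - 0) + s) /
        ((4 * n + r + 2 * s - 0)! * (3 * 0 + r)! : K) /
        ((2 * (2 * n + s - 0))! * (-1) ^ 0 / ((2 * n + s - 0)! * 0 !)) = c
  induction M with
  | zero =>
    intro _
    rw [← hc, div_mul_cancel₀]
    refine div_ne_zero (mul_ne_zero (fac (by omega)) ?_) (mul_ne_zero (fac (by omega)) ?_) <;> simp
  | succ M ih =>
    intro hM
    have ih := ih (by omega)
    obtain ⟨k, rfl⟩ : ∃ k, n = M + 1 + k := ⟨n - (M + 1), by omega⟩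
    clear hc
    obtain ⟨u, hu⟩ : ∃ u, u = M + 1 + 2 * k + s := ⟨_, rfl⟩
    obtain ⟨v, hv⟩ : ∃ v, v = 3 * M + 3 + 4 * k + r + 2 * s := ⟨_, rfl⟩
    obtain ⟨e, he⟩ : ∃ e, e = 3 * M + r := ⟨_, rfl⟩
    rw [show 2 * (M + 1 + k) + s - M = u + 1 by omega,
      show 4 * (M + 1 + k) + r + 2 * s - M = v + 1 by omega,
      show 2 * (M + 1 + k - M) + s = 2 * k + s + 2 by omega, ← he,
      show 2 * (u + 1) = 2 * u + 1 + 1 by ring] at ih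
    rw [show 2 * (M + 1 + k) + s - (M + 1) = u by omega,
      show 4 * (M + 1 + k) + r + 2 * s - (M + 1) = v by omega,
      show 2 * (M + 1 + k - (M + 1)) + s = 2 * k + s by omega,
      show 3 * (M + 1) + r = e + 2 + 1 by omega]
    have hp0 : (12 * (M + 1 + k) + 1 + 4 * r + 6 * s : K) = 0 := by
      have := CharP.cast_eq_zero K p
      rw [hp] at this
      exact_mod_cast this
    have huK : (u : K) = M + 1 + 2 * k + s := by rw [hu]; push_cast; ring
    have hvK : (v : K) = 3 * M + 3 + 4 * k + r + 2 * s := by rw [hv]; push_cast; ring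
    have heK : (e : K) = 3 * M + r := by rw [he]; push_cast; ring
    have n1 : (e + 1 : K) ≠ 0 := by exact_mod_cast nat (k := e + 1) (by omega) (by omega)
    have n2 : (e + 1 + 1 : K) ≠ 0 := by exact_mod_cast nat (k := e + 1 + 1) (by omega) (by omega)
    have n3 : (e + 2 + 1 : K) ≠ 0 := by exact_mod_cast nat (k := e + 2 + 1) (by omega) (by omega)
    have n4 : (v + 1 : K) ≠ 0 := by exact_mod_cast nat (k := v + 1) (by omega) (by omega)
    have n5 : (2 * u + 1 : K) ≠ 0 := by exact_mod_cast nat (k := 2 * u + 1) (by omega) (by omega)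
    have n6 : (u + 1 : K) ≠ 0 := by exact_mod_cast nat (k := u + 1) (by omega) (by omega)
    have n7 : (M + 1 : K) ≠ 0 := by exact_mod_cast nat (k := M + 1) (by omega) (by omega)
    have n8 : (2 : K) ≠ 0 := by exact_mod_cast nat (k := 2) (by omega) (by omega)
    have n9 : (27 : K) ≠ 0 := by
      rw [show (27 : K) = ((3 : ℕ) : K) ^ 3 by norm_num]
      exact pow_ne_zero 3 (nat (by omega) (by omega))
    have key : (4 * (e + 1) * (e + 2) * (e + 3) : K) =
        27 * (v + 1) * (2 * (2 * u + 1) * (M + 1)) := by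
      rw [huK, hvK, heK]
      rcases (by omega : r = 0 ∨ r = 1) with rfl | rfl
      · push_cast
        linear_combination (-6 * (M + 1 : K) * (12 * (M + 1 + k) + 1 + 6 * s - 5 - 9 * M)) * hp0
      · push_cast
        linear_combination (-6 * (M + 1 : K) * (12 * (M + 1 + k) + 1 + 4 + 6 * s - 10 - 9 * M)) * hp0
    have f1 := fac (k := u) (by omega)
    have f2 := fac (k := v) (by omega)
    have f3 := fac (k := e) (by omega)
    have f4 := fac (k := M) (by omega)
    have f5 := fac (k := 2 * u) (by omega)
    have hG : ((2 * u)! * (-1) ^ (M + 1) / (u ! * (M + 1)!) : K) * (2 * (2 * u + 1) * (M + 1)) =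
        -((2 * u + 1 + 1)! * (-1) ^ M / ((u + 1)! * M !)) := by
      simp only [Nat.factorial_succ, pow_succ]
      push_cast
      field_simp
      ring
    have hH : ((-27) ^ (e + 2 + 1) * (-54) ^ (2 * k + s) / (v ! * (e + 2 + 1)!) : K) *
        (2 * (2 * u + 1) * (M + 1)) =
        -((-27) ^ e * (-54) ^ (2 * k + s + 2) / ((v + 1)! * e !)) := by
      refine mul_left_cancel₀ (mul_ne_zero n9 n4) ?_
      rw [mul_left_comm, ← key]
      simp only [Nat.factorial_succ, pow_succ]
      push_cast
      field_simp
      ring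
    refine mul_right_cancel₀ (mul_ne_zero (mul_ne_zero n8 n5) n7) ?_
    rw [hH, ih, mul_assoc c, hG]
    ring

lemma coeff_X_mul_add_C_pow (a b : K) (m k : ℕ) :
    ((C a * X + C b) ^ m).coeff k = a ^ k * b ^ (m - k) * m.choose k := by
  have : (C a * X + C b) ^ m = ((X + C b) ^ m).comp (C a * X) := by simp
  rw [this, comp_C_mul_X_coeff, coeff_X_add_C_pow]
  ring

lemma coeff_cubic_pow_s18 (a b : K) {n r s : ℕ} (hr : r ≤ 1) (hs : s ≤ 1) :
    ((X ^ 3 + C a * X + C b) ^ (6 * n + 2 * r + 3 * s)).coeff (12 * n + 4 * r + 6 * s) =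
      ∑ M ∈ Finset.range (n + 1), ((6 * n + 2 * r + 3 * s).choose (4 * n + r + 2 * s - M) : K) *
        (2 * n + r + s + M).choose (3 * M + r) * a ^ (3 * M + r) * b ^ (2 * (n - M) + s) := by
  rw [add_assoc, add_pow, finsetSum_coeff]
  symm
  refine Finset.sum_of_injOn (fun M ↦ 4 * n + r + 2 * s - M) ?_ ?_ ?_ ?_
  · intro i hi j hj h
    simp at hi hj h
    omega
  · intro i hi
    simp at hi ⊢
    omega
  · intro i hi hi'
    rw [Finset.mem_range] at hi
    simp only [Finset.coe_range, Set.mem_image, Set.mem_Iio, not_exists, not_and] at hi'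
    rw [← pow_mul, mul_assoc, coeff_X_pow_mul', ← C_eq_natCast, coeff_mul_C]
    split_ifs with h
    · rw [coeff_X_mul_add_C_pow, Nat.choose_eq_zero_of_lt, Nat.cast_zero, mul_zero, zero_mul]
      by_contra h'
      exact hi' (4 * n + r + 2 * s - i) (by omega) (by omega)
    · rfl
  · intro M hM
    rw [Finset.mem_range] at hM
    rw [← pow_mul, mul_assoc (X ^ _), coeff_X_pow_mul', ← C_eq_natCast, coeff_mul_C,
      if_pos (by omega),
      coeff_X_mul_add_C_pow,
      show 6 * n + 2 * r + 3 * s - (4 * n + r + 2 * s - M) = 2 * n + r + s + M by omega,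
      show 12 * n + 4 * r + 6 * s - 3 * (4 * n + r + 2 * s - M) = 3 * M + r by omega,
      show 2 * n + r + s + M - (3 * M + r) = 2 * (n - M) + s by omega]
    ring

lemma coeff_quadratic_pow (A B : K) {n s : ℕ} (hs : s ≤ 1) :
    (((X + C B) ^ 2 + C A) ^ (2 * n + s)).coeff (2 * n + s) =
      ∑ M ∈ Finset.range (n + 1), ((2 * n + s).choose (2 * n + s - M) : K) *
        (2 * (2 * n + s - M)).choose (2 * n + s) * A ^ M * B ^ (2 * (n - M) + s) := by
  rw [add_pow, finsetSum_coeff]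
  symm
  refine Finset.sum_of_injOn (fun M ↦ 2 * n + s - M) ?_ ?_ ?_ ?_
  · intro i hi j hj h
    simp at hi hj h
    omega
  · intro i hi
    simp
  · intro i hi hi'
    rw [Finset.mem_range] at hi
    simp only [Finset.coe_range, Set.mem_image, Set.mem_Iio, not_exists, not_and] at hi'
    rw [← pow_mul, ← C_eq_natCast, coeff_mul_C, ← C_pow, coeff_mul_C, coeff_X_add_C_pow,
      Nat.choose_eq_zero_of_lt, Nat.cast_zero, mul_zero, zero_mul, zero_mul]
    by_contra h'
    exact hi' (2 * n + s - i) (by omega) (by omega)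
  · intro M hM
    rw [Finset.mem_range] at hM
    rw [← pow_mul, ← C_eq_natCast, coeff_mul_C, ← C_pow, coeff_mul_C, coeff_X_add_C_pow,
      show 2 * n + s - (2 * n + s - M) = M by omega,
      show 2 * (2 * n + s - M) - (2 * n + s) = 2 * (n - M) + s by omega]
    ring

lemma coeff_quadratic_pow' (A B : K) {n s : ℕ} (hs : s ≤ 1) :
    (((X + C B) ^ 2 + C A) ^ (2 * n + s)).coeff (2 * n + s) =
      ∑ k ∈ Finset.range (n + 1), ((2 * n + s).choose (2 * k + s) : K) *
        (2 * n - 2 * k).choose (n - k) * (2 * B) ^ (2 * k + s) * (B ^ 2 + A) ^ (n - k) := by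
  have : (X + C B) ^ 2 + C A = X * (C 1 * X + C (2 * B)) + C (B ^ 2 + A) := by
    simp only [map_mul, map_add, map_pow, map_one, map_ofNat]
    ring
  rw [this, add_pow, finsetSum_coeff]
  symm
  refine Finset.sum_of_injOn (fun k ↦ n + s + k) ?_ ?_ ?_ ?_
  · intro i hi j hj h
    simp at hi hj h
    omega
  · intro i hi
    simp at hi ⊢
    omega
  · intro i hi hi'
    rw [Finset.mem_range] at hi
    simp only [Finset.coe_range, Set.mem_image, Set.mem_Iio, not_exists, not_and] at hi'
    rw [mul_pow, mul_assoc, mul_assoc, coeff_X_pow_mul', ← C_eq_natCast, ← C_pow, ← C_mul,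
      coeff_mul_C]
    split_ifs with h
    · rw [coeff_X_mul_add_C_pow, Nat.choose_eq_zero_of_lt, Nat.cast_zero, mul_zero, zero_mul]
      by_contra h'
      exact hi' (i - n - s) (by omega) (by omega)
    · rfl
  · intro k hk
    rw [Finset.mem_range] at hk
    rw [mul_pow X, mul_assoc (X ^ _), mul_assoc (X ^ _), coeff_X_pow_mul', ← C_eq_natCast, ← C_pow,
      mul_assoc ((C 1 * X + C (2 * B)) ^ _), ← C_mul, coeff_mul_C, if_pos (by omega),
      coeff_X_mul_add_C_pow,
      show 2 * n + s - (n + s + k) = n - k by omega,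
      show n + s + k - (n - k) = 2 * k + s by omega]
    have : ((2 * n + s).choose (2 * k + s) : K) * (2 * n - 2 * k).choose (n - k) =
        (n + s + k).choose (n - k) * (2 * n + s).choose (n + s + k) := by
      norm_cast
      rw [← Nat.choose_symm (show 2 * k + s ≤ 2 * n + s by omega),
        ← Nat.choose_symm (show n + s + k ≤ 2 * n + s by omega),
        show 2 * n + s - (2 * k + s) = 2 * n - 2 * k by omega,
        show 2 * n + s - (n + s + k) = n - k by omega,
        Nat.choose_mul (by omega), show 2 * n + s - (n - k) = n + s + k by omega,
        show 2 * n - 2 * k - (n - k) = n - k by omega, mul_comm]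
    rw [this]
    ring

lemma coeff_cubic_pow_eq {p n r s : ℕ} [Fact p.Prime] [CharP K p] (hp5 : 5 ≤ p)
    (hp : p = 12 * n + 1 + 4 * r + 6 * s) (hr : r ≤ 1) (hs : s ≤ 1) :
    ∃ c : K, ∀ A B : K, ((X ^ 3 - C (27 * A) * X - C (54 * B)) ^ (p / 2)).coeff (p - 1) =
      c * (A ^ r * (((X + C B) ^ 2 + C (-A ^ 3)) ^ (2 * n + s)).coeff (2 * n + s)) := by
  have fac : ∀ {k : ℕ}, k < p → (k ! : K) ≠ 0 := fun hk ↦ cast_factorial_ne_zero hk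
  obtain ⟨c, hc⟩ := exists_factorial_ratio (K := K) hp5 hp hr
  refine ⟨c * (6 * n + 2 * r + 3 * s)!, fun A B ↦ ?_⟩
  rw [show X ^ 3 - C (27 * A) * X - C (54 * B) = X ^ 3 + C (-27 * A) * X + C (-54 * B) by
    simp only [neg_mul, C_neg]; ring, show p / 2 = 6 * n + 2 * r + 3 * s by omega,
    show p - 1 = 12 * n + 4 * r + 6 * s by omega, coeff_cubic_pow_s18 _ _ hr hs,
    coeff_quadratic_pow _ _ hs, Finset.mul_sum, Finset.mul_sum]
  refine Finset.sum_congr rfl fun M hM ↦ ?_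
  rw [Finset.mem_range, Nat.lt_succ_iff] at hM
  have h₁ := Nat.choose_mul_factorial_mul_factorial
    (show 4 * n + r + 2 * s - M ≤ 6 * n + 2 * r + 3 * s by omega)
  have h₂ := Nat.choose_mul_factorial_mul_factorial
    (show 3 * M + r ≤ 2 * n + r + s + M by omega)
  have h₃ := Nat.choose_mul_factorial_mul_factorial (show 2 * n + s - M ≤ 2 * n + s by omega)
  have h₄ := Nat.choose_mul_factorial_mul_factorial
    (show 2 * n + s ≤ 2 * (2 * n + s - M) by omega)
  rw [show 6 * n + 2 * r + 3 * s - (4 * n + r + 2 * s - M) = 2 * n + r + s + M by omega] at h₁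
  rw [show 2 * n + r + s + M - (3 * M + r) = 2 * (n - M) + s by omega] at h₂
  rw [show 2 * n + s - (2 * n + s - M) = M by omega] at h₃
  rw [show 2 * (2 * n + s - M) - (2 * n + s) = 2 * (n - M) + s by omega] at h₄
  replace h₁ := congrArg (Nat.cast : ℕ → K) h₁
  replace h₂ := congrArg (Nat.cast : ℕ → K) h₂
  replace h₃ := congrArg (Nat.cast : ℕ → K) h₃
  replace h₄ := congrArg (Nat.cast : ℕ → K) h₄
  push_cast at h₁ h₂ h₃ h₄
  have e₁ : ((6 * n + 2 * r + 3 * s).choose (4 * n + r + 2 * s - M) : K) *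
      (2 * n + r + s + M).choose (3 * M + r) = (6 * n + 2 * r + 3 * s)! /
        ((4 * n + r + 2 * s - M)! * (3 * M + r)! * (2 * (n - M) + s)!) := by
    rw [eq_div_iff (mul_ne_zero (mul_ne_zero (fac (by omega)) (fac (by omega))) (fac (by omega)))]
    rw [← h₁, ← h₂]
    ring
  have e₂ : ((2 * n + s).choose (2 * n + s - M) : K) * (2 * (2 * n + s - M)).choose (2 * n + s) =
      (2 * (2 * n + s - M))! / ((2 * n + s - M)! * M ! * (2 * (n - M) + s)!) := by
    rw [eq_div_iff (mul_ne_zero (mul_ne_zero (fac (by omega)) (fac (by omega))) (fac (by omega)))]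
    refine mul_right_cancel₀ (fac (k := 2 * n + s) (by omega)) ?_
    rw [← h₄]
    linear_combination ((2 * (2 * n + s - M)).choose (2 * n + s) : K) * (2 * (n - M) + s)! *
      (2 * n + s)! * h₃
  rw [e₁, e₂]
  have := hc M hM
  calc _ = (6 * n + 2 * r + 3 * s)! / (2 * (n - M) + s)! * A ^ (3 * M + r) * B ^ (2 * (n - M) + s) *
      ((-27) ^ (3 * M + r) * (-54) ^ (2 * (n - M) + s) /
        ((4 * n + r + 2 * s - M)! * (3 * M + r)! : K)) := by
        rw [mul_pow, mul_pow]
        ring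
    _ = _ := by
        rw [this, neg_pow (A ^ 3)]
        ring

lemma coeff_cubic_pow_eq_zero {p : ℕ} [Fact p.Prime] [Algebra (ZMod p) K] (hp5 : 5 ≤ p)
    {c₄ c₆ Δ j : K} (hΔ : 1728 * Δ = c₄ ^ 3 - c₆ ^ 2) (hjΔ : j * Δ = c₄ ^ 3)
    (hj : aeval j (ssp p) = 0) :
    ((X ^ 3 - C (27 * c₄) * X - C (54 * c₆)) ^ (p / 2)).coeff (p - 1) = 0 := by
  have : CharP K p := charP_of_injective_algebraMap (algebraMap (ZMod p) K).injective p
  obtain ⟨r, hr⟩ : ∃ r, r = if p % 3 = 2 then 1 else 0 := ⟨_, rfl⟩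
  obtain ⟨s, hs⟩ : ∃ s, s = if p % 4 = 3 then 1 else 0 := ⟨_, rfl⟩
  obtain ⟨n, hn⟩ : ∃ n, n = p / 12 := ⟨_, rfl⟩
  have hr1 : r ≤ 1 := by split_ifs at hr <;> omega
  have hs1 : s ≤ 1 := by split_ifs at hs <;> omega
  have hp : p = 12 * n + 1 + 4 * r + 6 * s := by
    have h2 : p % 2 ≠ 0 := fun h ↦ by
      have := ((Nat.dvd_prime Fact.out).mp (Nat.dvd_of_mod_eq_zero h))
      omega
    have h3 : p % 3 ≠ 0 := fun h ↦ by
      have := ((Nat.dvd_prime Fact.out).mp (Nat.dvd_of_mod_eq_zero h))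
      omega
    split_ifs at hr hs <;> omega
  obtain ⟨c, hc⟩ := coeff_cubic_pow_eq (K := K) hp5 hp hr1 hs1
  rw [hc]
  refine mul_eq_zero_of_right c ?_
  rw [coeff_quadratic_pow' _ _ hs1]
  simp only [ssp, ← hr, ← hs, ← hn, map_mul, map_pow, map_sum, map_sub, aeval_X, map_natCast,
    map_neg, map_ofNat, mul_eq_zero, pow_eq_zero_iff', ne_eq] at hj
  rcases hj with (⟨hj, hr0⟩ | ⟨hj, hs0⟩) | hj
  · rw [hj, zero_mul] at hjΔ
    rw [(pow_eq_zero_iff three_ne_zero).mp hjΔ.symm, zero_pow hr0, zero_mul]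
  · have h6 : c₆ = 0 := by
      refine (pow_eq_zero_iff two_ne_zero).mp ?_
      linear_combination hΔ - hjΔ + Δ * hj
    rw [h6]
    refine mul_eq_zero_of_right _ (Finset.sum_eq_zero fun k _ ↦ ?_)
    rw [mul_zero, zero_pow (by omega), mul_zero, zero_mul]
  · have h6 : c₆ ^ 2 = (j - 1728) * Δ := by linear_combination hΔ - hjΔ
    have h6' : c₆ ^ 2 + -c₄ ^ 3 = (-432) * (4 * Δ) := by linear_combination hΔ
    refine mul_eq_zero_of_right _ ?_
    rw [← mul_zero ((2 * c₆) ^ s * (4 * Δ) ^ n), ← hj, Finset.mul_sum]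
    refine Finset.sum_congr rfl fun k hk ↦ ?_
    obtain ⟨l, rfl⟩ : ∃ l, n = k + l := ⟨n - k, by rw [Finset.mem_range] at hk; omega⟩
    rw [pow_add _ _ s, pow_mul, mul_pow 2 c₆ 2, h6', h6, Nat.add_sub_cancel_left,
      show 2 ^ 2 * ((j - 1728) * Δ) = 4 * Δ * (j - 1728) by ring, mul_pow (4 * Δ), mul_pow (-432)]
    ring

end Hasse

section Tate

variable {K : Type*} [Field K]

/-- The Tate normal form `y² + (1 - c)xy - by = x³ - bx²`. -/
def tateCurve (b c : K) : WeierstrassCurve.Affine K :=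
  ⟨1 - c, -b, -b, 0, 0⟩

lemma exists_point_some_eq {W : WeierstrassCurve.Affine K} {x y x' y' : K}
    (h : W.Nonsingular x y) (hx : x = x') (hy : y = y') :
    ∃ h', Affine.Point.some x y h = Affine.Point.some x' y' h' := by
  subst hx hy
  exact ⟨h, rfl⟩

variable {b c : K} [WeierstrassCurve.IsElliptic (tateCurve b c)]

lemma tateCurve_nonsingular : (tateCurve b c).Nonsingular 0 0 := by
  rw [← Affine.equation_iff_nonsingular, Affine.equation_iff]
  simp [tateCurve]

variable (b c) in
/-- The marked point `(0, 0)` of a Tate normal form. -/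
def tatePoint : (tateCurve b c).Point :=
  .some 0 0 tateCurve_nonsingular

variable [DecidableEq K]

lemma two_nsmul_tatePoint (hb : b ≠ 0) : ∃ h, 2 • tatePoint b c = .some b (b * c) h := by
  have hy : (0 : K) ≠ (tateCurve b c).negY 0 0 := by
    simpa [Affine.negY, tateCurve] using hb.symm
  have hs : (tateCurve b c).slope 0 0 0 0 = 0 := by
    rw [Affine.slope_of_Y_ne rfl hy]
    simp [tateCurve]
  rw [two_nsmul, tatePoint, Affine.Point.add_self_of_Y_ne hy]
  refine exists_point_some_eq _ ?_ ?_ <;>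
    simp only [Affine.addX, Affine.addY, Affine.negAddY, Affine.negY, hs] <;>
    simp only [tateCurve] <;> ring

lemma three_nsmul_tatePoint (hb : b ≠ 0) : ∃ h, 3 • tatePoint b c = .some c (b - c) h := by
  obtain ⟨h, h₂⟩ := two_nsmul_tatePoint (b := b) (c := c) hb
  have hs : (tateCurve b c).slope b 0 (b * c) 0 = c := by
    rw [Affine.slope_of_X_ne hb]
    field_simp
    simp [mul_comm]
  rw [succ_nsmul, h₂, tatePoint, Affine.Point.add_of_X_ne hb]
  refine exists_point_some_eq _ ?_ ?_ <;>
    simp only [Affine.addX, Affine.addY, Affine.negAddY, Affine.negY, hs] <;>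
    simp only [tateCurve] <;> ring

lemma five_nsmul_tatePoint {b : K} [WeierstrassCurve.IsElliptic (tateCurve b b)] (hb : b ≠ 0) :
    5 • tatePoint b b = 0 := by
  obtain ⟨h, h₂⟩ := two_nsmul_tatePoint (b := b) (c := b) hb
  obtain ⟨h', h₃⟩ := three_nsmul_tatePoint (b := b) (c := b) hb
  rw [show 5 = 2 + 3 from rfl, add_nsmul, h₂, h₃, Affine.Point.add_of_Y_eq rfl]
  simp only [Affine.negY, tateCurve]
  ring

lemma seven_nsmul_tatePoint {d : K}
    [WeierstrassCurve.IsElliptic (tateCurve (d ^ 3 - d ^ 2) (d ^ 2 - d))]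
    (h₀ : d ≠ 0) (h₁ : d - 1 ≠ 0) :
    7 • tatePoint (d ^ 3 - d ^ 2) (d ^ 2 - d) = 0 := by
  have hc : d ^ 2 - d ≠ 0 := by
    rw [show d ^ 2 - d = d * (d - 1) by ring]
    exact mul_ne_zero h₀ h₁
  have hb : d ^ 3 - d ^ 2 ≠ 0 := by
    rw [show d ^ 3 - d ^ 2 = d * (d ^ 2 - d) by ring]
    exact mul_ne_zero h₀ hc
  obtain ⟨h, h₃⟩ := three_nsmul_tatePoint (c := d ^ 2 - d) hb
  have hs : (tateCurve (d ^ 3 - d ^ 2) (d ^ 2 - d)).slope (d ^ 2 - d) 0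
      (d ^ 3 - d ^ 2 - (d ^ 2 - d)) 0 = d - 1 := by
    rw [Affine.slope_of_X_ne hc]
    field_simp
    ring
  have h₄ : ∃ h', 4 • tatePoint (d ^ 3 - d ^ 2) (d ^ 2 - d) =
      .some (d ^ 2 - d) ((d ^ 2 - d) ^ 2) h' := by
    rw [succ_nsmul, h₃, tatePoint, Affine.Point.add_of_X_ne hc]
    refine exists_point_some_eq _ ?_ ?_ <;>
      simp only [Affine.addX, Affine.addY, Affine.negAddY, Affine.negY, hs] <;>
      simp only [tateCurve] <;> ring
  obtain ⟨h', h₄⟩ := h₄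
  rw [show 7 = 3 + 4 from rfl, add_nsmul, h₃, h₄, Affine.Point.add_of_Y_eq rfl]
  simp only [Affine.negY, tateCurve]
  ring

end Tate

section Supersingular

variable {K : Type*} [Field K] [DecidableEq K] [IsAlgClosed K] {W : WeierstrassCurve.Affine K}
  [WeierstrassCurve.IsElliptic W]

lemma exists_xRep_prime_nsmul_eq {p : ℕ} [Fact p.Prime] [Algebra (ZMod p) K]
    [Algebra.IsAlgebraic (ZMod p) K] (hp : 5 ≤ p) {j : K} (hj : aeval j (ssp p) = 0)
    (hW : j * W.Δ = W.c₄ ^ 3) :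
    ∃ α β : K, α ≠ 0 ∧
      (∀ x y (h : W.Nonsingular x y),
        (p • Affine.Point.some x y h).xRep = ![α * x ^ p ^ 2 + β, 1]) ∧
      ∀ x, W.Ψ₂Sq.eval (α * x ^ p ^ 2 + β) = α ^ 3 * W.Ψ₂Sq.eval x ^ p ^ 2 := by
  have : CharP K p := charP_of_injective_algebraMap (algebraMap (ZMod p) K).injective p
  have : ExpChar K p := .prime Fact.out
  obtain ⟨α, β, hα, h⟩ := exists_xRep_nsmul_eq (W := W) (n := p) (by omega) fun P hP ↦
    eq_zero_of_nsmul_eq_zero hp (coeff_cubic_pow_eq_zero hp W.c_relation hW hj) hP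
  have hp2 : p ≠ 2 := by omega
  refine ⟨α, β, hα, h, eval_twoTorsion_of_xRep_nsmul_eq
    ((Nat.Prime.odd_of_ne_two Fact.out hp2)) ?_ (fun x y ↦ ?_) ?_ h⟩
  · exact_mod_cast (CharP.cast_ne_zero_of_ne_of_prime (p := p) K Nat.prime_two hp2)
  · exact sub_pow_expChar_pow x y 2
  · exact map_ofNat (iterateFrobenius K p 2) 4

end Supersingular

lemma xRep_nsmul_eq_of_add_eq {K : Type*} [Field K] [DecidableEq K]
    {W : WeierstrassCurve.Affine K} {P : W.Point} {k m n : ℕ} (h : k + m = n) (hP : n • P = 0) :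
    (k • P).xRep = (m • P).xRep := by
  rw [← h, add_nsmul] at hP
  rw [eq_neg_of_add_eq_zero_left hP, Affine.Point.xRep_neg]

section FixedPoints

variable {K : Type*} [Field K] [IsAlgClosed K] {p : ℕ} [Fact p.Prime] [Algebra (ZMod p) K]

lemma exists_root_quadratic (u v : K) : ∃ x, x ^ 2 + u * x + v = 0 := by
  have h : (X ^ 2 + C u * X + C v : K[X]).degree = 2 := by compute_degree!
  obtain ⟨x, hx⟩ := IsAlgClosed.exists_root _ (h.trans_ne two_ne_zero)
  exact ⟨x, by simpa [IsRoot] using hx⟩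

lemma exists_root_cubic (u v w : K) : ∃ x, x ^ 3 + u * x ^ 2 + v * x + w = 0 := by
  have h : (X ^ 3 + C u * X ^ 2 + C v * X + C w : K[X]).degree = 3 := by compute_degree!
  obtain ⟨x, hx⟩ := IsAlgClosed.exists_root _ (h.trans_ne three_ne_zero)
  exact ⟨x, by simpa [IsRoot] using hx⟩

variable [Algebra.IsAlgebraic (ZMod p) K]

lemma pow_eq_of_five_torsion (hp : 5 ≤ p) (hp5 : p ≠ 5) {j t : K} (hj : aeval j (ssp p) = 0)
    (ht : t ≠ 0) (hjt : j * t = (t ^ 2 + 10 * t + 5) ^ 3) : t ^ p ^ 2 = t := by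
  classical
  have : CharP K p := charP_of_injective_algebraMap (algebraMap (ZMod p) K).injective p
  have : ExpChar K p := .prime Fact.out
  have hq : p ^ 2 ≠ 0 := pow_ne_zero 2 (Fact.out : p.Prime).ne_zero
  have frob : ∀ x : K, x ^ p ^ 2 = iterateFrobenius K p 2 x := fun x ↦ rfl
  obtain ⟨b, hb⟩ := exists_root_quadratic (-(t + 11)) (-1)
  have hb₀ : b ≠ 0 := by
    rintro rfl
    simp at hb
  have htb : t = b - b⁻¹ - 11 := by
    field_simp
    linear_combination -hb
  have hΔ : (tateCurve b b).Δ = b ^ 6 * t := by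
    simp only [WeierstrassCurve.Δ, b₂, b₄, b₆, b₈, tateCurve]
    linear_combination b ^ 5 * hb
  have : WeierstrassCurve.IsElliptic (tateCurve b b) :=
    ⟨by rw [hΔ]; exact (mul_ne_zero (pow_ne_zero 6 hb₀) ht).isUnit⟩
  have hW : j * (tateCurve b b).Δ = (tateCurve b b).c₄ ^ 3 := by
    rw [hΔ, mul_left_comm, hjt, htb]
    simp only [c₄, b₂, b₄, tateCurve]
    field_simp
    ring
  obtain ⟨α, β, -, hαβ, hf⟩ := exists_xRep_prime_nsmul_eq hp hj hW
  have h5 := five_nsmul_tatePoint hb₀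
  obtain ⟨h₂, e₂⟩ := two_nsmul_tatePoint (c := b) hb₀
  have r₁ : (1 • tatePoint b b).xRep = ![0, 1] := by
    rw [one_nsmul]
    rfl
  have r₂ : (2 • tatePoint b b).xRep = ![b, 1] := by rw [e₂, Affine.Point.xRep_some]
  have r₃ : (3 • tatePoint b b).xRep = ![b, 1] := by
    rw [xRep_nsmul_eq_of_add_eq (m := 2) (n := 5) rfl h5, r₂]
  have r₄ : (4 • tatePoint b b).xRep = ![0, 1] := by
    rw [xRep_nsmul_eq_of_add_eq (m := 1) (n := 5) rfl h5, r₁]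
  have x₁ : (p • tatePoint b b).xRep = ![β, 1] := by
    have := hαβ 0 0 tateCurve_nonsingular
    rwa [zero_pow hq, mul_zero, zero_add] at this
  have x₂ : (p • 2 • tatePoint b b).xRep = ![α * b ^ p ^ 2 + β, 1] := by
    rw [e₂]
    exact hαβ _ _ h₂
  rw [smul_smul, nsmul_eq_mod_nsmul _ h5] at x₂
  rw [nsmul_eq_mod_nsmul _ h5] at x₁
  have hx : (β = 0 ∧ α * b ^ p ^ 2 + β = b) ∨ (β = b ∧ α * b ^ p ^ 2 + β = 0) := by
    have hm : p % 5 ≠ 0 := fun h ↦ by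
      have := (Nat.dvd_prime Fact.out).mp (Nat.dvd_of_mod_eq_zero h)
      omega
    have hm : p % 5 = 1 ∧ p * 2 % 5 = 2 ∨ p % 5 = 2 ∧ p * 2 % 5 = 4 ∨
      p % 5 = 3 ∧ p * 2 % 5 = 1 ∨ p % 5 = 4 ∧ p * 2 % 5 = 3 := by
      rcases (by omega : p % 5 = 1 ∨ p % 5 = 2 ∨ p % 5 = 3 ∨ p % 5 = 4) with h | h | h | h <;> omega
    rcases hm with ⟨hm, hm'⟩ | ⟨hm, hm'⟩ | ⟨hm, hm'⟩ | ⟨hm, hm'⟩ <;>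
      simp only [hm, hm', r₁, r₂, r₃, r₄, Matrix.vecCons_inj, and_true] at x₁ x₂ <;>
      first | exact .inl ⟨x₁.symm, x₂.symm⟩ | exact .inr ⟨x₁.symm, x₂.symm⟩
  have hB : b ^ p ^ 2 ≠ 0 := pow_ne_zero _ hb₀
  have hf₀ := hf 0
  have f₀ : (tateCurve b b).Ψ₂Sq.eval 0 = b ^ 2 := by
    simp [Ψ₂Sq, b₂, b₄, b₆, tateCurve]
  have f₁ : (tateCurve b b).Ψ₂Sq.eval b = b ^ 4 := by
    simp only [Ψ₂Sq, b₂, b₄, b₆, tateCurve, eval_add, eval_mul, eval_C, eval_X, eval_pow]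
    ring
  rw [zero_pow hq, mul_zero, zero_add, f₀, pow_right_comm] at hf₀
  rw [htb, frob, map_sub, map_sub, map_inv₀, map_ofNat, ← frob]
  generalize b ^ p ^ 2 = B at *
  rcases hx with ⟨rfl, hB'⟩ | ⟨rfl, hB'⟩
  · have : B = b := by
      rw [f₀] at hf₀
      refine mul_left_cancel₀ (pow_ne_zero 2 hb₀) ?_
      rw [add_zero] at hB'
      calc b ^ 2 * B = (α * B) ^ 3 := by linear_combination B * hf₀
        _ = _ := by rw [hB']; ring
    rw [this]
  · have : B = -β⁻¹ := by
      rw [f₁] at hf₀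
      refine mul_left_cancel₀ (pow_ne_zero 4 hb₀) ?_
      calc β ^ 4 * B = (α * B) ^ 3 := by linear_combination B * hf₀
        _ = _ := by
          rw [eq_neg_of_add_eq_zero_left hB']
          field_simp
    rw [this]
    field_simp
    ring

lemma pow_eq_of_seven_torsion (hp : 5 ≤ p) (hp7 : p ≠ 7) {j t : K} (hj : aeval j (ssp p) = 0)
    (ht : t ≠ 0) (hjt : j * t = (t ^ 2 + 13 * t + 49) * (t ^ 2 + 5 * t + 1) ^ 3) :
    t ^ p ^ 2 = t := by
  classical
  have : CharP K p := charP_of_injective_algebraMap (algebraMap (ZMod p) K).injective p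
  have : ExpChar K p := .prime Fact.out
  have hq : p ^ 2 ≠ 0 := pow_ne_zero 2 (Fact.out : p.Prime).ne_zero
  have frob : ∀ x : K, x ^ p ^ 2 = iterateFrobenius K p 2 x := fun x ↦ rfl
  obtain ⟨d, hd⟩ := exists_root_cubic (-(t + 8)) (t + 5) 1
  have h₀ : d ≠ 0 := by
    rintro rfl
    simp at hd
  have h₁ : d - 1 ≠ 0 := fun h ↦ by
    have h := sub_eq_zero.mp h
    subst h
    exact one_ne_zero (α := K) (by linear_combination -hd)
  have hc : d ^ 2 - d ≠ 0 := by
    rw [show d ^ 2 - d = d * (d - 1) by ring]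
    exact mul_ne_zero h₀ h₁
  have hb : d ^ 3 - d ^ 2 ≠ 0 := by
    rw [show d ^ 3 - d ^ 2 = d * (d ^ 2 - d) by ring]
    exact mul_ne_zero h₀ hc
  have htd : t = (d ^ 3 - 8 * d ^ 2 + 5 * d + 1) / (d * (d - 1)) := by
    field_simp
    linear_combination -hd
  have hΔ : (tateCurve (d ^ 3 - d ^ 2) (d ^ 2 - d)).Δ = (d * (d - 1)) ^ 8 * t := by
    simp only [WeierstrassCurve.Δ, b₂, b₄, b₆, b₈, tateCurve]
    linear_combination (d * (d - 1)) ^ 7 * hd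
  have : WeierstrassCurve.IsElliptic (tateCurve (d ^ 3 - d ^ 2) (d ^ 2 - d)) :=
    ⟨by rw [hΔ]; exact (mul_ne_zero (pow_ne_zero 8 (mul_ne_zero h₀ h₁)) ht).isUnit⟩
  have hW : j * (tateCurve (d ^ 3 - d ^ 2) (d ^ 2 - d)).Δ =
      (tateCurve (d ^ 3 - d ^ 2) (d ^ 2 - d)).c₄ ^ 3 := by
    rw [hΔ, mul_left_comm, hjt, htd]
    simp only [c₄, b₂, b₄, tateCurve]
    field_simp
    ring
  obtain ⟨α, β, hα, hαβ, -⟩ := exists_xRep_prime_nsmul_eq hp hj hW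
  have h7 := seven_nsmul_tatePoint h₀ h₁
  obtain ⟨h₂, e₂⟩ := two_nsmul_tatePoint (c := d ^ 2 - d) hb
  obtain ⟨h₃, e₃⟩ := three_nsmul_tatePoint (c := d ^ 2 - d) hb
  have r₁ : (1 • tatePoint (d ^ 3 - d ^ 2) (d ^ 2 - d)).xRep = ![0, 1] := by
    rw [one_nsmul]
    rfl
  have r₂ : (2 • tatePoint (d ^ 3 - d ^ 2) (d ^ 2 - d)).xRep = ![d ^ 3 - d ^ 2, 1] := by
    rw [e₂, Affine.Point.xRep_some]
  have r₃ : (3 • tatePoint (d ^ 3 - d ^ 2) (d ^ 2 - d)).xRep = ![d ^ 2 - d, 1] := by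
    rw [e₃, Affine.Point.xRep_some]
  have r₄ : (4 • tatePoint (d ^ 3 - d ^ 2) (d ^ 2 - d)).xRep = ![d ^ 2 - d, 1] := by
    rw [xRep_nsmul_eq_of_add_eq (m := 3) (n := 7) rfl h7, r₃]
  have r₅ : (5 • tatePoint (d ^ 3 - d ^ 2) (d ^ 2 - d)).xRep = ![d ^ 3 - d ^ 2, 1] := by
    rw [xRep_nsmul_eq_of_add_eq (m := 2) (n := 7) rfl h7, r₂]
  have r₆ : (6 • tatePoint (d ^ 3 - d ^ 2) (d ^ 2 - d)).xRep = ![0, 1] := by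
    rw [xRep_nsmul_eq_of_add_eq (m := 1) (n := 7) rfl h7, r₁]
  have x₁ : (p • tatePoint (d ^ 3 - d ^ 2) (d ^ 2 - d)).xRep = ![β, 1] := by
    have := hαβ 0 0 tateCurve_nonsingular
    rwa [zero_pow hq, mul_zero, zero_add] at this
  have x₂ : (p • 2 • tatePoint (d ^ 3 - d ^ 2) (d ^ 2 - d)).xRep =
      ![α * (d ^ 3 - d ^ 2) ^ p ^ 2 + β, 1] := by
    rw [e₂]
    exact hαβ _ _ h₂
  have x₃ : (p • 3 • tatePoint (d ^ 3 - d ^ 2) (d ^ 2 - d)).xRep =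
      ![α * (d ^ 2 - d) ^ p ^ 2 + β, 1] := by
    rw [e₃]
    exact hαβ _ _ h₃
  rw [smul_smul, nsmul_eq_mod_nsmul _ h7] at x₂ x₃
  rw [nsmul_eq_mod_nsmul _ h7] at x₁
  have hbc : (d ^ 3 - d ^ 2) ^ p ^ 2 = d ^ p ^ 2 * (d ^ 2 - d) ^ p ^ 2 := by
    rw [← mul_pow]
    congr 1
    ring
  rw [hbc] at x₂
  have hC : α * (d ^ 2 - d) ^ p ^ 2 ≠ 0 := mul_ne_zero hα (pow_ne_zero _ hc)
  have hD : (d ^ p ^ 2 = d ∨ d ^ p ^ 2 * d = d - 1) ∨ d ^ p ^ 2 * (d - 1) = -1 := by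
    have hm : p % 7 ≠ 0 := fun h ↦ by
      have := (Nat.dvd_prime Fact.out).mp (Nat.dvd_of_mod_eq_zero h)
      omega
    have hm : ((p % 7 = 1 ∧ p * 2 % 7 = 2 ∧ p * 3 % 7 = 3 ∨
        p % 7 = 6 ∧ p * 2 % 7 = 5 ∧ p * 3 % 7 = 4) ∨
      (p % 7 = 2 ∧ p * 2 % 7 = 4 ∧ p * 3 % 7 = 6 ∨
        p % 7 = 5 ∧ p * 2 % 7 = 3 ∧ p * 3 % 7 = 1)) ∨
      p % 7 = 3 ∧ p * 2 % 7 = 6 ∧ p * 3 % 7 = 2 ∨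
        p % 7 = 4 ∧ p * 2 % 7 = 1 ∧ p * 3 % 7 = 5 := by
      rcases (by omega : p % 7 = 1 ∨ p % 7 = 2 ∨ p % 7 = 3 ∨ p % 7 = 4 ∨ p % 7 = 5 ∨ p % 7 = 6)
        with h | h | h | h | h | h <;> omega
    generalize d ^ p ^ 2 = D at *
    generalize (d ^ 2 - d) ^ p ^ 2 = B at *
    refine hm.imp (Or.imp ?_ ?_) ?_ <;> rintro (⟨hm, hm', hm''⟩ | ⟨hm, hm', hm''⟩) <;>
      simp only [hm, hm', hm'', r₁, r₂, r₃, r₄, r₅, r₆, Matrix.vecCons_inj, and_true]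
        at x₁ x₂ x₃ <;>
      refine mul_left_cancel₀ hC ?_ <;>
      first
      | linear_combination -x₂ + d * x₃ + (1 - d) * x₁
      | linear_combination -d * x₂ + (d - 1) * x₃ + x₁
      | linear_combination -(d - 1) * x₂ - x₃ + d * x₁
  rw [← eq_div_iff h₀, ← eq_div_iff h₁] at hD
  rw [htd, frob, map_div₀]
  simp only [map_add, map_sub, map_mul, map_pow, map_ofNat, map_one]
  rw [← frob]
  rcases hD with (h | h) | h <;> rw [h]
  · rw [show (d - 1) / d - 1 = -1 / d by field_simp; ring]
    field_simp
    ring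
  · rw [show -1 / (d - 1) - 1 = -d / (d - 1) by field_simp; ring]
    field_simp
    ring

end FixedPoints

section Fricke

variable {K : Type*} [Field K] [IsAlgClosed K] {p : ℕ} [Fact p.Prime] [Algebra (ZMod p) K]
  [Algebra.IsAlgebraic (ZMod p) K]

lemma pow_eq_of_fricke_five (hp : 5 ≤ p) (hp5 : p ≠ 5) {j y : K} (hj : aeval j (ssp p) = 0)
    (hy : j ^ 2 - j * (y ^ 5 - 80 * y ^ 4 + 1890 * y ^ 3 - 12600 * y ^ 2 + 7776 * y + 3456) +
      (y ^ 2 + 216 * y + 144) ^ 3 = 0) : y ^ p ^ 2 = y := by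
  have : CharP K p := charP_of_injective_algebraMap (algebraMap (ZMod p) K).injective p
  have : ExpChar K p := .prime Fact.out
  have frob : ∀ x : K, x ^ p ^ 2 = iterateFrobenius K p 2 x := fun x ↦ rfl
  have h5 : (5 : K) ≠ 0 := by
    exact_mod_cast CharP.cast_ne_zero_of_ne_of_prime (p := p) K Nat.prime_five hp5
  obtain ⟨t, ht⟩ := exists_root_quadratic (22 - y) 125
  have ht₀ : t ≠ 0 := by
    rintro rfl
    exact pow_ne_zero 3 h5 (by linear_combination ht)
  have hyt : y = t + 22 + 125 / t := by
    field_simp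
    linear_combination -ht
  have fix : t ^ p ^ 2 = t := by
    have h : (j * t - (t ^ 2 + 10 * t + 5) ^ 3) *
        (j * (125 / t) - ((125 / t) ^ 2 + 10 * (125 / t) + 5) ^ 3) = 0 := by
      rw [← mul_zero (125 : K), ← hy, hyt]
      field_simp
      ring
    rcases mul_eq_zero.mp h with h | h
    · exact pow_eq_of_five_torsion hp hp5 hj ht₀ (sub_eq_zero.mp h)
    · have h₁₂₅ : (125 : K) ≠ 0 := by
        rw [show (125 : K) = 5 ^ 3 by norm_num]
        exact pow_ne_zero 3 h5
      have := pow_eq_of_five_torsion hp hp5 hj (div_ne_zero h₁₂₅ ht₀) (sub_eq_zero.mp h)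
      rw [frob, map_div₀, map_ofNat, ← frob, div_eq_mul_inv, div_eq_mul_inv] at this
      exact inv_injective (mul_left_cancel₀ h₁₂₅ this)
  rw [hyt, frob, map_add, map_add, map_div₀, map_ofNat, map_ofNat, ← frob, fix]

lemma pow_eq_of_fricke_seven (hp : 5 ≤ p) (hp7 : p ≠ 7) {j y : K} (hj : aeval j (ssp p) = 0)
    (hy : j ^ 2 - j * y * (y ^ 2 - 21 * y + 8) *
        (y ^ 4 - 42 * y ^ 3 + 454 * y ^ 2 - 1008 * y - 1280) +
      y ^ 2 * (y ^ 2 + 224 * y + 448) ^ 3 = 0) : y ^ p ^ 2 = y := by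
  have : CharP K p := charP_of_injective_algebraMap (algebraMap (ZMod p) K).injective p
  have : ExpChar K p := .prime Fact.out
  have frob : ∀ x : K, x ^ p ^ 2 = iterateFrobenius K p 2 x := fun x ↦ rfl
  have h7 : (7 : K) ≠ 0 := by
    exact_mod_cast CharP.cast_ne_zero_of_ne_of_prime (p := p) K Nat.prime_seven hp7
  obtain ⟨t, ht⟩ := exists_root_quadratic (13 - y) 49
  have ht₀ : t ≠ 0 := by
    rintro rfl
    exact pow_ne_zero 2 h7 (by linear_combination ht)
  have hyt : y = t + 13 + 49 / t := by
    field_simp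
    linear_combination -ht
  have fix : t ^ p ^ 2 = t := by
    have h : (j * t - (t ^ 2 + 13 * t + 49) * (t ^ 2 + 5 * t + 1) ^ 3) *
        (j * (49 / t) - ((49 / t) ^ 2 + 13 * (49 / t) + 49) *
          ((49 / t) ^ 2 + 5 * (49 / t) + 1) ^ 3) = 0 := by
      rw [← mul_zero (49 : K), ← hy, hyt]
      field_simp
      ring
    rcases mul_eq_zero.mp h with h | h
    · exact pow_eq_of_seven_torsion hp hp7 hj ht₀ (sub_eq_zero.mp h)
    · have h₄₉ : (49 : K) ≠ 0 := by
        rw [show (49 : K) = 7 ^ 2 by norm_num]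
        exact pow_ne_zero 2 h7
      have := pow_eq_of_seven_torsion hp hp7 hj (div_ne_zero h₄₉ ht₀) (sub_eq_zero.mp h)
      rw [frob, map_div₀, map_ofNat, ← frob, div_eq_mul_inv, div_eq_mul_inv] at this
      exact inv_injective (mul_left_cancel₀ h₄₉ this)
  rw [hyt, frob, map_add, map_add, map_div₀, map_ofNat, map_ofNat, ← frob, fix]

end Fricke

end Supersingularity

/-- For a prime `p ≥ 5`, if `j` is a supersingular `j`-invariant in an algebraic
closure of `𝔽_p` and `y` satisfies `R₅(j,y) = 0` (with `p ≠ 5`) or `R₇(j,y) = 0`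
(with `p ≠ 7`), then `y` lies in `𝔽_{p²}`, i.e. `y^{p²} = y`. -/
theorem fricke_5_7_values_in_Fp2 (p : ℕ) [Fact p.Prime] (hp : 5 ≤ p)
    (j y : AlgebraicClosure (ZMod p)) (hj : aeval j (ssp p) = 0)
    (hy : (j ^ 2 - j * (y ^ 5 - 80 * y ^ 4 + 1890 * y ^ 3 - 12600 * y ^ 2 +
              7776 * y + 3456) + (y ^ 2 + 216 * y + 144) ^ 3 = 0 ∧ p ≠ 5) ∨
          (j ^ 2 - j * y * (y ^ 2 - 21 * y + 8) *
              (y ^ 4 - 42 * y ^ 3 + 454 * y ^ 2 - 1008 * y - 1280) +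
            y ^ 2 * (y ^ 2 + 224 * y + 448) ^ 3 = 0 ∧ p ≠ 7)) :
    y ^ p ^ 2 = y := by
  rcases hy with ⟨hy, hp5⟩ | ⟨hy, hp7⟩
  · exact pow_eq_of_fricke_five hp hp5 hj hy
  · exact pow_eq_of_fricke_seven hp hp7 hj hy
end
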